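/- Let t be a rational number with t ≠ 1 and t ≠ 2, and let α ∈ ℂ be a root of f_t. Then the subfield ℚ(α) of ℂ is a Galois extension of ℚ of degree 6, and its Galois group Gal(ℚ(α)/ℚ) is isomorphic to the symmetric group S₃ on three letters. -/

import Mathlib

open Polynomial IntermediateField

noncomputable def u (t : ℚ) : ℚ := (3*t^2 - 2*t + 2) / (t^2 + t - 1)

noncomputable def v (t : ℚ) : ℚ :=
  (t^5 - 5*t^4 + 10*t^3 - 20*t^2 + 15*t - 7) / ((t - 2) * (t^2 + t - 1)^2)

noncomputable def w (t : ℚ) : ℚ :=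
  (-3*t^5 + 10*t^4 - 20*t^3 + 20*t^2 - 20*t + 6) / ((t - 2) * (t^2 + t - 1)^2)

/-- The polynomial `f_t = X⁶ + uX⁵ + vX⁴ + wX³ + vX² + uX + 1 ∈ ℚ[X]`. -/
noncomputable def f (t : ℚ) : Polynomial ℚ :=
  X^6 + C (u t) * X^5 + C (v t) * X^4 + C (w t) * X^3 + C (v t) * X^2 + C (u t) * X + 1

/-! ### The ring of rationals with odd denominator -/

abbrev Z2 : ValuationSubring ℚ := (Rat.padicValuation 2).valuationSubring

lemma mem_Z2 (q : ℚ) : q ∈ Z2 ↔ ¬ 2 ∣ q.den := by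
  rw [Valuation.mem_valuationSubring_iff, Rat.padicValuation_le_one_iff]

lemma Z2_half_not_mem : (1/2 : ℚ) ∉ Z2 := by
  rw [mem_Z2]; norm_num

lemma Z2_two_ne : (2 : Z2) ≠ 0 := by
  intro h
  have := congrArg (Subtype.val) h
  norm_num at this

lemma Z2_not_unit : ¬ IsUnit (2 : Z2) := by
  rintro ⟨⟨a, b, h1, h2⟩, h3⟩
  simp only at h3
  subst h3
  have := congrArg Subtype.val h1
  have hb : (b : ℚ) = 1/2 := by
    have h4 : (2:ℚ) * (b:ℚ) = 1 := this
    linarith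
  exact Z2_half_not_mem (hb ▸ b.2)

lemma Z2_not_dvd_one : ¬ (2 : Z2) ∣ 1 := fun h => Z2_not_unit (isUnit_of_dvd_one h)

lemma Z2_exists_num (x : Z2) : ∃ n d : ℤ, ¬ 2 ∣ d ∧ (d : Z2) * x = n := by
  refine ⟨(x:ℚ).num, (x:ℚ).den, ?_, ?_⟩
  · have := (mem_Z2 x).1 x.2
    omega
  · apply Subtype.ext
    push_cast
    rw [mul_comm]; exact Rat.mul_den_eq_num _

lemma Z2_odd_unit (d : ℤ) (hd : ¬ 2 ∣ d) : IsUnit (d : Z2) := by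
  have hd0 : d ≠ 0 := by rintro rfl; simp at hd
  have hm : (1 / (d:ℚ)) ∈ Z2 := by
    rw [mem_Z2]
    have h1 : (1 / (d:ℚ)) = ((1:ℤ) : ℚ) / ((d:ℤ):ℚ) := by norm_num
    rw [h1]
    intro h
    have h2 : (((((1:ℤ):ℚ)/((d:ℤ):ℚ)).den : ℤ)) ∣ d := by
      rw [← Rat.divInt_eq_div]; exact Rat.den_dvd 1 d
    exact hd ((Int.natCast_dvd_natCast.2 h).trans h2)
  refine IsUnit.of_mul_eq_one ⟨_, hm⟩ ?_
  apply Subtype.ext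
  push_cast
  have : (d:ℚ) ≠ 0 := by exact_mod_cast hd0
  field_simp

lemma Z2_parity (x : Z2) : (2 : Z2) ∣ x ∨ (2 : Z2) ∣ x - 1 := by
  obtain ⟨n, d, hd, h⟩ := Z2_exists_num x
  obtain ⟨e, he⟩ := Z2_odd_unit d hd
  have key : ∀ y : Z2, (2:Z2) ∣ d * y → (2:Z2) ∣ y := by
    intro y hy
    rw [← he] at hy
    exact (Units.dvd_mul_left).1 hy
  rcases Int.even_or_odd' n with ⟨k, hk | hk⟩
  · left; apply key; rw [h, hk]; push_cast; exact Dvd.intro _ rfl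
  · right; apply key
    obtain ⟨j, hj⟩ : ∃ j, d = 2 * j + 1 := by
      rcases Int.even_or_odd' d with ⟨j, hj | hj⟩
      · omega
      · exact ⟨j, hj⟩
    rw [mul_sub, h, hk, hj]; push_cast
    exact ⟨k - j, by ring⟩

lemma Z2_isUnit {x : Z2} (h : ¬ (2:Z2) ∣ x) : IsUnit x := by
  obtain ⟨n, d, hd, hx⟩ := Z2_exists_num x
  have hn : ¬ (2:ℤ) ∣ n := by
    rintro ⟨k, hk⟩
    obtain ⟨e, he⟩ := Z2_odd_unit d hd
    apply h
    have : (2:Z2) ∣ e * x := by rw [he, hx, hk]; push_cast; exact Dvd.intro _ rfl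
    exact (Units.dvd_mul_left).1 this
  have := Z2_odd_unit n hn
  rw [← hx] at this
  exact isUnit_of_mul_isUnit_right this

lemma Z2_isUnit_iff {x : Z2} : IsUnit x ↔ ¬ (2:Z2) ∣ x :=
  ⟨fun h h2 => Z2_not_unit (isUnit_of_dvd_unit h2 h), Z2_isUnit⟩

lemma Z2_prime : Prime (2 : Z2) := by
  refine ⟨Z2_two_ne, Z2_not_unit, fun a b h => ?_⟩
  by_contra hc
  push Not at hc
  exact Z2_isUnit_iff.1 ((Z2_isUnit hc.1).mul (Z2_isUnit hc.2)) h

/-- odd elements -/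
lemma Z2_odd_iff {x : Z2} : ¬ (2:Z2) ∣ x ↔ (2:Z2) ∣ x - 1 := by
  constructor
  · intro h; exact (Z2_parity x).resolve_left h
  · intro h h2
    apply Z2_not_dvd_one
    have := dvd_sub h2 h
    simpa using this

lemma Z2_eq_zero {x : Z2} (h : ∀ k : ℕ, (2:Z2)^k ∣ x) : x = 0 := by
  obtain ⟨n, d, hd, hx⟩ := Z2_exists_num x
  obtain ⟨e, he⟩ := Z2_odd_unit d hd
  by_contra hx0
  have hn0 : n ≠ 0 := by
    rintro rfl
    rw [← he] at hx
    simp at hx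
    exact hx0 hx
  -- 2^k divides n in Z
  have hk : ∀ k : ℕ, (2:ℤ)^k ∣ n := by
    intro k
    obtain ⟨y, hy⟩ := h k
    obtain ⟨n', d', hd', hx'⟩ := Z2_exists_num y
    have h1 : (d' * n : ℤ) = d * 2^k * n' := by
      have : ((d' * n : ℤ) : Z2) = ((d * 2^k * n' : ℤ) : Z2) := by
        push_cast
        rw [← hx, ← hx', hy]; ring
      have h3 := congrArg Subtype.val this
      push_cast at h3
      exact_mod_cast h3
    have hc : IsCoprime ((2:ℤ)^k) d' := by
      apply IsCoprime.pow_left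
      exact (Int.prime_two.coprime_iff_not_dvd).2 hd'
    apply hc.dvd_of_dvd_mul_left
    rw [h1]; exact ⟨d * n', by ring⟩
  have := hk n.natAbs
  have h2 := Int.natAbs_dvd_natAbs.2 this
  have h3 := Nat.le_of_dvd (by omega) h2
  rw [Int.natAbs_pow] at h3
  have := Nat.lt_two_pow_self (n := n.natAbs)
  simp at h3
  omega

lemma Z2_mem_or_inv (q : ℚ) : q ∈ Z2 ∨ q⁻¹ ∈ Z2 := Z2.mem_or_inv_mem q

lemma Z2_pow_mem {q : ℚ} {n : ℕ} (hn : n ≠ 0) (h : q^n ∈ Z2) : q ∈ Z2 := by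
  rw [Valuation.mem_valuationSubring_iff] at *
  rw [map_pow] at h
  exact (pow_le_one_iff hn).1 h

/-- If `q` is not integral, its inverse is an even element. -/
lemma Z2_inv_even {q : ℚ} (h : q ∉ Z2) : ∃ r : Z2, (2:Z2) ∣ r ∧ (r:ℚ) = q⁻¹ := by
  have h1 := (Z2_mem_or_inv q).resolve_left h
  refine ⟨⟨q⁻¹, h1⟩, ?_, rfl⟩
  by_contra hc
  obtain ⟨y, hy⟩ := (Z2_isUnit hc).exists_right_inv
  have := congrArg Subtype.val hy
  have h2 : q⁻¹ * (y:ℚ) = 1 := by simpa using this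
  have hq : q ≠ 0 := by rintro rfl; exact h Z2.zero_mem
  have : (y:ℚ) = q := by field_simp at h2; exact h2
  exact h (this ▸ y.2)

lemma Z2_inv_coe {x : Z2} (h : ¬ (2:Z2) ∣ x) : ∃ y : Z2, x * y = 1 ∧ (y:ℚ) = (x:ℚ)⁻¹ := by
  obtain ⟨y, hy⟩ := (Z2_isUnit h).exists_right_inv
  refine ⟨y, hy, ?_⟩
  have := congrArg Subtype.val hy
  have h2 : (x:ℚ) * (y:ℚ) = 1 := by simpa using this
  exact eq_inv_of_mul_eq_one_right h2

/-- A nonzero finite family of rationals may be scaled to a primitive one. -/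
lemma Z2_primitive {n : ℕ} (x : Fin n → ℚ) (hx : x ≠ 0) :
    ∃ (c : ℚ) (y : Fin n → Z2), c ≠ 0 ∧ (∀ i, (y i : ℚ) = c * x i) ∧ ∃ i, ¬ (2:Z2) ∣ y i := by
  obtain ⟨i0, hi0⟩ := Function.ne_iff.1 hx
  have hne : (Finset.univ : Finset (Fin n)).Nonempty := ⟨i0, Finset.mem_univ _⟩
  obtain ⟨i, -, hi⟩ := Finset.exists_max_image Finset.univ
    (fun i => Rat.padicValuation 2 (x i)) hne
  have hi1 : x i ≠ 0 := by
    intro h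
    have := hi i0 (Finset.mem_univ _)
    rw [h, map_zero, le_zero_iff, Rat.padicValuation_eq_zero_iff] at this
    exact hi0 this
  refine ⟨(x i)⁻¹, fun j => ⟨(x i)⁻¹ * x j, ?_⟩, inv_ne_zero hi1, fun j => rfl, i, ?_⟩
  · rw [Valuation.mem_valuationSubring_iff, map_mul, map_inv₀]
    have h0 : Rat.padicValuation 2 (x i) ≠ 0 := by
      rw [Ne, Rat.padicValuation_eq_zero_iff]; exact hi1
    calc (Rat.padicValuation 2 (x i))⁻¹ * Rat.padicValuation 2 (x j)
        ≤ (Rat.padicValuation 2 (x i))⁻¹ * Rat.padicValuation 2 (x i) := by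
          gcongr; exact hi j (Finset.mem_univ _)
      _ = 1 := inv_mul_cancel₀ h0
  · have : (⟨(x i)⁻¹ * x i, by rw [inv_mul_cancel₀ hi1]; exact Z2.one_mem⟩ : Z2) = 1 := by
      apply Subtype.ext; simp [hi1]
    change ¬ (2:Z2) ∣ (⟨(x i)⁻¹ * x i, _⟩ : Z2)
    rw [this]; exact Z2_not_dvd_one

@[simp, norm_cast] lemma Z2_coe_two : ((2 : Z2) : ℚ) = 2 := rfl

lemma Z2_coe_ofNat (n : ℕ) [n.AtLeastTwo] : ((OfNat.ofNat n : Z2) : ℚ) = OfNat.ofNat n := rfl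

/-! ### Descent -/

/-- Coefficients of a divisor on `y² + y = x⁵` reducing to twice the point `(0,0)` modulo 2. -/
def Datum (a1 a0 m1 m0 : Z2) : Prop :=
  (2:Z2) ∣ a1 ∧ (2:Z2) ∣ a0 ∧ (2:Z2) ∣ m1 ∧ (2:Z2) ∣ m0 ∧
  ∃ c2 c1 c0 : Z2, m1^2 = c2 ∧ 2*m1*m0 - 1 = c1 + a1*c2 ∧ m0^2 = c0 + a1*c1 + a0*c2 ∧
    m1 = a1*c0 + a0*c1 ∧ m0 = a0*c0

lemma Z2_dvd_of_unit_mul {d x y : Z2} (hx : ¬ (2:Z2) ∣ x) (h : d ∣ x * y) : d ∣ y := by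
  obtain ⟨e, he⟩ := Z2_isUnit hx
  rw [← he] at h
  exact (Units.dvd_mul_left).1 h

lemma Z2_odd_add_two {x y : Z2} (h : x = 1 + 2 * y) : ¬ (2:Z2) ∣ x := by
  rw [Z2_odd_iff]; exact ⟨y, by rw [h]; ring⟩

lemma datum_of_mumford (α1 α0 b3 b2 b1 b0 c4 c3 c2 c1 c0 : Z2)
    (hα1 : (2:Z2) ∣ α1) (hα0 : (2:Z2) ∣ α0) (hb3 : (2:Z2) ∣ b3) (hb2 : (2:Z2) ∣ b2)
    (hb1 : (2:Z2) ∣ b1) (hb0 : (2:Z2) ∣ b0)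
    (h0 : b0^2 + b0 = α0*c0)
    (h1 : 2*b0*b1 + b1 = α0*c1 + α1*c0)
    (h2 : b1^2 + 2*b0*b2 + b2 = α0*c2 + α1*c1 + c0)
    (h3 : 2*b0*b3 + 2*b1*b2 + b3 = α0*c3 + α1*c2 + c1)
    (h4 : b2^2 + 2*b1*b3 = α0*c4 + α1*c3 + c2)
    (h5 : 2*b2*b3 - 1 = α1*c4 + c3)
    (h6 : b3^2 = c4) : ∃ m1 m0, Datum α1 α0 m1 m0 := by
  obtain ⟨β0, hβ0⟩ := hb0
  obtain ⟨A1, hA1⟩ := hα1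
  obtain ⟨A0, hA0⟩ := hα0
  obtain ⟨β1, hβ1⟩ := hb1
  obtain ⟨β2, hβ2⟩ := hb2
  obtain ⟨β3, hβ3⟩ := hb3
  obtain ⟨i0, hi0, -⟩ := Z2_inv_coe (x := 1 + b0) (Z2_odd_add_two (y := β0) (by rw [hβ0]))
  obtain ⟨i1, hi1, -⟩ := Z2_inv_coe (x := 1 + 2*b0) (Z2_odd_add_two (y := b0) rfl)
  have hc0 : (2:Z2) ∣ c0 := ⟨2*β1^2 + 2*b0*β2 + β2 - A0*c2 - A1*c1, by
    have : c0 = b1^2 + 2*b0*b2 + b2 - α0*c2 - α1*c1 := by linear_combination -h2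
    rw [this, hβ1, hβ2, hA0, hA1]; ring⟩
  have hc1 : (2:Z2) ∣ c1 := ⟨b0*b3 + b1*b2 + β3 - A0*c3 - A1*c2, by
    have : c1 = 2*b0*b3 + 2*b1*b2 + b3 - α0*c3 - α1*c2 := by linear_combination -h3
    rw [this, hβ3, hA0, hA1]; ring⟩
  obtain ⟨γ0, hγ0⟩ := hc0
  obtain ⟨γ1, hγ1⟩ := hc1
  obtain ⟨k0, hk0⟩ : ∃ k0, k0 = -c0 * i0 := ⟨_, rfl⟩
  obtain ⟨k1, hk1⟩ : ∃ k1, k1 = (α1*k0^2 - c1) * i1 := ⟨_, rfl⟩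
  have e0 : c0 = -k0*(1+b0) := by rw [hk0]; linear_combination -c0*hi0
  have e1 : (1+2*b0)*k1 = α1*k0^2 - c1 := by rw [hk1]; linear_combination (α1*k0^2 - c1)*hi1
  have e2 : b0 + α0*k0 = 0 := by
    linear_combination i0*(h0 + α0 * e0) - (b0 + α0*k0)*hi0
  have e3 : b1 + α0*k1 + α1*k0 = 0 := by
    have : (1+2*b0)*(b1 + α0*k1 + α1*k0) = 0 := by
      linear_combination h1 + α1*e0 + α0*e1 + α1*k0*e2
    linear_combination i1*this - (b1 + α0*k1 + α1*k0)*hi1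
  refine ⟨b3 + k1, b2 + k0 + α1*k1, ⟨A1, hA1⟩, ⟨A0, hA0⟩,
    ⟨β3 + (A1*k0^2 - γ1)*i1, by rw [hk1, hβ3, hγ1, hA1]; ring⟩,
    ⟨β2 - γ0*i0 + A1*k1, by rw [hA1, hβ2]; linear_combination hk0 - i0 * hγ0⟩,
    c4 + 2*b3*k1 + k1^2, c3 + 2*b3*k0 + 2*b2*k1 + 2*k0*k1 + α1*k1^2,
    c2 + 2*b2*k0 + 2*b1*k1 + k0^2 + 2*α1*k0*k1 + α0*k1^2, ?_, ?_, ?_, ?_, ?_⟩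
  · linear_combination h6
  · linear_combination h5
  · linear_combination h4 - 2 * (b3+k1) * e3
  · have e4 : c1 + k1 + 2*b0*k1 + 2*b1*k0 + 2*α0*k0*k1 + α1*k0^2 = 0 := by
      linear_combination e1 + 2*k0*e3
    linear_combination h3 + e4 - 2 * (b2+k0+α1*k1) * e3 - 2 * (b3+k1)*e2
  · have e5 : c0 + k0 + 2*b0*k0 + α0*k0^2 = 0 := by linear_combination e0 + k0*e2
    have e4 : c1 + k1 + 2*b0*k1 + 2*b1*k0 + 2*α0*k0*k1 + α1*k0^2 = 0 := by
      linear_combination e1 + 2*k0*e3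
    linear_combination h2 + α1*e4 + e5 - 2*(b2+k0+α1*k1)*e2 - (b1 + α0*k1 + α1*k0)*e3

/-- Level part of the descent. -/
lemma descent_level (a1 a0 m1 m0 c2 c1 c0 n2 n1 n0 q1 q0 : Z2) (k : ℕ) (hk : 1 ≤ k)
    (hq0 : (2:Z2) ∣ q0)
    (d0 : n0^2 = -q0 + q0^2*c0)
    (d1 : 2*n0*n1 = -q1 + 2*q0*q1*c0 + q0^2*c1)
    (d2 : n1^2 + 2*n0*n2 = a0 - 2*q0*m0 + q1^2*c0 + 2*q0*q1*c1 + q0^2*c2)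
    (d3 : 2*n1*n2 = a1 - 2*(q0*m1+q1*m0) + q1^2*c1 + 2*q0*q1*c2)
    (hn1 : (2:Z2)^k ∣ n1) (hn0 : (2:Z2)^k ∣ n0) : (2:Z2)^(k+1) ∣ a1 ∧ (2:Z2)^(k+1) ∣ a0 := by
  obtain ⟨j, rfl⟩ := Nat.exists_eq_add_of_le hk
  obtain ⟨N1, hN1⟩ := hn1
  obtain ⟨N0, hN0⟩ := hn0
  obtain ⟨Q0, hQ0⟩ := hq0
  obtain ⟨g, hg⟩ : ∃ g : Z2, g = 2^j := ⟨_, rfl⟩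
  have p1 : (2:Z2)^(1+j) = 2*g := by rw [hg]; ring
  have p2 : (2:Z2)^(1+j+1) = 4*g := by rw [hg]; ring
  rw [p1] at hN1 hN0
  rw [p2]
  have hq0' : 4*g ∣ q0 := by
    apply Z2_dvd_of_unit_mul (x := 1 - q0*c0)
      (Z2_odd_add_two (y := -Q0*c0) (by rw [hQ0]; ring))
    exact ⟨-g*N0^2, by rw [hN0] at d0; linear_combination d0⟩
  have hq1' : 4*g ∣ q1 := by
    apply Z2_dvd_of_unit_mul (x := 1 - 2*q0*c0) (Z2_odd_add_two (y := -q0*c0) (by ring))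
    obtain ⟨z, hz⟩ := hq0'
    exact ⟨q0*c1*z - 2*g*N0*N1, by
      rw [hN0, hN1] at d1; linear_combination d1 + q0*c1*hz⟩
  obtain ⟨z0, hz0⟩ := hq0'
  obtain ⟨z1, hz1⟩ := hq1'
  constructor
  · exact ⟨N1*n2 + 2*(z0*m1+z1*m0) - z1*q1*c1 - 2*z0*q1*c2, by
      rw [hN1] at d3
      linear_combination -d3 + 2*(hz0*m1+hz1*m0) - hz1*q1*c1 - 2*hz0*q1*c2⟩
  · exact ⟨g*N1^2 + N0*n2 + 2*z0*m0 - z1*q1*c0 - 2*z0*q1*c1 - z0*q0*c2, by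
      rw [hN1, hN0] at d2
      linear_combination -d2 + 2*hz0*m0 - hz1*q1*c0 - 2*hz0*q1*c1 - hz0*q0*c2⟩

/-- New datum. -/
lemma descent_datum (a1 a0 m1 m0 c2 c1 c0 n2 n1 n0 q1 q0 : Z2)
    (hm1 : (2:Z2) ∣ m1) (hm0 : (2:Z2) ∣ m0)
    (f2 : m1^2 = c2) (f1 : 2*m1*m0 - 1 = c1 + a1*c2) (f0 : m0^2 = c0 + a1*c1 + a0*c2)
    (g1 : m1 = a1*c0 + a0*c1) (g0 : m0 = a0*c0)
    (hq0 : (2:Z2) ∣ q0) (hq1 : (2:Z2) ∣ q1) (hn1 : (2:Z2) ∣ n1) (hn0 : (2:Z2) ∣ n0)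
    (hn2 : ¬ (2:Z2) ∣ n2)
    (d0 : n0^2 = -q0 + q0^2*c0)
    (d1 : 2*n0*n1 = -q1 + 2*q0*q1*c0 + q0^2*c1)
    (d2 : n1^2 + 2*n0*n2 = a0 - 2*q0*m0 + q1^2*c0 + 2*q0*q1*c1 + q0^2*c2)
    (d3 : 2*n1*n2 = a1 - 2*(q0*m1+q1*m0) + q1^2*c1 + 2*q0*q1*c2)
    (d4 : n2^2 = 1 - 2*q1*m1 + q1^2*c2) :
    ∃ α1 α0 m1' m0' : Z2, n1 = n2 * α1 ∧ n0 = n2*α0 ∧ Datum α1 α0 m1' m0' := by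
  obtain ⟨i, hi, -⟩ := Z2_inv_coe hn2
  have z1 : n1 = n2 * (i*n1) := by linear_combination -n1*hi
  have z0 : n0 = n2 * (i*n0) := by linear_combination -n0*hi
  obtain ⟨α1, hα1⟩ : ∃ x, x = i*n1 := ⟨_, rfl⟩
  obtain ⟨α0, hα0⟩ : ∃ x, x = i*n0 := ⟨_, rfl⟩
  rw [← hα1] at z1
  rw [← hα0] at z0
  have ev1 : (2:Z2) ∣ α1 := hα1 ▸ hn1.mul_left i
  have ev0 : (2:Z2) ∣ α0 := hα0 ▸ hn0.mul_left i
  -- c = n2^2 * C * (x^2+α1 x+α0)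
  obtain ⟨m1', m0', h⟩ := datum_of_mumford α1 α0 (m1 - q1*c2) (m0 - q1*c1 - q0*c2)
    (-q1*c0-q0*c1) (-q0*c0)
    (n2^2*c2) (n2^2*(c1 + α1*c2)) (n2^2*(c0+α1*c1+α0*c2)) (n2^2*(α1*c0+α0*c1)) (n2^2*(α0*c0))
    ev1 ev0 (dvd_sub hm1 (hq1.mul_right _))
    (dvd_sub (dvd_sub hm0 (hq1.mul_right _)) (hq0.mul_right _))
    (dvd_sub ((dvd_neg.2 hq1).mul_right _) (hq0.mul_right _)) ((dvd_neg.2 hq0).mul_right _)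
    (by
      rw [z0] at d0
      linear_combination -c0*d0)
    (by
      rw [z0, z1] at d1; rw [z0] at d0
      linear_combination -c0*d1 - c1*d0)
    (by
      rw [z0, z1] at d1 d2; rw [z0] at d0
      linear_combination -c0*d2 - c1*d1 - c2*d0 + g0)
    (by
      rw [z0, z1] at d1 d2; rw [z0] at d0; rw [z1] at d3
      linear_combination -c0*d3 - c1*d2 - c2*d1 + g1)
    (by
      rw [z0, z1] at d1 d2; rw [z0] at d0; rw [z1] at d3
      linear_combination -c0*d4 - c1*d3 - c2*d2 + f0)
    (by
      rw [z1] at d3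
      linear_combination -c1*d4 - c2*d3 + f1)
    (by linear_combination -c2*d4 + f2)
  exact ⟨α1, α0, m1', m0', z1, z0, h⟩

/-- The parity part of the descent. -/
lemma descent_parity (a1 a0 m1 m0 c2 c1 c0 n2 n1 n0 l q1 q0 : Z2)
    (ha1 : (2:Z2) ∣ a1) (ha0 : (2:Z2) ∣ a0)
    (hm1 : (2:Z2) ∣ m1) (hm0 : (2:Z2) ∣ m0)
    (f2 : m1^2 = c2) (f1 : 2*m1*m0 - 1 = c1 + a1*c2) (f0 : m0^2 = c0 + a1*c1 + a0*c2)
    (d0 : n0^2 = -l*q0 + q0^2*c0)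
    (d1 : 2*n0*n1 = -l*q1 + 2*q0*q1*c0 + q0^2*c1)
    (d2 : n1^2 + 2*n0*n2 = l^2*a0 - 2*l*q0*m0 + q1^2*c0 + 2*q0*q1*c1 + q0^2*c2)
    (d3 : 2*n1*n2 = l^2*a1 - 2*l*(q0*m1+q1*m0) + q1^2*c1 + 2*q0*q1*c2)
    (d4 : n2^2 = l^2 - 2*l*q1*m1 + q1^2*c2)
    (hp : ¬ ((2:Z2) ∣ n2 ∧ (2:Z2) ∣ n1 ∧ (2:Z2) ∣ n0 ∧ (2:Z2) ∣ l ∧ (2:Z2) ∣ q1 ∧ (2:Z2) ∣ q0)) :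
    (2:Z2) ∣ q0 ∧ (2:Z2) ∣ q1 ∧ (2:Z2) ∣ n1 ∧ (2:Z2) ∣ n0 ∧ ¬ (2:Z2) ∣ n2 ∧ ¬ (2:Z2) ∣ l := by
  obtain ⟨A1, hA1⟩ := ha1
  obtain ⟨A0, hA0⟩ := ha0
  obtain ⟨M1, hM1⟩ := hm1
  obtain ⟨M0, hM0⟩ := hm0
  have hsq : ∀ x : Z2, (2:Z2) ∣ x^2 → (2:Z2) ∣ x := fun x h => Z2_prime.dvd_of_dvd_pow h
  have hc2 : (2:Z2) ∣ c2 := ⟨2*M1^2, by rw [← f2, hM1]; ring⟩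
  obtain ⟨C2, hC2⟩ := hc2
  have hc0 : (2:Z2) ∣ c0 := ⟨2*M0^2 - A1*c1 - A0*c2, by
    have : c0 = m0^2 - a1*c1 - a0*c2 := by linear_combination -f0
    rw [this, hM0, hA1, hA0]; ring⟩
  obtain ⟨C0, hC0⟩ := hc0
  have hc1 : ¬ (2:Z2) ∣ c1 := Z2_odd_add_two (y := m1*m0 - 1 - A1*c2) (by
    have : c1 = 2*m1*m0 - 1 - a1*c2 := by linear_combination -f1
    rw [this, hA1]; ring)
  have hq1 : (2:Z2) ∣ q1 := by
    apply hsq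
    apply Z2_dvd_of_unit_mul hc1
    exact ⟨n1*n2 - l^2*A1 + l*(q0*m1+q1*m0) - q0*q1*c2, by
      rw [hA1] at d3; linear_combination -d3⟩
  obtain ⟨Q1, hQ1⟩ := hq1
  have hq0 : (2:Z2) ∣ q0 := by
    apply hsq
    apply Z2_dvd_of_unit_mul hc1
    exact ⟨n0*n1 + l*Q1 - q0*q1*c0, by linear_combination -d1 + l*hQ1⟩
  obtain ⟨Q0, hQ0⟩ := hq0
  have hn1 : (2:Z2) ∣ n1 := by
    apply hsq
    exact ⟨-n0*n2 + l^2*A0 - l*q0*m0 + q1^2*C0 + q0*q1*c1 + q0^2*C2, by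
      linear_combination d2 + l^2*hA0 + q1^2*hC0 + q0^2*hC2⟩
  have hn0 : (2:Z2) ∣ n0 := by
    apply hsq
    exact ⟨-l*Q0 + q0^2*C0, by linear_combination d0 - l*hQ0 + q0^2*hC0⟩
  have h42 : (2:Z2) ∣ n2 ↔ (2:Z2) ∣ l := by
    constructor
    · rintro ⟨z, hz⟩
      apply hsq
      exact ⟨2*z^2 + l*q1*m1 - q1^2*C2, by
        rw [hz] at d4; linear_combination -d4 - q1^2*hC2⟩
    · rintro ⟨z, hz⟩
      apply hsq
      exact ⟨2*z^2 - l*q1*m1 + q1^2*C2, by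
        rw [d4]; linear_combination (l + 2*z)*hz + q1^2*hC2⟩
  have hl : ¬ (2:Z2) ∣ l := fun h => hp ⟨h42.2 h, hn1, hn0, h, ⟨Q1, hQ1⟩, ⟨Q0, hQ0⟩⟩
  exact ⟨⟨Q0, hQ0⟩, ⟨Q1, hQ1⟩, hn1, hn0, fun h => hl (h42.1 h), hl⟩

/-- The linear algebra step producing the next relation. -/
lemma descent_linear {L : Type*} [Field L] [Algebra ℚ L] (hfin : Module.finrank ℚ L = 5)
    (θ : L) (hθ : 4 * θ^5 = -1)
    (hind : ∀ p0 p1 p2 p3 p4 : ℚ, algebraMap ℚ L p0 + algebraMap ℚ L p1 * θ +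
      algebraMap ℚ L p2 * θ^2 + algebraMap ℚ L p3 * θ^3 + algebraMap ℚ L p4 * θ^4 = 0 →
      p0 = 0 ∧ p1 = 0 ∧ p2 = 0 ∧ p3 = 0 ∧ p4 = 0)
    (a1 a0 m1 m0 c2 c1 c0 : ℚ)
    (f2 : m1^2 = c2) (f1 : 2*m1*m0 - 1 = c1 + a1*c2) (f0 : m0^2 = c0 + a1*c1 + a0*c2)
    (g1 : m1 = a1*c0 + a0*c1) (g0 : m0 = a0*c0)
    (s : L) (hs : s^2 = θ^2 + algebraMap ℚ L a1 * θ + algebraMap ℚ L a0) :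
    ∃ x : Fin 6 → ℚ, x ≠ 0 ∧
      (x 0)^2 = -x 3*x 4 + (x 4)^2*c0 ∧
      2*x 0*x 1 = -x 3*x 5 + 2*x 4*x 5*c0 + (x 4)^2*c1 ∧
      (x 1)^2 + 2*x 0*x 2 = (x 3)^2*a0 - 2*x 3*x 4*m0 + (x 5)^2*c0 + 2*x 4*x 5*c1 + (x 4)^2*c2 ∧
      2*x 1*x 2 = (x 3)^2*a1 - 2*x 3*(x 4*m1+x 5*m0) + (x 5)^2*c1 + 2*x 4*x 5*c2 ∧
      (x 2)^2 = (x 3)^2 - 2*x 3*x 5*m1 + (x 5)^2*c2 := by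
  have : Module.Finite ℚ L := Module.finite_of_finrank_pos (by omega)
  set i := algebraMap ℚ L with hi
  let A : L := θ^4 + i a1 * θ^3 + i a0 * θ^2
  let H : L := i m1 * θ^3 + i m0 * θ^2 + 1/2
  let V : Fin 6 → L := ![θ*s, θ*s*θ, θ*s*θ^2, -A, H, θ*H]
  have hnli : ¬ LinearIndependent ℚ V := by
    intro h
    have := h.fintype_card_le_finrank
    rw [hfin] at this
    simp at this
  obtain ⟨x, hx, k, hk⟩ := Fintype.not_linearIndependent_iff.1 hnli
  refine ⟨x, fun h => hk (by rw [h]; rfl), ?_⟩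
  simp only [Fin.sum_univ_six, Algebra.smul_def, ← hi] at hx
  simp [V, -eq_ratCast] at hx
  have hchar : (2:L) ≠ 0 := by
    have : i 2 ≠ 0 := by rw [Ne, map_eq_zero]; norm_num
    simpa using this
  have hθ0 : θ ≠ 0 := by rintro rfl; norm_num at hθ
  have hA0 : A ≠ 0 := by
    intro h
    have h1 : i 0 + i 0 * θ + i a0 * θ^2 + i a1 * θ^3 + i 1 * θ^4 = 0 := by
      simp only [map_zero, map_one]
      linear_combination h
    have := (hind _ _ _ _ _ h1).2.2.2.2
    norm_num at this
  have F2 := congrArg i f2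
  have F1 := congrArg i f1
  have F0 := congrArg i f0
  have G1 := congrArg i g1
  have G0 := congrArg i g0
  simp only [map_mul, map_add, map_sub, map_pow, map_one, map_ofNat] at F2 F1 F0 G1 G0
  have hHsq : H^2 = A * (i c2 * θ^2 + i c1 * θ + i c0) := by
    have : (4:L) ≠ 0 := by
      have : (4:L) = 2*2 := by norm_num
      rw [this]; exact mul_ne_zero hchar hchar
    apply mul_left_cancel₀ this
    simp only [H, A]
    field_simp
    ring_nf
    ring_nf at hθ F2 F1 F0 G1 G0
    linear_combination hθ + 4*θ^6*F2 + 4*θ^5*F1 + 4*θ^4*F0 + 4*θ^3*G1 + 4*θ^2*G0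
  have hsq : (θ*s)^2 = A := by rw [mul_pow, hs]; ring
  have hmain : A * ((i (x 0) + i (x 1)*θ + i (x 2) *θ^2)^2 -
     ((i (x 3))^2 * A - i (x 3) * (i (x 4) + i (x 5)*θ) * (2*H) +
      (i (x 4) + i (x 5)*θ)^2 * (i c2 * θ^2 + i c1 * θ + i c0))) = 0 := by
    have e1 : (θ*s) * (i (x 0) + i (x 1)*θ + i (x 2) *θ^2) =
        i (x 3) * A - (i (x 4) + i (x 5)*θ) * H := by linear_combination hx
    have e2 : ((θ*s) * (i (x 0) + i (x 1)*θ + i (x 2) *θ^2))^2 =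
        (i (x 3) * A - (i (x 4) + i (x 5)*θ) * H)^2 := by rw [e1]
    linear_combination e2 - (i (x 0) + i (x 1)*θ + i (x 2) *θ^2)^2 * hsq +
      (i (x 4) + i (x 5)*θ)^2 * hHsq
  have hmain2 := (mul_eq_zero.1 hmain).resolve_left hA0
  have h2H : 2*H = 2*(i m1 * θ^3 + i m0 * θ^2) + 1 := by simp only [H]; field_simp
  rw [h2H] at hmain2
  have hfinal := hind
    ((x 0)^2 - (-x 3*x 4 + (x 4)^2*c0))
    (2*x 0*x 1 - (-x 3*x 5 + 2*x 4*x 5*c0 + (x 4)^2*c1))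
    ((x 1)^2 + 2*x 0*x 2 - ((x 3)^2*a0 - 2*x 3*x 4*m0 + (x 5)^2*c0 + 2*x 4*x 5*c1 + (x 4)^2*c2))
    (2*x 1*x 2 - ((x 3)^2*a1 - 2*x 3*(x 4*m1+x 5*m0) + (x 5)^2*c1 + 2*x 4*x 5*c2))
    ((x 2)^2 - ((x 3)^2 - 2*x 3*x 5*m1 + (x 5)^2*c2)) (by
      simp only [← hi, map_mul, map_add, map_sub, map_pow, map_neg, map_one, map_ofNat]
      rw [← hmain2]; simp only [A]; ring)
  simpa only [sub_eq_zero] using hfinal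

/-- The main theorem of the descent, assuming the Selmer condition. -/
theorem datum_trivial_of_selmer {L : Type*} [Field L] [Algebra ℚ L]
    (hfin : Module.finrank ℚ L = 5)
    (θ : L) (hθ : 4 * θ^5 = -1)
    (hind : ∀ p0 p1 p2 p3 p4 : ℚ, algebraMap ℚ L p0 + algebraMap ℚ L p1 * θ +
      algebraMap ℚ L p2 * θ^2 + algebraMap ℚ L p3 * θ^3 + algebraMap ℚ L p4 * θ^4 = 0 →
      p0 = 0 ∧ p1 = 0 ∧ p2 = 0 ∧ p3 = 0 ∧ p4 = 0)
    (hsel : ∀ a1 a0 m1 m0 : Z2, Datum a1 a0 m1 m0 →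
      ∃ s : L, s^2 = θ^2 + algebraMap ℚ L a1 * θ + algebraMap ℚ L a0)
    (a1 a0 m1 m0 : Z2) (hD : Datum a1 a0 m1 m0) : a1 = 0 ∧ a0 = 0 := by
  have step : ∀ a1 a0 m1 m0 : Z2, Datum a1 a0 m1 m0 → ∃ α1 α0 μ1 μ0 : Z2, Datum α1 α0 μ1 μ0 ∧
      ∀ k : ℕ, 1 ≤ k → (2:Z2)^k ∣ α1 → (2:Z2)^k ∣ α0 → (2:Z2)^(k+1) ∣ a1 ∧ (2:Z2)^(k+1) ∣ a0 := by
    intro a1 a0 m1 m0 hD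
    obtain ⟨s, hs⟩ := hsel _ _ _ _ hD
    obtain ⟨ha1, ha0, hm1, hm0, c2, c1, c0, f2, f1, f0, g1, g0⟩ := hD
    have cst : ∀ {x y : Z2}, x = y → (x:ℚ) = (y:ℚ) := fun h => congrArg _ h
    obtain ⟨x, hx0, d0, d1, d2, d3, d4⟩ := descent_linear hfin θ hθ hind
      (a1:ℚ) a0 m1 m0 c2 c1 c0 (by exact_mod_cast cst f2) (by exact_mod_cast cst f1)
      (by exact_mod_cast cst f0) (by exact_mod_cast cst g1) (by exact_mod_cast cst g0) s hs
    obtain ⟨c, y, hc, hy, j, hj⟩ := Z2_primitive x hx0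
    have D0 : (y 0)^2 = -y 3*y 4 + (y 4)^2*c0 := by
      apply Subtype.ext; push_cast; simp only [hy]; linear_combination c^2 * d0
    have D1 : 2*y 0*y 1 = -y 3*y 5 + 2*y 4*y 5*c0 + (y 4)^2*c1 := by
      apply Subtype.ext; push_cast; simp only [hy]; linear_combination c^2 * d1
    have D2 : (y 1)^2 + 2*y 0*y 2 = (y 3)^2*a0 - 2*y 3*y 4*m0 + (y 5)^2*c0 + 2*y 4*y 5*c1
        + (y 4)^2*c2 := by
      apply Subtype.ext; push_cast; simp only [hy]; linear_combination c^2 * d2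
    have D3 : 2*y 1*y 2 = (y 3)^2*a1 - 2*y 3*(y 4*m1+y 5*m0) + (y 5)^2*c1 + 2*y 4*y 5*c2 := by
      apply Subtype.ext; push_cast; simp only [hy]; linear_combination c^2 * d3
    have D4 : (y 2)^2 = (y 3)^2 - 2*y 3*y 5*m1 + (y 5)^2*c2 := by
      apply Subtype.ext; push_cast; simp only [hy]; linear_combination c^2 * d4
    obtain ⟨hq0, hq1, hn1, hn0, hn2, hl⟩ := descent_parity a1 a0 m1 m0 c2 c1 c0
      (y 2) (y 1) (y 0) (y 3) (y 5) (y 4) ha1 ha0 hm1 hm0 f2 f1 f0 D0 D1 D2 D3 D4 (by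
        rintro ⟨h2, h1, h0, h3, h5, h4⟩
        apply hj
        fin_cases j <;> assumption)
    obtain ⟨i, hi, -⟩ := Z2_inv_coe hl
    have E0 : (i * y 0)^2 = -(i*y 4) + (i*y 4)^2*c0 := by
      linear_combination i^2*D0 - i*y 4*hi
    have E1 : 2*(i*y 0)*(i*y 1) = -(i*y 5) + 2*(i*y 4)*(i*y 5)*c0 + (i*y 4)^2*c1 := by
      linear_combination i^2*D1 - i*y 5*hi
    have E2 : (i*y 1)^2 + 2*(i*y 0)*(i*y 2) = a0 - 2*(i*y 4)*m0 + (i*y 5)^2*c0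
        + 2*(i*y 4)*(i*y 5)*c1 + (i*y 4)^2*c2 := by
      linear_combination i^2*D2 - 2*i*y 4*m0*hi + (y 3*i+1)*a0*hi
    have E3 : 2*(i*y 1)*(i*y 2) = a1 - 2*((i*y 4)*m1+(i*y 5)*m0) + (i*y 5)^2*c1
        + 2*(i*y 4)*(i*y 5)*c2 := by
      linear_combination i^2*D3 - 2*(i*y 4*m1+i*y 5*m0)*hi + (y 3*i+1)*a1*hi
    have E4 : (i*y 2)^2 = 1 - 2*(i*y 5)*m1 + (i*y 5)^2*c2 := by
      linear_combination i^2*D4 - 2*i*y 5*m1*hi + (y 3*i+1)*hi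
    have hn2' : ¬ (2:Z2) ∣ i * y 2 := by
      rw [← Z2_isUnit_iff] at hn2 ⊢
      exact (IsUnit.of_mul_eq_one (y 3) (by rw [mul_comm]; exact hi)).mul hn2
    obtain ⟨α1, α0, m1', m0', z1, z0, hD'⟩ := descent_datum a1 a0 m1 m0 c2 c1 c0
      (i*y 2) (i*y 1) (i*y 0) (i*y 5) (i*y 4) hm1 hm0 f2 f1 f0 g1 g0 (hq0.mul_left _)
      (hq1.mul_left _) (hn1.mul_left _) (hn0.mul_left _) hn2' E0 E1 E2 E3 E4
    refine ⟨α1, α0, m1', m0', hD', fun k hk h1 h0 => ?_⟩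
    exact descent_level a1 a0 m1 m0 c2 c1 c0 (i*y 2) (i*y 1) (i*y 0) (i*y 5) (i*y 4) k hk
      (hq0.mul_left _) E0 E1 E2 E3 (z1 ▸ h1.mul_left _) (z0 ▸ h0.mul_left _)
  have all : ∀ k : ℕ, ∀ a1 a0 m1 m0 : Z2, Datum a1 a0 m1 m0 →
      (2:Z2)^(k+1) ∣ a1 ∧ (2:Z2)^(k+1) ∣ a0 := by
    intro k
    induction k with
    | zero => intro a1 a0 m1 m0 h; simpa using ⟨h.1, h.2.1⟩
    | succ k ih =>
      intro a1 a0 m1 m0 h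
      obtain ⟨α1, α0, μ1, μ0, hD', hlev⟩ := step _ _ _ _ h
      obtain ⟨h1, h0⟩ := ih _ _ _ _ hD'
      exact hlev (k+1) (by omega) h1 h0
  constructor
  · exact Z2_eq_zero fun k => (pow_dvd_pow _ (Nat.le_succ k)).trans (all k _ _ _ _ hD).1
  · exact Z2_eq_zero fun k => (pow_dvd_pow _ (Nat.le_succ k)).trans (all k _ _ _ _ hD).2

def MWStmt : Prop := ∀ a1 a0 m1 m0 : Z2, Datum a1 a0 m1 m0 → a1 = 0 ∧ a0 = 0

lemma quad_rem_zero (c1 c0 r1 r0 : Z2)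
    (h : (X^2 + C c1 * X + C c0 : Z2[X]) ∣ C r1 * X + C r0) : r1 = 0 ∧ r0 = 0 := by
  have hm : (X^2 + C c1 * X + C c0 : Z2[X]).Monic := by monicity!
  have hd : (X^2 + C c1 * X + C c0 : Z2[X]).degree = 2 := by compute_degree!
  have h0 : (C r1 * X + C r0 : Z2[X]) = 0 := by
    by_contra hne
    have h1 := hm.not_dvd_of_degree_lt hne (by
      rw [hd]
      exact lt_of_le_of_lt degree_linear_le (by norm_num))
    exact h1 h
  constructor
  · simpa using congrArg (fun p => coeff p 1) h0
  · simpa using congrArg (fun p => coeff p 0) h0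

lemma lemma_T (MW : MWStmt) (h w1 w0 A2 A1 A0 : Z2) (C2 C1 C0 : ℚ)
    (hh : (2:Z2) ∣ h) (hw : ¬ (2:Z2) ∣ w0) (hA : ¬ (2:Z2) ∣ A0)
    (e0 : (h:ℚ)*w0 = A0*C0) (e1 : (h:ℚ)*w1 = A0*C1 + A1*C0)
    (e2 : (w0:ℚ)^2 = A0*C2 + A1*C1 + A2*C0)
    (e3 : 2*(w0:ℚ)*w1 - h^2 = A1*C2 + A2*C1)
    (e4 : (w1:ℚ)^2 = A2*C2) : h = 0 := by
  obtain ⟨j, hj, hj'⟩ := Z2_inv_coe hA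
  have hA0 : (A0:ℚ) ≠ 0 := by
    intro h; apply hA; have : A0 = 0 := Subtype.ext h
    rw [this]; exact dvd_zero _
  have ej : (A0:ℚ) * j = 1 := by exact_mod_cast congrArg Subtype.val hj
  obtain ⟨D0, hD0⟩ : ∃ D0 : Z2, D0 = j*(h*w0) := ⟨_, rfl⟩
  have z0 : C0 = D0 := by
    rw [hD0]; push_cast; linear_combination -C0*ej - j*e0
  subst z0
  obtain ⟨D1, hD1⟩ : ∃ D1 : Z2, D1 = j*(h*w1 - A1*D0) := ⟨_, rfl⟩
  have z1 : C1 = D1 := by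
    rw [hD1]; push_cast; linear_combination -C1*ej - j*e1
  subst z1
  obtain ⟨D2, hD2⟩ : ∃ D2 : Z2, D2 = j*(w0^2 - A1*D1 - A2*D0) := ⟨_, rfl⟩
  have z2 : C2 = D2 := by
    rw [hD2]; push_cast; linear_combination -C2*ej - j*e2
  subst z2
  norm_cast at e0 e1 e2 e4
  have e3' : 2*w0*w1 - h^2 = A1*D2 + A2*D1 := by
    apply Subtype.ext; push_cast; exact e3
  have ev0 : (2:Z2) ∣ D0 := hD0 ▸ (hh.mul_right _).mul_left _
  have ev1 : (2:Z2) ∣ D1 := hD1 ▸ (dvd_sub (hh.mul_right _) (ev0.mul_left _)).mul_left _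
  have od2 : ¬ (2:Z2) ∣ D2 := by
    intro h2
    apply hw
    apply Z2_prime.dvd_of_dvd_pow (n := 2)
    rw [e2]
    exact dvd_add (dvd_add (h2.mul_left _) (ev1.mul_left _)) (ev0.mul_left _)
  obtain ⟨k, hk, -⟩ := Z2_inv_coe od2
  obtain ⟨c1, hc1⟩ : ∃ c1, c1 = k*D1 := ⟨_, rfl⟩
  obtain ⟨c0, hc0⟩ : ∃ c0, c0 = k*D0 := ⟨_, rfl⟩
  have d1 : D1 = D2*c1 := by rw [hc1]; linear_combination -D1*hk
  have d0 : D0 = D2*c0 := by rw [hc0]; linear_combination -D0*hk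
  have evc1 : (2:Z2) ∣ c1 := hc1 ▸ ev1.mul_left _
  have evc0 : (2:Z2) ∣ c0 := hc0 ▸ ev0.mul_left _
  obtain ⟨ν, hν⟩ : ∃ ν, ν = w0^2 - w0*w1*c1 + w1^2*c0 := ⟨_, rfl⟩
  have oν : ¬ (2:Z2) ∣ ν := by
    intro h2
    apply hw
    apply Z2_prime.dvd_of_dvd_pow (n := 2)
    have : w0^2 = ν + w0*w1*c1 - w1^2*c0 := by rw [hν]; ring
    rw [this]
    exact dvd_sub (dvd_add h2 (evc1.mul_left _)) (evc0.mul_left _)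
  obtain ⟨i, hi, -⟩ := Z2_inv_coe oν
  obtain ⟨m1, hm1⟩ : ∃ m1, m1 = -h*w0*i := ⟨_, rfl⟩
  obtain ⟨m0, hm0⟩ : ∃ m0, m0 = -h*w1*c0*i := ⟨_, rfl⟩
  have n1 : w1*m0 + w0*m1 + h = m1*w1*c1 := by
    rw [hm0, hm1]; linear_combination -h*hi + h*i*hν
  have n0 : w0*m0 = m1*w1*c0 := by rw [hm0, hm1]; ring
  let c : Z2[X] := X^2 + C c1 * X + C c0
  let W : Z2[X] := C w1 * X + C w0
  let M : Z2[X] := C m1 * X + C m0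
  have p1 : W * M = - C h * X + C (m1*w1) * c := by
    have n1' := congrArg (C : Z2 → Z2[X]) n1
    have n0' := congrArg (C : Z2 → Z2[X]) n0
    simp only [map_mul, map_add] at n1' n0'
    simp only [W, M, c, map_mul]
    linear_combination X * n1' + n0'
  have p2 : X^2*W^2 + C h * W - C h^2*X^3 = (C A2 * X^2 + C A1 * X + C A0) * (C D2 * c) := by
    have q0 := congrArg (C : Z2 → Z2[X]) e0
    have q1 := congrArg (C : Z2 → Z2[X]) e1
    have q2 := congrArg (C : Z2 → Z2[X]) e2
    have q3 := congrArg (C : Z2 → Z2[X]) e3'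
    have q4 := congrArg (C : Z2 → Z2[X]) e4
    have r1 := congrArg (C : Z2 → Z2[X]) d1
    have r0 := congrArg (C : Z2 → Z2[X]) d0
    simp only [map_mul, map_add, map_sub, map_pow, map_ofNat] at q0 q1 q2 q3 q4 r1 r0
    simp only [W, c]
    linear_combination q0 + X*q1 + X^2*q2 + X^3*q3 + X^4*q4 +
      (C A2 * X^2 + C A1 * X + C A0) * (X * r1 + r0)
  have p3 : c ∣ W^2 * (X^2*M^2 + M - X^3) := by
    refine ⟨-X * (C A2 * X^2 + C A1 * X + C A0) * C D2 - 2*X^3*C h * C (m1*w1)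
      + X^2*C (m1*w1)^2*c + W*C (m1*w1), ?_⟩
    have : W^2 * (X^2*M^2 + M - X^3) = X^2*(W*M)^2 + W*(W*M) - W^2*X^3 := by ring
    rw [this, p1]
    linear_combination -X * p2
  have p4 : IsCoprime c W := by
    refine ⟨C (i*w1^2), - C i * (C w1 * X + C (w1*c1-w0)), ?_⟩
    have h1 := congrArg (C : Z2 → Z2[X]) hi
    have h2 := congrArg (C : Z2 → Z2[X]) hν
    simp only [map_mul, map_add, map_sub, map_pow, map_one] at h1 h2
    simp only [c, W, map_mul, map_sub, map_pow]
    linear_combination h1 - C i * h2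
  have p5 : c ∣ X^2*M^2 + M - X^3 := (p4.pow_right).dvd_of_dvd_mul_left p3
  obtain ⟨γ2, hγ2⟩ : ∃ z, z = m1^2 := ⟨_, rfl⟩
  obtain ⟨γ1, hγ1⟩ : ∃ z, z = 2*m1*m0 - 1 - c1*γ2 := ⟨_, rfl⟩
  obtain ⟨γ0, hγ0⟩ : ∃ z, z = m0^2 - c1*γ1 - c0*γ2 := ⟨_, rfl⟩
  have p6 : X^2*M^2 + M - X^3 = c * (C γ2 * X^2 + C γ1*X + C γ0) +
      (C (m1 - (c1*γ0 + c0*γ1)) * X + C (m0 - c0*γ0)) := by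
    have h2 := congrArg (C : Z2 → Z2[X]) hγ2
    have h1 := congrArg (C : Z2 → Z2[X]) hγ1
    have h0 := congrArg (C : Z2 → Z2[X]) hγ0
    simp only [map_mul, map_add, map_sub, map_pow, map_one, map_ofNat] at h2 h1 h0
    simp only [c, M, map_mul, map_sub, map_add]
    linear_combination -X^4*h2 - X^3*h1 - X^2*h0
  rw [p6] at p5
  obtain ⟨g1, g0⟩ := quad_rem_zero c1 c0 _ _ ((dvd_add_right (dvd_mul_right _ _)).1 p5)
  have hD : Datum c1 c0 m1 m0 := by
    refine ⟨evc1, evc0, ?_, ?_, γ2, γ1, γ0, hγ2.symm, ?_, ?_, ?_, ?_⟩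
    · rw [hm1]; exact ((dvd_neg.2 hh).mul_right _).mul_right _
    · rw [hm0]; exact (((dvd_neg.2 hh).mul_right _).mul_right _).mul_right _
    · linear_combination -hγ1
    · linear_combination -hγ0
    · linear_combination g1
    · linear_combination g0
  have hz := (MW _ _ _ _ hD).2
  rw [hz, mul_zero] at d0
  rw [d0, mul_zero] at e0
  rcases mul_eq_zero.1 e0 with h1 | h1
  · exact h1
  · exact absurd (h1 ▸ dvd_zero _) hw

lemma Z2_zero_of_coe {x : Z2} (h : (x:ℚ) = 0) : x = 0 := Subtype.ext h

/-- Case of `ρ` odd. -/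
lemma rho_odd (MW : MWStmt) (c ρ : Z2) (hc : ¬ (2:Z2) ∣ c) (hρ : ¬ (2:Z2) ∣ ρ)
    (h : c^5 = 1 - 5*ρ + 5*ρ^2) : ρ = 1 := by
  have rel : (c:ℚ)^5 = 1 - 5*(ρ:ℚ) + 5*(ρ:ℚ)^2 := by
    have := congrArg (Subtype.val) h
    push_cast at this
    exact this
  have hun : ∀ {x y : Z2}, ¬ (2:Z2) ∣ x → ¬ (2:Z2) ∣ y → ¬ (2:Z2) ∣ x * y := by
    intro x y hx hy
    exact Z2_prime.not_dvd_mul hx hy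
  have key := lemma_T MW (ρ^2*(1-ρ)) (c^2*ρ^2) (-(c^3*(1-2*ρ))) (ρ^2) (-(c*(1-3*ρ))) (ρ*c^2)
    (c^4*ρ^2) (c^5*(ρ-1) - ρ^2*(1-ρ)^2) (-(ρ*(1-ρ)*c*(1-2*ρ)))
    (by
      have := (Z2_odd_iff.1 hρ)
      rw [← dvd_neg, neg_sub] at this
      exact this.mul_left _)
    (by
      rw [dvd_neg]
      refine hun (fun h => hc (Z2_prime.dvd_of_dvd_pow h)) (Z2_odd_add_two (y := -ρ) (by ring)))
    (hun hρ (fun h => hc (Z2_prime.dvd_of_dvd_pow h)))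
    (by push_cast; ring)
    (by push_cast; rw [Z2_coe_ofNat]; linear_combination (c:ℚ)^2*ρ*(1-ρ)*rel)
    (by push_cast; rw [Z2_coe_ofNat]; linear_combination (c:ℚ)*ρ^2*(1-ρ)*rel)
    (by push_cast; rw [Z2_coe_ofNat]; ring)
    (by push_cast; ring)
  rcases mul_eq_zero.1 key with h1 | h1
  · have : ρ = 0 := by simpa using h1
    exact absurd (this ▸ dvd_zero _) hρ
  · linear_combination -h1

/-- The affine curve `c⁵ = 1 - 5 ρ + 5 ρ²` has only the obvious rational points. -/
theorem curve_points (MW : MWStmt) (c ρ : ℚ) (h : c^5 = 1 - 5*ρ + 5*ρ^2) : ρ = 0 ∨ ρ = 1 := by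
  by_cases hρ : ρ ∈ Z2
  · have hc5 : c^5 ∈ Z2 := by
      rw [h]
      have := (1 - 5*(⟨ρ, hρ⟩:Z2) + 5*(⟨ρ, hρ⟩:Z2)^2).2
      push_cast at this
      exact this
    have hc : c ∈ Z2 := Z2_pow_mem (by norm_num) hc5
    obtain ⟨r, hr⟩ : ∃ r : Z2, r = ⟨ρ, hρ⟩ := ⟨_, rfl⟩
    obtain ⟨d, hd⟩ : ∃ d : Z2, d = ⟨c, hc⟩ := ⟨_, rfl⟩
    have rel : d^5 = 1 - 5*r + 5*r^2 := by
      apply Subtype.ext; rw [hr, hd]; push_cast; exact h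
    have hdo : ¬ (2:Z2) ∣ d := by
      intro h2
      have h3 : (2:Z2) ∣ r^2 - r := by
        rcases Z2_parity r with h4 | h4
        · have : r^2 - r = r*(r-1) := by ring
          rw [this]; exact h4.mul_right _
        · have : r^2 - r = r*(r-1) := by ring
          rw [this]; exact h4.mul_left _
      apply Z2_not_dvd_one
      have : (1:Z2) = d^5 - 5*(r^2-r) := by rw [rel]; ring
      rw [this]
      exact dvd_sub (dvd_pow h2 (by norm_num)) (h3.mul_left _)
    by_cases hro : (2:Z2) ∣ r
    · left
      have h1 := rho_odd MW d (1 - r) hdo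
        (by rw [Z2_odd_iff]; have := dvd_neg.2 hro; convert this using 1; ring)
        (by rw [rel]; ring)
      have h2 : r = 0 := by linear_combination -h1
      have := congrArg Subtype.val h2
      rw [hr] at this; exact this
    · right
      have h1 := rho_odd MW d r hdo hro rel
      have := congrArg Subtype.val h1
      rw [hr] at this; exact this
  · exfalso
    have hρ0 : ρ ≠ 0 := by rintro rfl; exact hρ Z2.zero_mem
    obtain ⟨σ, ⟨σ', hσ'⟩, hσ2⟩ := Z2_inv_even hρ
    have hσ0 : (σ:ℚ) ≠ 0 := by rw [hσ2]; exact inv_ne_zero hρ0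
    have hρσ : ρ = (σ:ℚ)⁻¹ := by rw [hσ2, inv_inv]
    have hunit : ¬ (2:Z2) ∣ σ^2 - 5*σ + 5 :=
      Z2_odd_add_two (y := 2*σ'^2 - 5*σ' + 2) (by rw [hσ']; ring)
    obtain ⟨i, hi, -⟩ := Z2_inv_coe hunit
    have hrel : (σ:ℚ)^2*c^5 = (σ:ℚ)^2 - 5*(σ:ℚ) + 5 := by
      rw [h, hρσ]; field_simp
    have hiq : ((σ:ℚ)^2 - 5*σ + 5) * i = 1 := by
      have := congrArg Subtype.val hi
      push_cast at this; exact this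
    have hc0 : c ≠ 0 := by
      rintro rfl
      rw [← hrel] at hiq; norm_num at hiq
    -- s = 1/c
    have hs5 : (c⁻¹)^5 = ((σ^2*i : Z2) : ℚ) := by
      push_cast
      rw [← hrel] at hiq
      field_simp
      linear_combination -hiq
    have hs : c⁻¹ ∈ Z2 := Z2_pow_mem (n := 5) (by norm_num) (hs5 ▸ (σ^2*i : Z2).2)
    have hP5 : ((σ:ℚ)*c^2)^5 = ((σ*(σ^2-5*σ+5)^2 : Z2) : ℚ) := by
      push_cast; rw [Z2_coe_ofNat, ← hrel]; ring
    have hP : (σ:ℚ)*c^2 ∈ Z2 := Z2_pow_mem (n := 5) (by norm_num)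
      (hP5 ▸ (σ*(σ^2-5*σ+5)^2 : Z2).2)
    obtain ⟨s, hs'⟩ : ∃ s : Z2, (s:ℚ) = c⁻¹ := ⟨⟨_, hs⟩, rfl⟩
    obtain ⟨P, hP'⟩ : ∃ s : Z2, (s:ℚ) = (σ:ℚ)*c^2 := ⟨⟨_, hP⟩, rfl⟩
    have evs : (2:Z2) ∣ s := by
      apply Z2_prime.dvd_of_dvd_pow (n := 5)
      have : s^5 = σ^2*i := by apply Subtype.ext; rw [← hs5]; push_cast; rw [hs']
      rw [this, hσ']; exact ⟨2*σ'^2*i, by ring⟩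
    have evP : (2:Z2) ∣ P := by
      apply Z2_prime.dvd_of_dvd_pow (n := 5)
      have : P^5 = σ*(σ^2-5*σ+5)^2 := by apply Subtype.ext; rw [← hP5]; push_cast; rw [hP']
      rw [this, hσ']; exact ⟨σ'*((2*σ')^2 - 5*(2*σ') + 5)^2, by ring⟩
    have hP0 : P ≠ 0 := by
      intro h0
      rw [h0] at hP'
      have : (σ:ℚ)*c^2 = 0 := hP'.symm
      rcases mul_eq_zero.1 this with h1 | h1
      · exact hσ0 h1
      · exact hc0 (by simpa using h1)
    have hrelP : (s:ℚ)*(5 - 5*s^2*P + s^4*P^2) = P^2 := by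
      rw [hs', hP']; field_simp
      linear_combination -hrel
    have hDodd : ¬ (2:Z2) ∣ s^2*P - 1 := by
      obtain ⟨z, hz⟩ := evP
      exact Z2_odd_add_two (y := s^2*z - 1) (by rw [hz]; ring)
    obtain ⟨j, hj, -⟩ := Z2_inv_coe hDodd
    have hjq : ((s:ℚ)^2*P-1)*j = 1 := by
      have := congrArg Subtype.val hj
      push_cast at this; exact this
    have hDne : ((s:ℚ)^2*P-1) ≠ 0 := by intro h0; rw [h0] at hjq; simp at hjq
    have hjj : (j:ℚ) = 1/((s:ℚ)^2*P-1) := by field_simp; linear_combination hjq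
    have h3 : ((3:Z2):ℚ) = 3 := rfl
    have hD : Datum (-(s^3*P^2-3*s*P)) P (j*P) (j*(P^2*(2*s-s^3*P))) := by
      refine ⟨?_, evP, evP.mul_left _, ?_, (j*P)^2, j*(1 + (s^3*P-3*s)*P*s*(2-s^2*P)),
        j*(P*(2*s-s^3*P)), rfl, ?_, ?_, ?_, ?_⟩
      · rw [dvd_neg]; exact dvd_sub ((dvd_pow evP (by norm_num)).mul_left _) (evP.mul_left _)
      · exact ((dvd_pow evP (by norm_num)).mul_right _).mul_left _
      · apply Subtype.ext; push_cast; simp only [h3, hjj]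
        field_simp
        linear_combination (s:ℚ)*P*(s^2*P-1) * hrelP
      · apply Subtype.ext; push_cast; simp only [h3, hjj]
        field_simp
        linear_combination (P:ℚ)*(1 - s^2 * P*(2-s^2*P)^2) * hrelP
      · ring
      · ring
    exact hP0 (MW _ _ _ _ hD).2

set_option linter.unusedSimpArgs false

/-! ### The discriminant curve has no rational points -/

lemma Z2_inj {x y : Z2} (h : Z2.subtype x = Z2.subtype y) : x = y := Subtype.ext h

lemma lemma_T' (MW : MWStmt) (h w1 w0 A2 A1 A0 : Z2) (C2 C1 C0 : ℚ)
    (hh : (2:Z2) ∣ h) (hw : ¬ (2:Z2) ∣ w0) (hA : ¬ (2:Z2) ∣ A0)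
    (e0 : Z2.subtype h * Z2.subtype w0 = Z2.subtype A0*C0)
    (e1 : Z2.subtype h*Z2.subtype w1 = Z2.subtype A0*C1 + Z2.subtype A1*C0)
    (e2 : (Z2.subtype w0)^2 = Z2.subtype A0*C2 + Z2.subtype A1*C1 + Z2.subtype A2*C0)
    (e3 : 2*(Z2.subtype w0)*Z2.subtype w1 - (Z2.subtype h)^2 = Z2.subtype A1*C2 + Z2.subtype A2*C1)
    (e4 : (Z2.subtype w1)^2 = Z2.subtype A2*C2) : h = 0 :=
  lemma_T MW h w1 w0 A2 A1 A0 C2 C1 C0 hh hw hA e0 e1 e2 e3 e4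

lemma disc_odd (τ δ : Z2) (h : δ^2 = -((1+2*τ)-2)*(7*(1+2*τ)^5 - 10*(1+2*τ)^4 - 20*(1+2*τ)^3 - 4)) :
    False := by
  have sq : ∀ x : Z2, ∃ k, x^2 + x = 2*k := by
    intro x
    rcases Z2_parity x with ⟨k, hk⟩ | ⟨k, hk⟩
    · exact ⟨k*(x+1), by linear_combination (x+1)*hk⟩
    · exact ⟨x*(k+1), by linear_combination x*hk⟩
  obtain ⟨κ, hκ⟩ := sq τ
  obtain ⟨m, hm⟩ : ∃ m, δ^2 = 5 + 8*m := ⟨-4 + 15*κ - 17*τ + 60*τ^3 + 30*τ^4 - 72*τ^5 - 56*τ^6, by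
    rw [h]; linear_combination 60*hκ⟩
  rcases Z2_parity δ with ⟨d, hd⟩ | ⟨d, hd⟩
  · apply Z2_not_dvd_one
    exact ⟨2*d^2 - 2 - 4*m, by linear_combination -hm + (δ+2*d)*hd⟩
  · obtain ⟨l, hl⟩ := sq d
    apply Z2_not_dvd_one
    refine ⟨l - m, ?_⟩
    have : (4:Z2) * (1 - 2*(l-m)) = 0 := by
      linear_combination -hm + 4*hl + (δ + 1 + 2*d)*hd
    have h4 : (4:Z2) ≠ 0 := by
      have : (4:Z2) = 2*2 := by norm_num
      rw [this]; exact mul_ne_zero Z2_two_ne Z2_two_ne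
    exact sub_eq_zero.1 ((mul_eq_zero.1 this).resolve_left h4)

lemma disc_pole_id0 (τ D G N a1 a0 q0 q1 : ℚ) (hG : G = 7 - 10*τ - 20*τ^2 - 4*τ^5) (hN : N = 1 + τ - τ^2)
    (hG0 : G ≠ 0) (hN0 : N ≠ 0) (hT0 : 1-2*τ ≠ 0) (hD : D^2 = -(1-2*τ)*G)
    (ha1 : a1 = (4 - 15*τ + 40*τ^3 + 25*τ^4 + 2*τ^5)/G) (ha0 : a0 = (2 - 10*τ^3 - 20*τ^4 - 9*τ^5)/G)
    (hq0 : q0 = (-13 + 85*τ - 85*τ^2 - 150*τ^3 + 180*τ^4 - 158*τ^5 - 270*τ^6 + 470*τ^7 + 550*τ^8 + 90*τ^9 - 32*τ^10)/(G^2*N*(1-2*τ)))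
    (hq1 : q1 = (-40 + 200*τ - 100*τ^2 - 700*τ^3 + 450*τ^4 + 1310*τ^5 - 150*τ^6 - 1050*τ^7 - 350*τ^8 + 100*τ^9 + 40*τ^10)/(G^2*N*(1-2*τ))) :
    (D*q0)^2 = 1 + 4*a0*((D*q1)^2/4 - a0*a1 - a1*(a0-a1^2)) := by
  rw [mul_pow, mul_pow, hD, ha1, ha0, hq0, hq1]
  field_simp
  rw [hG, hN]
  ring

lemma disc_pole_id1 (τ D G N a1 a0 q0 q1 : ℚ) (hG : G = 7 - 10*τ - 20*τ^2 - 4*τ^5) (hN : N = 1 + τ - τ^2)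
    (hG0 : G ≠ 0) (hN0 : N ≠ 0) (hT0 : 1-2*τ ≠ 0) (hD : D^2 = -(1-2*τ)*G)
    (ha1 : a1 = (4 - 15*τ + 40*τ^3 + 25*τ^4 + 2*τ^5)/G) (ha0 : a0 = (2 - 10*τ^3 - 20*τ^4 - 9*τ^5)/G)
    (hq0 : q0 = (-13 + 85*τ - 85*τ^2 - 150*τ^3 + 180*τ^4 - 158*τ^5 - 270*τ^6 + 470*τ^7 + 550*τ^8 + 90*τ^9 - 32*τ^10)/(G^2*N*(1-2*τ)))
    (hq1 : q1 = (-40 + 200*τ - 100*τ^2 - 700*τ^3 + 450*τ^4 + 1310*τ^5 - 150*τ^6 - 1050*τ^7 - 350*τ^8 + 100*τ^9 + 40*τ^10)/(G^2*N*(1-2*τ))) :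
    (D*q0)*(D*q1) = 2*(a0*(a0-a1^2) + a1*((D*q1)^2/4 - a0*a1 - a1*(a0-a1^2))) := by
  have : (D*q0)*(D*q1) = D^2*(q0*q1) := by ring
  rw [this, mul_pow, hD, ha1, ha0, hq0, hq1]
  field_simp
  rw [hG, hN]
  ring

lemma disc_pole (MW : MWStmt) (τ D : Z2) (hτ : (2:Z2) ∣ τ)
    (hD : D^2 = -(1-2*τ)*(7 - 10*τ - 20*τ^2 - 4*τ^5)) : False := by
  obtain ⟨σ, hσ⟩ := hτ
  obtain ⟨G, hG⟩ : ∃ G : Z2, G = 7 - 10*τ - 20*τ^2 - 4*τ^5 := ⟨_, rfl⟩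
  obtain ⟨N, hN⟩ : ∃ N : Z2, N = 1 + τ - τ^2 := ⟨_, rfl⟩
  obtain ⟨T, hT⟩ : ∃ T : Z2, T = 1 - 2*τ := ⟨_, rfl⟩
  obtain ⟨ν1, hν1⟩ : ∃ z : Z2, z = 4 - 15*τ + 40*τ^3 + 25*τ^4 + 2*τ^5 := ⟨_, rfl⟩
  obtain ⟨ν0, hν0⟩ : ∃ z : Z2, z = 2 - 10*τ^3 - 20*τ^4 - 9*τ^5 := ⟨_, rfl⟩
  obtain ⟨r0, hr0⟩ : ∃ z : Z2, z = -13 + 85*τ - 85*τ^2 - 150*τ^3 + 180*τ^4 - 158*τ^5 - 270*τ^6 + 470*τ^7 + 550*τ^8 + 90*τ^9 - 32*τ^10 := ⟨_, rfl⟩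
  obtain ⟨r1, hr1⟩ : ∃ z : Z2, z = -40 + 200*τ - 100*τ^2 - 700*τ^3 + 450*τ^4 + 1310*τ^5 - 150*τ^6 - 1050*τ^7 - 350*τ^8 + 100*τ^9 + 40*τ^10 := ⟨_, rfl⟩
  have oG : ¬ (2:Z2) ∣ G := Z2_odd_add_two (y := 3 - 5*τ - 10*τ^2 - 2*τ^5) (by rw [hG]; ring)
  have oN : ¬ (2:Z2) ∣ N := Z2_odd_add_two (y := σ - τ*σ) (by rw [hN, hσ]; ring)
  have oT : ¬ (2:Z2) ∣ T := Z2_odd_add_two (y := -τ) (by rw [hT]; ring)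
  have or0 : ¬ (2:Z2) ∣ r0 := by
    refine Z2_odd_add_two (y := -7 + 85*σ - 85*σ*τ - 75*τ^3 + 90*τ^4 - 79*τ^5 - 135*τ^6 + 235*τ^7 + 275*τ^8 + 45*τ^9 - 16*τ^10) ?_
    rw [hr0]; linear_combination (85 - 85*τ)*hσ
  have oD : ¬ (2:Z2) ∣ D := by
    intro h
    have : (2:Z2) ∣ T*G := by
      rw [← dvd_neg]
      have e : -(T*G) = D^2 := by rw [hD, hT, hG]; ring
      rw [e]; exact dvd_pow h (by norm_num)
    rcases Z2_prime.dvd_or_dvd this with h | h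
    · exact oT h
    · exact oG h
  have oprod : ¬ (2:Z2) ∣ G^2*N*T := by
    intro h
    rcases Z2_prime.dvd_or_dvd h with h | h
    · rcases Z2_prime.dvd_or_dvd h with h | h
      · exact oG (Z2_prime.dvd_of_dvd_pow h)
      · exact oN h
    · exact oT h
  obtain ⟨Gi, hGi, hGi'⟩ := Z2_inv_coe oG
  obtain ⟨Q, hQ, hQ'⟩ := Z2_inv_coe oprod
  -- choose the sign
  obtain ⟨d, hd2, k, hk⟩ : ∃ d : Z2, d^2 = D^2 ∧ ∃ k, d*(r0*Q) = 1 + 4*k := by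
    have odd : ¬ (2:Z2) ∣ D*(r0*Q) := by
      intro h
      rcases Z2_prime.dvd_or_dvd h with h | h
      · exact oD h
      rcases Z2_prime.dvd_or_dvd h with h | h
      · exact or0 h
      · exact Z2_not_dvd_one (hQ ▸ h.mul_left _)
    obtain ⟨y, hy⟩ := Z2_odd_iff.1 odd
    rcases Z2_parity y with ⟨k, hk⟩ | ⟨k, hk⟩
    · exact ⟨D, rfl, k, by linear_combination hy + 2*hk⟩
    · exact ⟨-D, by ring, -k-1, by linear_combination -hy - 2*hk⟩
  have cG : Z2.subtype G = 7 - 10*Z2.subtype τ - 20*(Z2.subtype τ)^2 - 4*(Z2.subtype τ)^5 := by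
    rw [hG]; simp only [map_add, map_sub, map_neg, map_mul, map_pow, map_ofNat]
  have cN : Z2.subtype N = 1 + Z2.subtype τ - (Z2.subtype τ)^2 := by
    rw [hN]; simp only [map_add, map_sub, map_neg, map_mul, map_pow, map_ofNat, map_one]
  have cT : Z2.subtype T = 1 - 2*Z2.subtype τ := by
    rw [hT]; simp only [map_add, map_sub, map_neg, map_mul, map_pow, map_ofNat, map_one]
  have nz : ∀ x : Z2, ¬ (2:Z2) ∣ x → Z2.subtype x ≠ 0 := by
    intro x hx h0
    apply hx
    have : x = 0 := Subtype.ext h0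
    rw [this]; exact dvd_zero _
  have cGi : Z2.subtype Gi = (Z2.subtype G)⁻¹ := hGi'
  have cQ : Z2.subtype Q = ((Z2.subtype G)^2*Z2.subtype N*(1-2*Z2.subtype τ))⁻¹ := by
    rw [← cT, ← map_pow, ← map_mul, ← map_mul]; exact hQ'
  have cD : (Z2.subtype d)^2 = -(1-2*Z2.subtype τ)*Z2.subtype G := by
    rw [← cT, ← map_pow, ← map_neg, ← map_mul, hd2, hD, hT, hG]
  have ca1 : Z2.subtype (ν1*Gi) = (4 - 15*Z2.subtype τ + 40*(Z2.subtype τ)^3 + 25*(Z2.subtype τ)^4 + 2*(Z2.subtype τ)^5)/Z2.subtype G := by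
    rw [map_mul, cGi, hν1, div_eq_mul_inv]; simp only [map_add, map_sub, map_neg, map_mul, map_pow, map_ofNat, map_one]
  have ca0 : Z2.subtype (ν0*Gi) = (2 - 10*(Z2.subtype τ)^3 - 20*(Z2.subtype τ)^4 - 9*(Z2.subtype τ)^5)/Z2.subtype G := by
    rw [map_mul, cGi, hν0, div_eq_mul_inv]; simp only [map_add, map_sub, map_neg, map_mul, map_pow, map_ofNat, map_one]
  have cq0 : Z2.subtype (r0*Q) = (-13 + 85*Z2.subtype τ - 85*(Z2.subtype τ)^2 - 150*(Z2.subtype τ)^3 + 180*(Z2.subtype τ)^4 - 158*(Z2.subtype τ)^5 - 270*(Z2.subtype τ)^6 + 470*(Z2.subtype τ)^7 + 550*(Z2.subtype τ)^8 + 90*(Z2.subtype τ)^9 - 32*(Z2.subtype τ)^10)/((Z2.subtype G)^2*Z2.subtype N*(1-2*Z2.subtype τ)) := by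
    rw [map_mul, cQ, hr0, div_eq_mul_inv]; simp only [map_add, map_sub, map_neg, map_mul, map_pow, map_ofNat, map_one]
  have cq1 : Z2.subtype (r1*Q) = (-40 + 200*Z2.subtype τ - 100*(Z2.subtype τ)^2 - 700*(Z2.subtype τ)^3 + 450*(Z2.subtype τ)^4 + 1310*(Z2.subtype τ)^5 - 150*(Z2.subtype τ)^6 - 1050*(Z2.subtype τ)^7 - 350*(Z2.subtype τ)^8 + 100*(Z2.subtype τ)^9 + 40*(Z2.subtype τ)^10)/((Z2.subtype G)^2*Z2.subtype N*(1-2*Z2.subtype τ)) := by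
    rw [map_mul, cQ, hr1, div_eq_mul_inv]; simp only [map_add, map_sub, map_neg, map_mul, map_pow, map_ofNat, map_one]
  have id0 := disc_pole_id0 (Z2.subtype τ) (Z2.subtype d) (Z2.subtype G) (Z2.subtype N) _ _ _ _ cG cN
    (nz _ oG) (nz _ oN) (cT ▸ nz _ oT) cD ca1 ca0 cq0 cq1
  have id1 := disc_pole_id1 (Z2.subtype τ) (Z2.subtype d) (Z2.subtype G) (Z2.subtype N) _ _ _ _ cG cN
    (nz _ oG) (nz _ oN) (cT ▸ nz _ oT) cD ca1 ca0 cq0 cq1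
  obtain ⟨ρ, hρ⟩ : ∃ ρ, ρ = -10 + 50*τ - 25*τ^2 - 175*τ^3 + 225*σ*τ^3 + 655*σ*τ^4 - 75*σ*τ^5 - 525*σ*τ^6 - 175*σ*τ^7 + 25*τ^9 + 10*τ^10 := ⟨_, rfl⟩
  have hr1' : r1 = 4*ρ := by
    rw [hr1, hρ]; linear_combination (450*τ^3+1310*τ^4-150*τ^5-1050*τ^6-350*τ^7)*hσ
  obtain ⟨b1, hb1⟩ : ∃ b1, b1 = 2*(d*(ρ*Q)) := ⟨_, rfl⟩
  obtain ⟨a1, ha1⟩ : ∃ a1, a1 = ν1*Gi := ⟨_, rfl⟩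
  obtain ⟨a0, ha0⟩ : ∃ a0, a0 = ν0*Gi := ⟨_, rfl⟩
  have hY1 : d*(r1*Q) = 2*b1 := by rw [hb1, hr1']; ring
  rw [← map_mul, ← map_mul, hY1, hk, ← ha1, ← ha0] at id0 id1
  simp only [map_mul, map_add, map_ofNat, map_one] at id0 id1
  obtain ⟨m1, m0, hDat⟩ := datum_of_mumford a1 a0 0 0 b1 (2*k) 0 (-1) a1 (a0-a1^2)
    (b1^2 - a0*a1 - a1*(a0-a1^2))
    ⟨(2 - 15*σ + 20*τ^3 + 25*σ*τ^3 + τ^5)*Gi, by rw [ha1, hν1]; linear_combination Gi*(-15 + 25*τ^3)*hσ⟩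
    ⟨(1 - 5*τ^3 - 10*τ^4 - 9*σ*τ^4)*Gi, by rw [ha0, hν0]; linear_combination Gi*(-9*τ^4)*hσ⟩
    (dvd_zero _) (dvd_zero _) ⟨_, hb1⟩ ⟨k, rfl⟩
    (by
      apply Z2_inj
      simp only [map_mul, map_add, map_sub, map_pow, map_ofNat, map_one]
      linear_combination id0/4)
    (by
      apply Z2_inj
      simp only [map_mul, map_add, map_sub, map_pow, map_ofNat, map_one]
      linear_combination id1/2)
    (by ring) (by ring) (by ring) (by ring) (by ring)
  have h0 := (MW _ _ _ _ hDat).2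
  apply Z2_not_dvd_one
  have e : ν0 = 0 := by
    linear_combination G*h0 + G*(-ha0)*(-1)*(-1) - ν0*hGi
  refine ⟨5*σ*τ^2 + 10*σ*τ^3 + 9*σ^2*τ^3, ?_⟩
  have : (2:Z2)*(1 - 2*(5*σ*τ^2 + 10*σ*τ^3 + 9*σ^2*τ^3)) = 0 := by
    linear_combination e - hν0 + (10*τ^2 + 20*τ^3 + 9*τ^4 + 18*σ*τ^3)*hσ
  exact sub_eq_zero.1 ((mul_eq_zero.1 this).resolve_left Z2_two_ne)

lemma disc_even_id (t ε A A1 g N w0 w1 : ℚ) (hA : A = -9 - 20*t - 10*t^2 + 2*t^5) (hA1 : A1 = 2 + 25*t + 40*t^2 - 15*t^4 + 4*t^5)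
    (hg : g = -4 - 20*t^3 - 10*t^4 + 7*t^5) (hN : N = -1 + t + t^2)
    (hw0 : w0 = 109 + 555*t + 985*t^2 + 355*t^3 - 805*t^4 - 529*t^5 + 385*t^6 + 195*t^7 - 115*t^8 - 10*t^9 + 6*t^10 - ε*N*(-32 + 20*t + 745*t^2 + 1820*t^3 + 1050*t^4 - 1063*t^5 - 960*t^6 + 390*t^7 + 265*t^8 - 100*t^9 + 2*t^10)/2)
    (hw1 : w1 = -74 - 270*t - 330*t^2 - 340*t^3 - 425*t^4 + 79*t^5 + 485*t^6 + 15*t^7 - 155*t^8 + 25*t^9 + 4*t^10 - ε*N*(-8 - 100*t - 160*t^2 - 40*t^3 - 460*t^4 - 1052*t^5 - 225*t^6 + 580*t^7 + 70*t^8 - 145*t^9 + 28*t^10)/2)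
    (he : ε^2*g = -4*(t-2)) :
    A*(2*w0*w1 - (ε*A^2*N)^2) = A1*(w0^2 - A1*(ε*N*(A*w1-A1*w0)) - g*(ε*A*N*w0)) + A*g*(ε*N*(A*w1-A1*w0)) ∧
    A*w1^2 = g*(w0^2 - A1*(ε*N*(A*w1-A1*w0)) - g*(ε*A*N*w0)) := by
  rw [hg] at he
  constructor
  · rw [hw0, hw1, hA, hA1, hg, hN]
    linear_combination (-60713/4 - 278337/2*t - 1824637/4*t^2 - 1278411/4*t^3 + 7346927/4*t^4 + 19914261/4*t^5 + 9379503/4*t^6 - 35132611/4*t^7 - 57894533/4*t^8 - 6125219/4*t^9 + 56850103/4*t^10 + 37638469/4*t^11 - 22797553/4*t^12 - 29407859/4*t^13 + 3139863/4*t^14 + 12150589/4*t^15 + 701147/4*t^16 - 3092639/4*t^17 - 80423*t^18 + 486619/4*t^19 + 9378*t^20 - 10631*t^21 - 128*t^22 + 341*t^23 - 12*t^24) * he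
  · rw [hw0, hw1, hA, hA1, hg, hN]
    linear_combination (220 - 1740*t - 18545*t^2 - 12960*t^3 + 820405/4*t^4 + 959695/2*t^5 - 1585255/4*t^6 - 9633665/4*t^7 - 5907895/4*t^8 + 15880465/4*t^9 + 22907845/4*t^10 - 4806615/4*t^11 - 25108045/4*t^12 - 7102335/4*t^13 + 12788195/4*t^14 + 6494985/4*t^15 - 3784245/4*t^16 - 2401335/4*t^17 + 759645/4*t^18 + 116915*t^19 - 109745/4*t^20 - 10990*t^21 + 4785/2*t^22 + 290*t^23 - 55*t^24) * he

lemma disc_even (MW : MWStmt) (τ ε : Z2) (hε0 : ε ≠ 0) (hε : (2:Z2) ∣ ε)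
    (he : ε^2*(-1 - 40*τ^3 - 40*τ^4 + 56*τ^5) = 2 - 2*τ) : False := by
  obtain ⟨η, hη⟩ := hε
  obtain ⟨A, hA⟩ : ∃ z : Z2, z = (-9 - 40*τ - 40*τ^2 + 64*τ^5) := ⟨_, rfl⟩
  obtain ⟨A1, hA1⟩ : ∃ z : Z2, z = (2 + 50*τ + 160*τ^2 - 240*τ^4 + 128*τ^5) := ⟨_, rfl⟩
  obtain ⟨g, hg⟩ : ∃ z : Z2, z = (-4 - 160*τ^3 - 160*τ^4 + 224*τ^5) := ⟨_, rfl⟩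
  obtain ⟨N, hN⟩ : ∃ z : Z2, z = (-1 + 2*τ + 4*τ^2) := ⟨_, rfl⟩
  obtain ⟨w0, hw0⟩ : ∃ z : Z2, z = (109 + 1110*τ + 3940*τ^2 + 2840*τ^3 - 12880*τ^4 - 16928*τ^5 + 24640*τ^6 + 24960*τ^7 - 29440*τ^8 - 5120*τ^9 + 6144*τ^10) - ε*N*(-16 + 20*τ + 1490*τ^2 + 7280*τ^3 + 8400*τ^4 - 17008*τ^5 - 30720*τ^6 + 24960*τ^7 + 33920*τ^8 - 25600*τ^9 + 1024*τ^10) := ⟨_, rfl⟩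
  obtain ⟨w1, hw1⟩ : ∃ z : Z2, z = (-74 - 540*τ - 1320*τ^2 - 2720*τ^3 - 6800*τ^4 + 2528*τ^5 + 31040*τ^6 + 1920*τ^7 - 39680*τ^8 + 12800*τ^9 + 4096*τ^10) - ε*N*(-4 - 100*τ - 320*τ^2 - 160*τ^3 - 3680*τ^4 - 16832*τ^5 - 7200*τ^6 + 37120*τ^7 + 8960*τ^8 - 37120*τ^9 + 14336*τ^10) := ⟨_, rfl⟩
  have oA : ¬ (2:Z2) ∣ A := Z2_odd_add_two (y := -5 - 20*τ - 20*τ^2 + 32*τ^5) (by rw [hA]; ring)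
  have oN : ¬ (2:Z2) ∣ N := Z2_odd_add_two (y := -1 + τ + 2*τ^2) (by rw [hN]; ring)
  have ow : ¬ (2:Z2) ∣ w0 := by
    refine Z2_odd_add_two (y := 54 + 555*τ + 1970*τ^2 + 1420*τ^3 - 6440*τ^4 - 8464*τ^5 + 12320*τ^6 + 12480*τ^7 - 14720*τ^8 - 2560*τ^9 + 3072*τ^10 - η*N*(-16 + 20*τ + 1490*τ^2 + 7280*τ^3 + 8400*τ^4 - 17008*τ^5 - 30720*τ^6 + 24960*τ^7 + 33920*τ^8 - 25600*τ^9 + 1024*τ^10)) ?_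
    rw [hw0, hη]; ring
  have nz : ∀ x : Z2, ¬ (2:Z2) ∣ x → x ≠ 0 := by
    rintro x hx rfl
    exact hx (dvd_zero _)
  have nzq : ∀ x : Z2, ¬ (2:Z2) ∣ x → (x:ℚ) ≠ 0 := by
    intro x hx h0
    exact nz x hx (Subtype.ext h0)
  have cast : ∀ x y : Z2, x = y → Z2.subtype x = Z2.subtype y := fun x y h => by rw [h]
  have cA := cast _ _ hA
  have cA1 := cast _ _ hA1
  have cg := cast _ _ hg
  have cN := cast _ _ hN
  have cw0 := cast _ _ hw0
  have cw1 := cast _ _ hw1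
  have ce := cast _ _ he
  simp only [map_add, map_sub, map_neg, map_mul, map_pow, map_ofNat, map_one] at cA cA1 cg cN cw0 cw1 ce
  obtain ⟨i3, i4⟩ := disc_even_id (2*Z2.subtype τ) (Z2.subtype ε) (Z2.subtype A) (Z2.subtype A1)
    (Z2.subtype g) (Z2.subtype N) (Z2.subtype w0) (Z2.subtype w1)
    (by rw [cA]; ring) (by rw [cA1]; ring) (by rw [cg]; ring) (by rw [cN]; ring)
    (by rw [cw0]; ring) (by rw [cw1]; ring) (by rw [cg]; linear_combination 4*ce)
  have hA0 : Z2.subtype A ≠ 0 := nzq _ oA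
  have hh := lemma_T' MW (ε*A^2*N) w1 w0 g A1 A
    ((Z2.subtype w0^2 - Z2.subtype A1*(Z2.subtype ε*Z2.subtype N*(Z2.subtype A*Z2.subtype w1-Z2.subtype A1*Z2.subtype w0)) - Z2.subtype g*(Z2.subtype ε*Z2.subtype A*Z2.subtype N*Z2.subtype w0))/Z2.subtype A)
    (Z2.subtype ε*Z2.subtype N*(Z2.subtype A*Z2.subtype w1-Z2.subtype A1*Z2.subtype w0))
    (Z2.subtype ε*Z2.subtype A*Z2.subtype N*Z2.subtype w0)
    (by rw [hη]; exact ⟨η*A^2*N, by ring⟩) ow oA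
    (by
      simp only [map_mul, map_pow]; ring)
    (by
      simp only [map_mul, map_pow]; ring)
    (by
      field_simp; ring)
    (by
      simp only [map_mul, map_pow]
      apply mul_left_cancel₀ hA0
      rw [i3]
      field_simp)
    (by
      apply mul_left_cancel₀ hA0
      rw [i4]
      field_simp)
  exact mul_ne_zero (mul_ne_zero hε0 (pow_ne_zero 2 (nz _ oA))) (nz _ oN) hh

theorem disc_not_square (MW : MWStmt) (t δ : ℚ) (ht : t ≠ 2)
    (h : δ^2 = -(t-2)*(7*t^5 - 10*t^4 - 20*t^3 - 4)) : False := by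
  by_cases htm : t ∈ Z2
  · obtain ⟨x, hx⟩ : ∃ x : Z2, Z2.subtype x = t := ⟨⟨t, htm⟩, rfl⟩
    rcases Z2_parity x with ⟨τ, hτ⟩ | ⟨τ, hτ⟩
    · have hτ' : t = 2*Z2.subtype τ := by rw [← hx, hτ, map_mul, map_ofNat]
      obtain ⟨g, hg⟩ : ∃ g : Z2, g = -1 - 40*τ^3 - 40*τ^4 + 56*τ^5 := ⟨_, rfl⟩
      have og : ¬ (2:Z2) ∣ g := Z2_odd_add_two (y := -1 - 20*τ^3 - 20*τ^4 + 28*τ^5) (by rw [hg]; ring)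
      obtain ⟨gi, hgi, hgi'⟩ := Z2_inv_coe og
      have cg : Z2.subtype g = -1 - 40*(Z2.subtype τ)^3 - 40*(Z2.subtype τ)^4 + 56*(Z2.subtype τ)^5 := by
        rw [hg]; simp only [map_add, map_sub, map_neg, map_mul, map_pow, map_ofNat, map_one]
      have hg0 : Z2.subtype g ≠ 0 := by
        intro h0
        apply og
        have : g = 0 := Subtype.ext h0
        rw [this]; exact dvd_zero _
      have ht0 : t - 2 ≠ 0 := sub_ne_zero.2 ht
      have hgt : 7*t^5 - 10*t^4 - 20*t^3 - 4 = 4*Z2.subtype g := by rw [cg, hτ']; ring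
      rw [hgt] at h
      have hδ : δ ≠ 0 := by
        rintro rfl
        have : (t-2)*(4*Z2.subtype g) = 0 := by linear_combination h
        rcases mul_eq_zero.1 this with h | h
        · exact ht0 h
        · exact hg0 (by linarith)
      have hε2 : (2*(t-2)/δ)^2 = Z2.subtype ((2 - 2*τ)*gi) := by
        have e : Z2.subtype ((2 - 2*τ)*gi) = -(t-2)*(Z2.subtype g)⁻¹ := by
          have : Z2.subtype gi = (Z2.subtype g)⁻¹ := hgi'
          rw [map_mul, this, hτ', map_sub, map_mul, map_ofNat]; ring
        rw [e]; field_simp; linear_combination h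
      have hεm : 2*(t-2)/δ ∈ Z2 := Z2_pow_mem (n := 2) (by norm_num) (hε2 ▸ ((2 - 2*τ)*gi).2)
      obtain ⟨ε, hε⟩ : ∃ x : Z2, Z2.subtype x = 2*(t-2)/δ := ⟨⟨_, hεm⟩, rfl⟩
      have he : ε^2 = (2-2*τ)*gi := by
        apply Z2_inj; rw [map_pow, hε, hε2]
      refine disc_even MW τ ε ?_ ?_ ?_
      · rintro rfl
        rw [map_zero] at hε
        have : 2*(t-2)/δ ≠ 0 := by positivity
        exact this hε.symm
      · apply Z2_prime.dvd_of_dvd_pow (n := 2)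
        rw [he]; exact ⟨(1-τ)*gi, by ring⟩
      · rw [← hg, he]; linear_combination (2-2*τ)*hgi
    · have hx1 : x = 1 + 2*τ := by linear_combination hτ
      have hm : δ ∈ Z2 := by
        apply Z2_pow_mem (n := 2) (by norm_num)
        have : δ^2 = Z2.subtype (-(x-2)*(7*x^5 - 10*x^4 - 20*x^3 - 4)) := by
          rw [h, ← hx]; simp only [map_add, map_sub, map_neg, map_mul, map_pow, map_ofNat, map_one]
        rw [this]; exact (-(x-2)*(7*x^5 - 10*x^4 - 20*x^3 - 4)).2
      refine disc_odd τ ⟨δ, hm⟩ ?_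
      rw [← hx1]
      apply Z2_inj
      simp only [map_add, map_sub, map_neg, map_mul, map_pow, map_ofNat, map_one, hx]
      exact h
  · have ht0 : t ≠ 0 := by rintro rfl; exact htm Z2.zero_mem
    obtain ⟨τ, hτ, hτ'⟩ := Z2_inv_even htm
    have hτ2 : Z2.subtype τ = t⁻¹ := hτ'
    have hτ3 : t = (Z2.subtype τ)⁻¹ := by rw [hτ2, inv_inv]
    have hτ0 : Z2.subtype τ ≠ 0 := by rw [hτ2]; exact inv_ne_zero ht0
    have e : (δ*(Z2.subtype τ)^3)^2 = Z2.subtype (-(1-2*τ)*(7 - 10*τ - 20*τ^2 - 4*τ^5)) := by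
      rw [mul_pow, h, hτ3]
      simp only [map_add, map_sub, map_neg, map_mul, map_pow, map_ofNat, map_one]
      field_simp
    have hm : δ*(Z2.subtype τ)^3 ∈ Z2 := by
      apply Z2_pow_mem (n := 2) (by norm_num)
      rw [e]; exact (-(1-2*τ)*(7 - 10*τ - 20*τ^2 - 4*τ^5)).2
    refine disc_pole MW τ ⟨_, hm⟩ hτ ?_
    apply Z2_inj
    rw [map_pow, ← e]; rfl

section Part6
open NumberField

/-! ### The field generated by a fifth root of two -/

section Fifth

variable {L : Type*} [Field L] [NumberField L] {ϖ : 𝓞 L}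

lemma irr_X5 : Irreducible (X^5 - C 2 : ℚ[X]) := by
  refine X_pow_sub_C_irreducible_of_prime (by norm_num) ?_
  intro b hb
  have h1 : padicValRat 2 (b^5) = 1 := by
    rw [hb]; exact_mod_cast padicValRat.self (p := 2) (by norm_num)
  have hb0 : b ≠ 0 := by rintro rfl; norm_num at hb
  rw [padicValRat.pow] at h1
  omega

lemma coe_fifth (h : ϖ^5 = 2) : (ϖ:L)^5 = 2 := by
  have := congrArg (algebraMap (𝓞 L) L) h
  rw [map_pow, map_ofNat] at this
  exact this

lemma minpoly_fifth (h : ϖ^5 = 2) : minpoly ℚ (ϖ : L) = X^5 - C 2 := by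
  symm
  apply minpoly.eq_of_irreducible_of_monic irr_X5
  · simp [coe_fifth h]
  · exact monic_X_pow_sub_C 2 (by norm_num)

lemma fifth_lin (h : ϖ^5 = 2) : LinearIndependent ℚ (fun i : Fin 5 => (ϖ:L)^(i:ℕ)) := by
  have := linearIndependent_pow (K := ℚ) (ϖ : L)
  rw [minpoly_fifth h] at this
  have e : (X^5 - C 2 : ℚ[X]).natDegree = 5 := natDegree_X_pow_sub_C
  rw [e] at this
  exact this

noncomputable def fifthBasis (h : ϖ^5 = 2) (hf : Module.finrank ℚ L = 5) :
    Module.Basis (Fin 5) ℚ L :=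
  basisOfLinearIndependentOfCardEqFinrank (fifth_lin h) (by rw [hf]; rfl)

lemma fifthBasis_apply (h : ϖ^5 = 2) (hf : Module.finrank ℚ L = 5) (i : Fin 5) :
    fifthBasis h hf i = (ϖ:L)^(i:ℕ) := by
  simp [fifthBasis]

lemma fifth_repr (h : ϖ^5 = 2) (hf : Module.finrank ℚ L = 5) (x : Fin 5 → ℚ) :
    (fifthBasis h hf).repr (∑ i, algebraMap ℚ L (x i) * (ϖ:L)^(i:ℕ)) = x := by
  have := (fifthBasis h hf).repr_sum_self x
  simp only [fifthBasis_apply, Algebra.smul_def] at this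
  exact this

lemma norm_fifth (h : ϖ^5 = 2) (hf : Module.finrank ℚ L = 5) (a b c d e : ℚ) :
    Algebra.norm ℚ (algebraMap ℚ L a + algebraMap ℚ L b * ϖ + algebraMap ℚ L c * (ϖ:L)^2
      + algebraMap ℚ L d * (ϖ:L)^3 + algebraMap ℚ L e * (ϖ:L)^4) =
    Matrix.det !![a, 2*e, 2*d, 2*c, 2*b; b, a, 2*e, 2*d, 2*c; c, b, a, 2*e, 2*d;
      d, c, b, a, 2*e; e, d, c, b, a] := by
  have h5 := coe_fifth h
  have e2 : algebraMap ℚ L 2 = 2 := map_ofNat _ 2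
  rw [Algebra.norm_eq_matrix_det (fifthBasis h hf)]
  congr 1
  ext i j
  rw [Algebra.leftMulMatrix_eq_repr_mul, fifthBasis_apply]
  have key : ∀ x : Fin 5 → ℚ, (algebraMap ℚ L a + algebraMap ℚ L b * ϖ + algebraMap ℚ L c * (ϖ:L)^2
      + algebraMap ℚ L d * (ϖ:L)^3 + algebraMap ℚ L e * (ϖ:L)^4) * (ϖ:L)^(j:ℕ)
      = ∑ i, algebraMap ℚ L (x i) * (ϖ:L)^(i:ℕ) → 
      (fifthBasis h hf).repr ((algebraMap ℚ L a + algebraMap ℚ L b * ϖ + algebraMap ℚ L c * (ϖ:L)^2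
      + algebraMap ℚ L d * (ϖ:L)^3 + algebraMap ℚ L e * (ϖ:L)^4) * (ϖ:L)^(j:ℕ)) i = x i := by
    intro x hx; rw [hx, fifth_repr]
  fin_cases j
  · rw [key ![a,b,c,d,e] (by simp [Fin.sum_univ_succ, -eq_ratCast, e2]; ring)]; fin_cases i <;> rfl
  · rw [key ![2*e,a,b,c,d] (by simp [Fin.sum_univ_succ, -eq_ratCast, e2]; linear_combination (algebraMap ℚ L e) * h5)]
    fin_cases i <;> rfl
  · rw [key ![2*d,2*e,a,b,c] (by
      simp [Fin.sum_univ_succ, -eq_ratCast, e2]; linear_combination (algebraMap ℚ L e * ϖ + algebraMap ℚ L d) * h5)]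
    fin_cases i <;> rfl
  · rw [key ![2*c,2*d,2*e,a,b] (by
      simp [Fin.sum_univ_succ, -eq_ratCast, e2]
      linear_combination (algebraMap ℚ L e * ϖ^2 + algebraMap ℚ L d * ϖ + algebraMap ℚ L c) * h5)]
    fin_cases i <;> rfl
  · rw [key ![2*b,2*c,2*d,2*e,a] (by
      simp [Fin.sum_univ_succ, -eq_ratCast, e2]
      linear_combination (algebraMap ℚ L e * ϖ^3 + algebraMap ℚ L d * ϖ^2 + algebraMap ℚ L c * ϖ + algebraMap ℚ L b) * h5)]
    fin_cases i <;> rfl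

lemma norm_beta (h : ϖ^5 = 2) (hf : Module.finrank ℚ L = 5) (c e : ℚ) :
    Algebra.norm ℚ (1 + algebraMap ℚ L c * (ϖ:L)^2 + algebraMap ℚ L e * (ϖ:L)^4) =
      1 + 4*(c^5 - 5*c^3*e + 5*c*e^2) + 16*e^5 := by
  have := norm_fifth h hf 1 0 c 0 e
  simp only [map_one, map_zero, zero_mul, add_zero] at this
  rw [this]
  simp [Matrix.det_succ_row_zero, Fin.sum_univ_succ, Fin.succAbove]
  ring

lemma intnorm_fifth (h : ϖ^5 = 2) (hf : Module.finrank ℚ L = 5) (a b c d e : ℤ) :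
    (Algebra.norm ℤ ((a:𝓞 L) + b * ϖ + c*ϖ^2 + d*ϖ^3 + e*ϖ^4) : ℤ) = 
    Matrix.det !![a, 2*e, 2*d, 2*c, 2*b; b, a, 2*e, 2*d, 2*c; c, b, a, 2*e, 2*d;
      d, c, b, a, 2*e; e, d, c, b, a] := by
  have h1 := norm_fifth h hf a b c d e
  have h2 := Algebra.coe_norm_int (K := L) ((a:𝓞 L) + b * ϖ + c*ϖ^2 + d*ϖ^3 + e*ϖ^4)
  have : ((Algebra.norm ℤ ((a:𝓞 L) + b * ϖ + c*ϖ^2 + d*ϖ^3 + e*ϖ^4) : ℤ):ℚ) = 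
    ((Matrix.det !![a, 2*e, 2*d, 2*c, 2*b; b, a, 2*e, 2*d, 2*c; c, b, a, 2*e, 2*d;
      d, c, b, a, 2*e; e, d, c, b, a] : ℤ) : ℚ) := by
    rw [h2]
    simp only [map_add, map_mul, map_pow, map_intCast] at h1 ⊢
    rw [h1]
    refine Eq.trans ?_ (RingHom.map_det (Int.castRingHom ℚ) _).symm
    congr 1
    ext i j; fin_cases i <;> fin_cases j <;> simp
  exact_mod_cast this

lemma norm_varpi (h : ϖ^5 = 2) (hf : Module.finrank ℚ L = 5) : Algebra.norm ℤ ϖ = 2 := by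
  have := intnorm_fifth h hf 0 1 0 0 0
  rw [show ((0:ℤ):𝓞 L) + (1:ℤ) * ϖ + (0:ℤ)*ϖ^2 + (0:ℤ)*ϖ^3 + (0:ℤ)*ϖ^4 = ϖ by push_cast; ring] at this
  rw [this]; decide +kernel

lemma norm_one_add (h : ϖ^5 = 2) (hf : Module.finrank ℚ L = 5) : Algebra.norm ℤ (1+ϖ) = 3 := by
  have := intnorm_fifth h hf 1 1 0 0 0
  rw [show ((1:ℤ):𝓞 L) + (1:ℤ) * ϖ + (0:ℤ)*ϖ^2 + (0:ℤ)*ϖ^3 + (0:ℤ)*ϖ^4 = 1+ϖ by push_cast; ring] at this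
  rw [this]; decide +kernel

lemma norm_pi5 (h : ϖ^5 = 2) (hf : Module.finrank ℚ L = 5) : Algebra.norm ℤ (1+ϖ^2) = 5 := by
  have := intnorm_fifth h hf 1 0 1 0 0
  rw [show ((1:ℤ):𝓞 L) + (0:ℤ) * ϖ + (1:ℤ)*ϖ^2 + (0:ℤ)*ϖ^3 + (0:ℤ)*ϖ^4 = 1+ϖ^2 by push_cast; ring] at this
  rw [this]; decide +kernel

lemma norm_pi7 (h : ϖ^5 = 2) (hf : Module.finrank ℚ L = 5) : Algebra.norm ℤ (-1+ϖ^3) = 7 := by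
  have := intnorm_fifth h hf (-1) 0 0 1 0
  rw [show ((-1:ℤ):𝓞 L) + (0:ℤ) * ϖ + (0:ℤ)*ϖ^2 + (1:ℤ)*ϖ^3 + (0:ℤ)*ϖ^4 = -1+ϖ^3 by push_cast; ring] at this
  rw [this]; decide +kernel

lemma norm_pi13 (h : ϖ^5 = 2) (hf : Module.finrank ℚ L = 5) : Algebra.norm ℤ (1-ϖ^2+ϖ^4) = 13 := by
  have := intnorm_fifth h hf 1 0 (-1) 0 1
  rw [show ((1:ℤ):𝓞 L) + (0:ℤ) * ϖ + (-1:ℤ)*ϖ^2 + (0:ℤ)*ϖ^3 + (1:ℤ)*ϖ^4 = 1-ϖ^2+ϖ^4 by push_cast; ring] at this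
  rw [this]; decide +kernel

lemma norm_eta1 (h : ϖ^5 = 2) (hf : Module.finrank ℚ L = 5) : Algebra.norm ℤ (1-ϖ) = -1 := by
  have := intnorm_fifth h hf 1 (-1) 0 0 0
  rw [show ((1:ℤ):𝓞 L) + (-1:ℤ) * ϖ + (0:ℤ)*ϖ^2 + (0:ℤ)*ϖ^3 + (0:ℤ)*ϖ^4 = 1-ϖ by push_cast; ring] at this
  rw [this]; decide +kernel

lemma norm_eta2 (h : ϖ^5 = 2) (hf : Module.finrank ℚ L = 5) : Algebra.norm ℤ (1+ϖ+ϖ^3) = 1 := by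
  have := intnorm_fifth h hf 1 1 0 1 0
  rw [show ((1:ℤ):𝓞 L) + (1:ℤ) * ϖ + (0:ℤ)*ϖ^2 + (1:ℤ)*ϖ^3 + (0:ℤ)*ϖ^4 = 1+ϖ+ϖ^3 by push_cast; ring] at this
  rw [this]; decide +kernel

end Fifth

end Part6

section Part7
open NumberField

section Fifth

variable {L : Type*} [Field L] [NumberField L] {ϖ : 𝓞 L}

lemma discr_fifthBasis (h : ϖ^5 = 2) (hf : Module.finrank ℚ L = 5) :
    Algebra.discr ℚ (fifthBasis h hf) = 50000 := by
  let pb : PowerBasis ℚ L := ⟨(ϖ:L), 5, fifthBasis h hf, fun i => fifthBasis_apply h hf i⟩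
  have := Algebra.discr_powerBasis_eq_norm ℚ pb
  change Algebra.discr ℚ (fifthBasis h hf) = _ * Algebra.norm ℚ (aeval (ϖ:L) (derivative (minpoly ℚ (ϖ:L)))) at this
  rw [this, minpoly_fifth h, hf]
  have h2 := norm_fifth h hf 0 0 0 0 5
  have e : aeval (ϖ:L) (derivative (X^5 - C 2 : ℚ[X])) = algebraMap ℚ L 5 * (ϖ:L)^4 := by
    simp [-eq_ratCast, map_ofNat]; left; norm_num
  rw [e]
  simp only [map_zero, zero_mul, zero_add] at h2
  rw [h2]
  simp [Matrix.det_succ_row_zero, Fin.sum_univ_succ, Fin.succAbove]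
  norm_num

lemma discr_fifth (h : ϖ^5 = 2) (hf : Module.finrank ℚ L = 5) : |discr L| ≤ 50000 := by
  classical
  have hcard : Fintype.card (Module.Free.ChooseBasisIndex ℤ (𝓞 L)) = Fintype.card (Fin 5) := by
    rw [← Module.finrank_eq_card_chooseBasisIndex, RingOfIntegers.rank, hf]; rfl
  let e := Fintype.equivOfCardEq hcard
  let B := (integralBasis L).reindex e
  let P : Matrix (Fin 5) (Fin 5) ℤ := fun i j => (RingOfIntegers.basis L).repr (ϖ^(j:ℕ)) (e.symm i)
  have hP : B.toMatrix (fifthBasis h hf) = P.map (Int.castRingHom ℚ) := by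
    ext i j
    rw [Module.Basis.toMatrix_apply, fifthBasis_apply]
    simp only [B, P, Module.Basis.repr_reindex, Finsupp.mapDomain_equiv_apply, Matrix.map_apply]
    have := integralBasis_repr_apply L (ϖ^(j:ℕ)) (e.symm i)
    rw [map_pow] at this
    rw [this]; rfl
  have h1 := Algebra.discr_of_matrix_vecMul B (B.toMatrix (fifthBasis h hf))
  rw [Module.Basis.toMatrix_map_vecMul, discr_fifthBasis, hP, ← RingHom.mapMatrix_apply,
    ← RingHom.map_det] at h1
  have h2 : Algebra.discr ℚ B = discr L := by
    rw [coe_discr, ← Algebra.discr_reindex ℚ (integralBasis L) e, Module.Basis.coe_reindex]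
  rw [h2] at h1
  have h3 : (50000:ℤ) = P.det^2 * discr L := by
    have : ((50000:ℤ):ℚ) = ((P.det^2 * discr L : ℤ) : ℚ) := by rw [Int.cast_mul, Int.cast_pow]; simpa using h1
    exact_mod_cast this
  exact Int.le_of_dvd (by norm_num) (by rw [abs_dvd]; exact ⟨P.det^2, by rw [h3]; ring⟩)

lemma nrComplex_le (hf : Module.finrank ℚ L = 5) : InfinitePlace.nrComplexPlaces L ≤ 2 := by
  have := InfinitePlace.card_add_two_mul_card_eq_rank L
  omega

open Real Nat in
lemma minkowski_fifth (h : ϖ^5 = 2) (hf : Module.finrank ℚ L = 5) :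
    (4 / π) ^ InfinitePlace.nrComplexPlaces L *
  ((Module.finrank ℚ L)! / (Module.finrank ℚ L) ^ (Module.finrank ℚ L) * √|discr L|) < (14:ℝ) := by
  have h1 : (|discr L| : ℝ) ≤ 50000 := by exact_mod_cast discr_fifth h hf
  have h2 : √|(discr L:ℝ)| ≤ 223.61 := by
    rw [Real.sqrt_le_left (by norm_num)]; linarith
  have hpi : (4/π:ℝ) ≤ 1.27329 := by
    rw [div_le_iff₀ Real.pi_pos]; linarith [Real.pi_gt_d6]
  have hpi1 : (1:ℝ) ≤ 4/π := by
    rw [le_div_iff₀ Real.pi_pos]; linarith [Real.pi_lt_four]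
  have h3 : (4/π:ℝ)^ InfinitePlace.nrComplexPlaces L ≤ 1.27329^2 :=
    (pow_le_pow_right₀ hpi1 (nrComplex_le hf)).trans (by gcongr)
  rw [hf]
  have h5 : ((5 ! : ℕ):ℝ) = 120 := by norm_num [Nat.factorial]
  rw [h5]
  calc _ ≤ (1.27329^2 : ℝ) * (120 / ((5:ℕ):ℝ)^5 * 223.61) := by gcongr
    _ < 14 := by norm_num

lemma prime_eq_span {P : Ideal (𝓞 L)} (hP : P.IsPrime) {γ : 𝓞 L} {p : ℕ} (hp : p.Prime)
    (hγ : Algebra.norm ℤ γ = p) (hm : γ ∈ P) : Submodule.IsPrincipal P := by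
  have h1 : Ideal.absNorm (Ideal.span {γ}) = p := by
    rw [Ideal.absNorm_span_singleton, hγ]; rfl
  have h2 : (Ideal.span {γ}).IsPrime := Ideal.isPrime_of_irreducible_absNorm (by rw [h1]; exact hp)
  have h3 : Ideal.span {γ} ≠ ⊥ := by
    intro h; rw [h, Ideal.absNorm_bot] at h1; exact hp.ne_zero h1.symm
  have h4 := (Ideal.IsPrime.isMaximal h2 h3).eq_of_le hP.ne_top ((Ideal.span_singleton_le_iff_mem P).mpr hm)
  exact ⟨γ, h4.symm⟩

lemma pid_prime (h : ϖ^5 = 2) (hf : Module.finrank ℚ L = 5) (P : Ideal (𝓞 L)) (hP : P.IsPrime)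
    (h0 : P ≠ ⊥) (hN : Ideal.absNorm P ≤ 13) : Submodule.IsPrincipal P := by
  have hmax := hP.isMaximal h0
  let _ : Field (𝓞 L ⧸ P) := Ideal.Quotient.field P
  have hq : Nat.card (𝓞 L ⧸ P) = Ideal.absNorm P := by
    rw [Ideal.absNorm_apply]; rfl
  have hne : Ideal.absNorm P ≠ 0 := by rwa [Ne, Ideal.absNorm_eq_zero_iff]
  have : Finite (𝓞 L ⧸ P) := Nat.finite_of_card_ne_zero (by rw [hq]; exact hne)
  let _ : Fintype (𝓞 L ⧸ P) := Fintype.ofFinite _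
  have hq' : Fintype.card (𝓞 L ⧸ P) = Ideal.absNorm P := by rw [← hq, Nat.card_eq_fintype_card]
  have hc : ((Ideal.absNorm P : ℕ) : 𝓞 L ⧸ P) = 0 := by rw [← hq']; exact Nat.cast_card_eq_zero _
  have hx : ∀ x : 𝓞 L ⧸ P, x ^ (Ideal.absNorm P) = x := by
    intro x; rw [← hq']; exact FiniteField.pow_card x
  have hpp : IsPrimePow (Ideal.absNorm P) := by
    rw [← hq']; exact Fintype.isPrimePow_card_of_field
  have mem : ∀ γ : 𝓞 L, Ideal.Quotient.mk P γ = 0 → γ ∈ P := fun γ h => Ideal.Quotient.eq_zero_iff_mem.mp h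
  set x := Ideal.Quotient.mk P ϖ with hxd
  have h5 : x^5 = 2 := by rw [hxd, ← map_pow, h, map_ofNat]
  have hxx := hx x
  have two_case : (2 : 𝓞 L ⧸ P) = 0 → Submodule.IsPrincipal P := by
    intro h2
    exact prime_eq_span hP Nat.prime_two (norm_varpi h hf) (mem _ (by
      rw [h2] at h5; exact pow_eq_zero_iff (by norm_num) |>.mp h5))
  have three_case : (3 : 𝓞 L ⧸ P) = 0 → (x^9 = x) → Submodule.IsPrincipal P := by
    intro h3 h9
    refine prime_eq_span hP Nat.prime_three (norm_one_add h hf) (mem _ ?_)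
    rw [map_add, map_one]
    change 1 + x = 0
    have hx2 : x^2 = 4 := by linear_combination (x^5+2)*h5 - x*h9
    linear_combination (1-5*x)*h3 + h5 - x*(x^2+4)*hx2
  have xne : (2 : 𝓞 L ⧸ P) ≠ 0 → x ≠ 0 := by
    intro h2 hx; rw [hx] at h5; exact h2 (by rw [← h5]; norm_num)
  have one_ne : (1 : 𝓞 L ⧸ P) ≠ 0 := one_ne_zero
  interval_cases hn : Ideal.absNorm P
  · exact absurd rfl hne
  · exact absurd hpp not_isPrimePow_one
  · exact two_case (by exact_mod_cast hc)
  · exact three_case (by exact_mod_cast hc) (by linear_combination (x^6+x^4+x^2)*hxx+ hxx)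
  · exact two_case (by
      have : (2 : 𝓞 L ⧸ P)^2 = 0 := by push_cast at hc; linear_combination hc
      exact pow_eq_zero_iff (by norm_num) |>.mp this)
  · push_cast at hc
    refine prime_eq_span hP Nat.prime_five (norm_pi5 h hf) (mem _ ?_)
    rw [map_add, map_one, map_pow]
    change 1 + x^2 = 0
    have : x = 2 := by linear_combination h5 - hxx
    rw [this]; linear_combination hc
  · exfalso; revert hpp; decide +kernel
  · push_cast at hc
    have h2 : (2 : 𝓞 L ⧸ P) ≠ 0 := fun h2 => one_ne (by linear_combination hc - 3*h2)
    refine prime_eq_span hP (by norm_num : Nat.Prime 7) (norm_pi7 h hf) (mem _ ?_)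
    rw [map_add, map_neg, map_one, map_pow]
    change -1 + x^3 = 0
    have h2x : 2*x = 1 := mul_left_cancel₀ (xne h2) (by linear_combination hxx - x^2*h5)
    have : x = 4 := by linear_combination 4*h2x - x*hc
    rw [this]; linear_combination 9*hc
  · exact two_case (by
      have : (2 : 𝓞 L ⧸ P)^3 = 0 := by push_cast at hc; linear_combination hc
      exact pow_eq_zero_iff (by norm_num) |>.mp this)
  · exact three_case (by
      have : (3 : 𝓞 L ⧸ P)^2 = 0 := by push_cast at hc; linear_combination hc
      exact pow_eq_zero_iff (by norm_num) |>.mp this) hxx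
  · exfalso; revert hpp; decide +kernel
  · exfalso
    push_cast at hc
    have h2 : (2 : 𝓞 L ⧸ P) ≠ 0 := fun h2 => one_ne (by linear_combination hc - 5*h2)
    have : (3:𝓞 L ⧸ P) = 0 := mul_left_cancel₀ (xne h2) (by linear_combination hxx - x*(x^5+2)*h5)
    exact one_ne (by linear_combination 4*this - hc)
  · exfalso; revert hpp; decide +kernel
  · push_cast at hc
    have h2 : (2 : 𝓞 L ⧸ P) ≠ 0 := fun h2 => one_ne (by linear_combination hc - 6*h2)
    refine prime_eq_span hP (by norm_num : Nat.Prime 13) (norm_pi13 h hf) (mem _ ?_)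
    rw [map_add, map_sub, map_one, map_pow, map_pow]
    change 1 - x^2 + x^4 = 0
    have h2x : 4*x^2 = 1 := mul_left_cancel₀ (xne h2) (by linear_combination hxx - x^3*(x^5+2)*h5)
    have : x^2 = 10 := by linear_combination 10*h2x - 3*x^2*hc
    linear_combination (x^2+9)*this + 7*hc

lemma pid_fifth (h : ϖ^5 = 2) (hf : Module.finrank ℚ L = 5) : IsPrincipalIdealRing (𝓞 L) := by
  refine RingOfIntegers.isPrincipalIdealRing_of_isPrincipal_of_norm_le_of_isPrime ?_
  intro I hI hN
  refine pid_prime h hf _ hI (nonZeroDivisors.coe_ne_zero I) ?_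
  have := lt_of_le_of_lt hN (minkowski_fifth h hf)
  have h14 : Ideal.absNorm (I : Ideal (𝓞 L)) < 14 := by exact_mod_cast this
  omega

end Fifth

end Part7

section Part8
open NumberField

section Fifth

variable {L : Type*} [Field L] [NumberField L] {ϖ : 𝓞 L}

lemma varpi_ne_zero (h : ϖ^5 = 2) : ϖ ≠ 0 := by
  rintro rfl
  norm_num at h

lemma varpi_prime (h : ϖ^5 = 2) (hf : Module.finrank ℚ L = 5) : Prime ϖ := by
  rw [← Ideal.span_singleton_prime (varpi_ne_zero h)]
  apply Ideal.isPrime_of_irreducible_absNorm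
  rw [Ideal.absNorm_span_singleton, norm_varpi h hf]
  exact Nat.prime_two

lemma varpi_cases (h : ϖ^5 = 2) (hf : Module.finrank ℚ L = 5) (s : 𝓞 L) : ϖ ∣ s ∨ ϖ ∣ s - 1 := by
  have h1 : Nat.card (𝓞 L ⧸ Ideal.span {ϖ}) = 2 := by
    have : Ideal.absNorm (Ideal.span {ϖ}) = 2 := by
      rw [Ideal.absNorm_span_singleton, norm_varpi h hf]; rfl
    rw [← this, Ideal.absNorm_apply]; rfl
  obtain ⟨y, hy, huniq⟩ := (Nat.card_eq_two_iff' (0 : 𝓞 L ⧸ Ideal.span {ϖ})).mp h1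
  by_cases hs : Ideal.Quotient.mk (Ideal.span {ϖ}) s = 0
  · left; rwa [← Ideal.mem_span_singleton, ← Ideal.Quotient.eq_zero_iff_mem]
  · right
    rw [← Ideal.mem_span_singleton, ← Ideal.Quotient.eq_zero_iff_mem, map_sub, map_one, sub_eq_zero]
    rw [huniq _ hs]
    refine (huniq 1 ?_).symm
    intro h1
    have : (1 : 𝓞 L) ∈ Ideal.span {ϖ} := by rw [← Ideal.Quotient.eq_zero_iff_mem, map_one, h1]
    rw [Ideal.mem_span_singleton] at this
    exact (varpi_prime h hf).not_isUnit (isUnit_of_dvd_one this)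

lemma sq_mod4 (h : ϖ^5 = 2) (hf : Module.finrank ℚ L = 5) (s : 𝓞 L) (hs : ¬ ϖ ∣ s) :
    ϖ^4 ∣ s^2 - 1 ∨ ϖ^4 ∣ s^2 - (1+ϖ^2) := by
  obtain ⟨r, hr⟩ := (varpi_cases h hf s).resolve_left hs
  have hs : s = 1 + ϖ*r := by linear_combination hr
  rcases varpi_cases h hf r with ⟨r', hr'⟩ | ⟨r', hr'⟩
  · left; rw [hs, hr']
    refine ⟨ϖ^3*r' + r'^2, ?_⟩
    linear_combination (-ϖ^2*r')*h
  · right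
    have hr2 : r = 1 + ϖ*r' := by linear_combination hr'
    rw [hs, hr2]
    refine ⟨ϖ^2*(1+ϖ*r') + ϖ^4*r' + r'^2, ?_⟩
    linear_combination -(ϖ + ϖ^2*r'+ϖ^3*r')*h

lemma not_dvd_pow (h : ϖ^5 = 2) (hf : Module.finrank ℚ L = 5) (k : ℕ) (hk : k ≤ 3) (m : 𝓞 L) :
    ¬ ϖ^4 ∣ ϖ^k * (1 + ϖ*m) := by
  intro hd
  have h1 : ϖ^k * ϖ ∣ ϖ^k * (1+ϖ*m) := by
    rw [← pow_succ]; exact (pow_dvd_pow ϖ (by omega)).trans hd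
  have h2 := (mul_dvd_mul_iff_left (pow_ne_zero k (varpi_ne_zero h))).mp h1
  rw [add_comm, dvd_add_right (dvd_mul_right _ _)] at h2
  exact (varpi_prime h hf).not_isUnit (isUnit_of_dvd_one h2)

lemma mod4_A (h : ϖ^5 = 2) (hf : Module.finrank ℚ L = 5) (a t s : 𝓞 L) (ht : ¬ ϖ ∣ t) (hs : ¬ ϖ ∣ s)
    (hd : ϖ^4 ∣ a*t^2 - s^2) : ϖ^4 ∣ a - 1 ∨ ϖ^4 ∣ a - (1+ϖ^2) := by
  have hts : ¬ ϖ ∣ t*s := fun hh => ((varpi_prime h hf).dvd_or_dvd hh).elim ht hs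
  have h4 : ϖ^4 ∣ t^4 - 1 := by
    rcases sq_mod4 h hf t ht with ⟨c, hc⟩ | ⟨c, hc⟩
    · exact ⟨c*(t^2+1), by linear_combination (t^2+1)*hc⟩
    · exact ⟨c*(t^2+1+ϖ^2) + ϖ^3+1, by linear_combination (t^2+1+ϖ^2)*hc - ϖ^2*h⟩
  obtain ⟨c, hc⟩ := h4
  obtain ⟨d, hd⟩ := hd
  rcases sq_mod4 h hf _ hts with ⟨e, he⟩ | ⟨e, he⟩
  · left; exact ⟨-a*c + d*t^2 + e, by linear_combination -a*hc + t^2*hd + he⟩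
  · right; exact ⟨-a*c + d*t^2 + e, by linear_combination -a*hc + t^2*hd + he⟩

lemma eta_odd1 (h : ϖ^5 = 2) (hf : Module.finrank ℚ L = 5) : ¬ ϖ ∣ 1 - ϖ := by
  intro hh; have := (dvd_add_left (dvd_refl ϖ)).mpr hh
  rw [sub_add_cancel] at this
  exact (varpi_prime h hf).not_isUnit (isUnit_of_dvd_one this)

lemma eta_odd2 (h : ϖ^5 = 2) (hf : Module.finrank ℚ L = 5) : ¬ ϖ ∣ 1 + ϖ+ϖ^3 := by
  rintro ⟨c, hc⟩
  have : ϖ ∣ 1 := ⟨c-1-ϖ^2, by linear_combination hc⟩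
  exact (varpi_prime h hf).not_isUnit (isUnit_of_dvd_one this)

lemma mod4_B (h : ϖ^5 = 2) (hf : Module.finrank ℚ L = 5) (i j k : ℕ) (t s : 𝓞 L)
    (ht : ¬ ϖ ∣ t) (hs : ¬ ϖ ∣ s)
    (hd : ϖ^4 ∣ (-1)^i*(1-ϖ)^j*(1+ϖ+ϖ^3)^k*t^2 - s^2) : Even j ∧ Even k := by
  have hd1 : ϖ^4 ∣ (1-ϖ)^j*(1+ϖ+ϖ^3)^k*t^2 - s^2 := by
    rcases neg_one_pow_eq_or (𝓞 L) i with hi | hi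
    · rw [hi, one_mul] at hd; exact hd
    · rw [hi] at hd
      obtain ⟨c, hc⟩ := hd
      refine ⟨c + ϖ*(1-ϖ)^j*(1+ϖ+ϖ^3)^k*t^2, ?_⟩
      linear_combination hc - ((1-ϖ)^j*(1+ϖ+ϖ^3)^k*t^2)*h
  obtain ⟨q, r, hr, hj⟩ : ∃ q r, r < 2 ∧ j = 2*q + r := ⟨j/2, j%2, Nat.mod_lt _ (by norm_num), by omega⟩
  obtain ⟨q', r', hr', hk⟩ : ∃ q r, r < 2 ∧ k = 2*q + r := ⟨k/2, k%2, Nat.mod_lt _ (by norm_num), by omega⟩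
  have hp := varpi_prime h hf
  have ht' : ¬ ϖ ∣ (1-ϖ)^q*(1+ϖ+ϖ^3)^q'*t := by
    intro hh
    rcases hp.dvd_or_dvd hh with hh | hh
    · rcases hp.dvd_or_dvd hh with hh | hh
      · exact eta_odd1 h hf (hp.dvd_of_dvd_pow hh)
      · exact eta_odd2 h hf (hp.dvd_of_dvd_pow hh)
    · exact ht hh
  have := mod4_A h hf ((1-ϖ)^r*(1+ϖ+ϖ^3)^r') _ s ht' hs (by
    convert hd1 using 2
    rw [hj, hk]; ring)
  interval_cases r <;> interval_cases r'
  · exact ⟨⟨q, by omega⟩, ⟨q', by omega⟩⟩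
  · exfalso
    rcases this with hh | hh
    · refine not_dvd_pow h hf 1 (by norm_num) (ϖ) ?_
      convert hh using 1; ring
    · refine not_dvd_pow h hf 1 (by norm_num) (ϖ-1) ?_
      convert hh using 1; ring
  · exfalso
    rcases this with hh | hh
    · refine not_dvd_pow h hf 1 (by norm_num) 0 ?_
      rw [← dvd_neg]
      convert hh using 1; ring
    · refine not_dvd_pow h hf 1 (by norm_num) 1 ?_
      rw [← dvd_neg]
      convert hh using 1; ring
  · exfalso
    rcases this with hh | hh
    · refine not_dvd_pow h hf 2 (by norm_num) (-1+ϖ) ?_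
      rw [← dvd_neg]
      convert hh using 1; ring
    · refine not_dvd_pow h hf 3 (by norm_num) (-1-ϖ^3) ?_
      convert hh using 1; linear_combination -ϖ^2*h

lemma nrReal_fifth (h : ϖ^5 = 2) (hf : Module.finrank ℚ L = 5) : InfinitePlace.nrRealPlaces L ≤ 1 := by
  classical
  rw [← InfinitePlace.card_real_embeddings, Fintype.card_le_one_iff_subsingleton]
  constructor
  rintro ⟨φ, hφ⟩ ⟨ψ, hψ⟩
  have key : ∀ φ : L →+* ℂ, ComplexEmbedding.IsReal φ → ∃ r : ℝ, φ (ϖ:L) = r ∧ r^5 = 2 := by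
    intro φ hφ
    refine ⟨hφ.embedding (ϖ:L), (hφ.coe_embedding_apply _).symm, ?_⟩
    rw [← map_pow, coe_fifth h, map_ofNat]
  obtain ⟨r, hr, hr5⟩ := key φ hφ
  obtain ⟨r', hr', hr5'⟩ := key ψ hψ
  have hrr : r = r' := (Odd.strictMono_pow (by decide : Odd 5)).injective (hr5.trans hr5'.symm)
  have hlin : φ.toRatAlgHom = ψ.toRatAlgHom := by
    have : φ.toRatAlgHom.toLinearMap = ψ.toRatAlgHom.toLinearMap := by
      apply (fifthBasis h hf).ext
      intro i
      simp [fifthBasis_apply, hr, hr', hrr]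
    exact AlgHom.toLinearMap_injective this
  apply Subtype.ext
  ext x
  exact DFunLike.congr_fun hlin x

lemma rank_fifth (h : ϖ^5 = 2) (hf : Module.finrank ℚ L = 5) : Units.rank L = 2 := by
  have h1 := InfinitePlace.card_add_two_mul_card_eq_rank L
  have h2 := nrReal_fifth h hf
  rw [Units.rank, InfinitePlace.card_eq_nrRealPlaces_add_nrComplexPlaces]
  omega

lemma exists_bits (hf : Module.finrank ℚ L = 5) : ∃ b : (𝓞 L)ˣ → Bool × (Fin (Units.rank L) → ZMod 2),
    ∀ x y, b x = b y → ∃ s, x * y = s^2 := by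
  classical
  have H : ∀ x : (𝓞 L)ˣ, ∃ (z : Bool) (e : Fin (Units.rank L) → ℤ),
      x = (if z then 1 else -1) * ∏ i, (Units.fundSystem L i) ^ (e i) := by
    intro x
    obtain ⟨⟨z, e⟩, hx, -⟩ := Units.exist_unique_eq_mul_prod L x
    rcases Units.torsion_eq_one_or_neg_one_of_odd_finrank (K := L) (by rw [hf]; decide) z with hz | hz
    · exact ⟨true, e, by simpa [hz] using hx⟩
    · exact ⟨false, e, by simpa [hz] using hx⟩
  choose z e hze using H
  refine ⟨fun x => (z x, fun i => (e x i : ZMod 2)), ?_⟩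
  intro x y hxy
  simp only [Prod.mk.injEq] at hxy
  obtain ⟨hz, he⟩ := hxy
  have he' : ∀ i, ∃ k, e x i + e y i = 2 * k := by
    intro i
    have := congrFun he i

    have h2 := (ZMod.intCast_eq_intCast_iff_dvd_sub _ _ _).mp this
    push_cast at h2
    exact ⟨(e x i + e y i)/2, by omega⟩
  choose k hk using he'
  refine ⟨∏ i, (Units.fundSystem L i)^(k i), ?_⟩
  conv_lhs => rw [hze x, hze y, hz]
  have e1 : ((if z y = true then 1 else -1) : (𝓞 L)ˣ) * (if z y = true then 1 else -1) = 1 := by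
    split_ifs <;> simp
  rw [mul_mul_mul_comm, e1, one_mul, ← Finset.prod_mul_distrib, ← Finset.prod_pow]
  refine Finset.prod_congr rfl fun i _ => ?_
  rw [← zpow_add, hk, mul_comm, zpow_mul]; norm_cast

lemma units_fifth (h : ϖ^5 = 2) (hf : Module.finrank ℚ L = 5) (x : (𝓞 L)ˣ) :
    ∃ (i j k : ℕ) (s : 𝓞 L), (x : 𝓞 L) = (-1)^i*(1-ϖ)^j*(1+ϖ+ϖ^3)^k*s^2 ∧ ¬ ϖ ∣ s := by
  obtain ⟨b, hb⟩ := exists_bits (L := L) hf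
  have hu1 : IsUnit (1-ϖ) := by
    apply IsUnit.of_mul_eq_one (-(1+ϖ+ϖ^2+ϖ^3+ϖ^4)); linear_combination h
  have hu2 : IsUnit (1+ϖ+ϖ^3) := by
    rw [isUnit_iff_norm, RingOfIntegers.coe_norm, ← Algebra.coe_norm_int, norm_eta2 h hf]; simp
  obtain ⟨e1, he1⟩ := hu1
  obtain ⟨e2, he2⟩ := hu2
  have nu : ∀ s : (𝓞 L)ˣ, ¬ ϖ ∣ (s : 𝓞 L) := fun s hs =>
    (varpi_prime h hf).not_isUnit (isUnit_of_dvd_unit hs s.isUnit)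
  let η : Fin 2 × Fin 2 × Fin 2 → (𝓞 L)ˣ := fun p => (-1)^(p.1:ℕ) * e1^(p.2.1:ℕ) * e2^(p.2.2:ℕ)
  have hη : ∀ p, ((η p : (𝓞 L)ˣ) : 𝓞 L) = (-1)^(p.1:ℕ)*(1-ϖ)^(p.2.1:ℕ)*(1+ϖ+ϖ^3)^(p.2.2:ℕ) := by
    intro p; simp [η, he1, he2]
  have hinj : Function.Injective (b ∘ η) := by
    rintro ⟨i, j, k⟩ ⟨i', j', k'⟩ hxy
    obtain ⟨s, hs⟩ := hb _ _ hxy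
    have hs' := congrArg (fun x : (𝓞 L)ˣ => (x : 𝓞 L)) hs
    simp only [Units.val_mul, hη, Units.val_pow_eq_pow_val] at hs'
    have h1 := mod4_B h hf ((i:ℕ)+i') (j+j') (k+k') 1 s
      (fun hh => (varpi_prime h hf).not_isUnit (isUnit_of_dvd_one hh)) (nu s) ⟨0, by
        rw [← hs']; ring⟩
    have hN := congrArg (Algebra.norm ℤ) hs'
    simp only [map_mul, map_pow, norm_eta1 h hf, norm_eta2 h hf] at hN
    have hm1 : Algebra.norm ℤ (-1 : 𝓞 L) = -1 := by
      have := intnorm_fifth h hf (-1) 0 0 0 0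
      rw [show ((-1:ℤ):𝓞 L) + (0:ℤ) * ϖ + (0:ℤ)*ϖ^2 + (0:ℤ)*ϖ^3 + (0:ℤ)*ϖ^4 = -1 by push_cast; ring] at this
      rw [this]; decide +kernel
    rw [hm1] at hN
    have hj : j = j' := by have := h1.1.two_dvd; apply Fin.ext; omega
    have hk : k = k' := by have := h1.2.two_dvd; apply Fin.ext; omega
    subst hj hk
    have hi : i = i' := by
      have : 0 ≤ Algebra.norm ℤ (s : 𝓞 L)^2 := sq_nonneg _
      rw [← hN] at this
      fin_cases i <;> fin_cases i' <;> fin_cases j <;> simp at this ⊢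
    rw [hi]
  have hcard : Fintype.card (Fin 2 × Fin 2 × Fin 2) =
      Fintype.card (Bool × (Fin (Units.rank L) → ZMod 2)) := by
    rw [rank_fifth h hf]; rfl
  have hsurj := ((Fintype.bijective_iff_injective_and_card _).mpr ⟨hinj, hcard⟩).2
  obtain ⟨p, hp⟩ := hsurj (b x)
  obtain ⟨s, hs⟩ := hb _ _ hp
  refine ⟨p.1, p.2.1, p.2.2, ((s * (η p)⁻¹ : (𝓞 L)ˣ) : 𝓞 L), ?_, nu _⟩
  rw [← hη, ← Units.val_pow_eq_pow_val, ← Units.val_mul, mul_pow, ← hs]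
  congr 1
  rw [inv_pow, sq]
  rw [mul_inv]; calc x = (η p * (η p)⁻¹) * (η p * (η p)⁻¹) * x := by simp
    _ = _ := by ac_rfl
  

/-- A unit of norm one which is locally a square at the prime above two is a square. -/
lemma unit_square (h : ϖ^5 = 2) (hf : Module.finrank ℚ L = 5) (x : (𝓞 L)ˣ)
    (hN : Algebra.norm ℤ (x : 𝓞 L) = 1) (s y : 𝓞 L) (hs : ¬ ϖ ∣ s) (hy : ¬ ϖ ∣ y)
    (hd : ϖ^4 ∣ (x : 𝓞 L)*s^2 - y^2) : ∃ r : 𝓞 L, (x:𝓞 L) = r^2 := by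
  obtain ⟨i, j, k, r, hx, hr⟩ := units_fifth h hf x
  have hrs : ¬ ϖ ∣ r*s := fun hh => ((varpi_prime h hf).dvd_or_dvd hh).elim hr hs
  obtain ⟨⟨j', hj⟩, ⟨k', hk⟩⟩ := mod4_B h hf i j k (r*s) y hrs hy (by
    convert hd using 2; rw [hx]; ring)
  have hm1 : Algebra.norm ℤ (-1 : 𝓞 L) = -1 := by
    have := intnorm_fifth h hf (-1) 0 0 0 0
    rw [show ((-1:ℤ):𝓞 L) + (0:ℤ) * ϖ + (0:ℤ)*ϖ^2 + (0:ℤ)*ϖ^3 + (0:ℤ)*ϖ^4 = -1 by push_cast; ring] at this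
    rw [this]; decide +kernel
  have hi : (-1:𝓞 L)^i = 1 := by
    rcases Nat.even_or_odd i with hi | hi
    · exact hi.neg_one_pow
    · exfalso
      rw [hx, hj, hk, hi.neg_one_pow] at hN
      simp only [map_mul, map_pow, hm1] at hN
      rw [← two_mul, ← two_mul, mul_comm 2 j', mul_comm 2 k', pow_mul, pow_mul] at hN
      have : 0 ≤ ((Algebra.norm ℤ (1-ϖ)) ^ j') ^ 2 * ((Algebra.norm ℤ (1 + ϖ + ϖ ^ 3)) ^ k') ^ 2 * (Algebra.norm ℤ) r ^ 2 := by positivity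
      linarith
  refine ⟨(1-ϖ)^j'*(1+ϖ+ϖ^3)^k'*r, ?_⟩
  rw [hx, hi, hj, hk]; ring

end Fifth

end Part8

section Part9
open NumberField

section LocalClaim

variable {L : Type*} [Field L] (V : ValuationSubring L)

/-- `z` is a nonzero square up to a unit of `V`. -/
def SqU (z : L) : Prop := ∃ q : L, q ≠ 0 ∧ ∃ e : V, IsUnit e ∧ z = q^2 * (e:L)

variable {V}

@[simp, norm_cast]
lemma vs_coe2 : ((2 : V) : L) = 2 := map_ofNat V.subtype 2

@[simp, norm_cast]
lemma vs_coe3 : ((3 : V) : L) = 3 := map_ofNat V.subtype 3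

@[simp, norm_cast]
lemma vs_coe4 : ((4 : V) : L) = 4 := map_ofNat V.subtype 4

@[simp, norm_cast]
lemma vs_coe5 : ((5 : V) : L) = 5 := map_ofNat V.subtype 5

@[simp, norm_cast]
lemma vs_coe8 : ((8 : V) : L) = 8 := map_ofNat V.subtype 8

@[simp, norm_cast]
lemma vs_coe12 : ((12 : V) : L) = 12 := map_ofNat V.subtype 12

@[simp, norm_cast]
lemma vs_coe16 : ((16 : V) : L) = 16 := map_ofNat V.subtype 16

@[simp, norm_cast]
lemma vs_coe20 : ((20 : V) : L) = 20 := map_ofNat V.subtype 20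

lemma vs_sq_mem {x : L} (h : x^2 ∈ V) : x ∈ V := by
  rcases V.mem_or_inv_mem x with h1 | h1
  · exact h1
  · by_cases hx : x = 0
    · rw [hx]; exact V.zero_mem
    · have : x = x^2 * x⁻¹ := by field_simp
      rw [this]; exact V.mul_mem _ _ h h1

lemma vs_unit_ne {e : V} (h : IsUnit e) : (e:L) ≠ 0 := by
  intro h0
  have : e = 0 := Subtype.ext h0
  rw [this] at h; exact not_isUnit_zero h

lemma vs_isUnit_iff {e : V} : IsUnit e ↔ IsLocalRing.residue V e ≠ 0 :=
  (IsLocalRing.residue_ne_zero_iff_isUnit e).symm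

/-- from `q² = z * e` with `e` a unit conclude. -/
lemma SqU.mk' {z q : L} {e : V} (he : IsUnit e) (hz : z ≠ 0) (h : q^2 = z * e) : SqU V z := by
  have he0 := vs_unit_ne he
  refine ⟨q, ?_, (he.unit⁻¹ : Vˣ), Units.isUnit _, ?_⟩
  · rintro rfl
    have : z * (e:L) = 0 := by rw [← h]; ring
    exact (mul_ne_zero hz he0) this
  · have h1 : (e * ((he.unit⁻¹ : Vˣ) : V) : V) = 1 := he.mul_val_inv
    have h2 : (e:L) * (((he.unit⁻¹ : Vˣ) : V) : L) = 1 := by exact_mod_cast h1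
    rw [h, mul_assoc, h2, mul_one]

lemma SqU.mul_unit {z : L} {e : V} (h : SqU V z) (he : IsUnit e) : SqU V (z * e) := by
  obtain ⟨q, hq, e', he', rfl⟩ := h
  exact ⟨q, hq, e' * e, he'.mul he, by push_cast; ring⟩

def Gθ (a1 p θ : L) : L := 16*(θ^8+p*θ^6+p^2*θ^4+p^3*θ^2+p^4 - a1*(θ^7 + p*θ^5+p^2*θ^3+p^3*θ)
  + (a1^2-2*p)*(θ^6+p*θ^4+p^2*θ^2) - (a1^3-3*a1*p)*(θ^5+p*θ^3)+(a1^4-4*a1^2*p+2*p^2)*θ^4)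

lemma Gθ_eq (a1 a0 θ : L) (hθ : 4*θ^5 = -1) : 1 - 4*(a1^5-5*a1^3*a0+5*a1*a0^2) + 16*a0^5
    = (θ^2+a1*θ+a0) * Gθ a1 a0 θ := by
  unfold Gθ
  linear_combination (1 - 4*θ^5 - 4*(a1^5-5*a1^3*a0+5*a1*a0^2)) * hθ

variable {a1 a0 B1 B0 w : L}

lemma E_w (E1 : 2*B0*B1 - a1*B1^2 = 4*(a1^4-3*a1^2*a0+a0^2))
    (E0 : B0^2 - a0*B1^2 = 4*(a1^3*a0-2*a1*a0^2)+1)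
    (hw : w = B0^2 - a1*B0*B1 + a0*B1^2) :
    w^2 = 1 - 4*(a1^5-5*a1^3*a0+5*a1*a0^2) + 16*a0^5 := by
  have : w^2 = (B0^2 - a0*B1^2)^2 - a1*(B0^2 - a0*B1^2)*(2*B0*B1 - a1*B1^2)
      + a0*(2*B0*B1 - a1*B1^2)^2 := by rw [hw]; ring
  rw [this, E1, E0]; ring

lemma caseI (θ i2 i5 : V) (hθ : 4*θ^5 = -1) (h2 : 2*i2 = 1) (h5 : 5*i5 = 1) (a1 a0 : V)
    (E1 : 2*B0*B1 - a1*B1^2 = 4*((a1:L)^4-3*a1^2*a0+a0^2))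
    (E0 : B0^2 - a0*B1^2 = 4*((a1:L)^3*a0-2*a1*a0^2)+1)
    (hw : w = B0^2 - a1*B0*B1 + a0*B1^2) (hw0 : w ≠ 0) :
    SqU V ((θ:L)^2+a1*θ+a0) := by
  have hθL : 4*(θ:L)^5 = -1 := by exact_mod_cast congrArg (fun x : V => (x:L)) hθ
  have hw2 := E_w E1 E0 hw
  rw [Gθ_eq _ _ _ hθL] at hw2
  have hA0 : (θ:L)^2+a1*θ+a0 ≠ 0 := by
    intro h; rw [h, zero_mul] at hw2; exact hw0 (pow_eq_zero_iff (by norm_num) |>.mp hw2)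
  let A : V := θ^2+a1*θ+a0
  have hA : (A:L) = (θ:L)^2+a1*θ+a0 := by simp [A]
  by_cases hAu : IsUnit A
  · exact ⟨1, one_ne_zero, A, hAu, by rw [hA]; ring⟩
  let G : V := 16*(θ^8+a0*θ^6+a0^2*θ^4+a0^3*θ^2+a0^4 - a1*(θ^7 + a0*θ^5+a0^2*θ^3+a0^3*θ)
  + (a1^2-2*a0)*(θ^6+a0*θ^4+a0^2*θ^2) - (a1^3-3*a1*a0)*(θ^5+a0*θ^3)+(a1^4-4*a1^2*a0+2*a0^2)*θ^4)
  have hG : (G:L) = Gθ (a1:L) a0 θ := by simp [G, Gθ]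
  by_cases hGu : IsUnit G
  · exact SqU.mk' hGu hA0 (by rw [hw2, hG])
  rw [vs_isUnit_iff, not_not] at hAu hGu
  let π := IsLocalRing.residue V
  have hθk : 4*(π θ)^5 = -1 := by
    have := congrArg π hθ; simpa only [map_mul, map_pow, map_neg, map_one, map_ofNat] using this
  have h2k : 2*(π i2) = 1 := by
    have := congrArg π h2; simpa only [map_mul, map_pow, map_neg, map_one, map_ofNat] using this
  have h5k : 5*(π i5) = 1 := by
    have := congrArg π h5; simpa only [map_mul, map_pow, map_neg, map_one, map_ofNat] using this
  have hAk : (π θ)^2 + π a1 * π θ + π a0 = 0 := by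
    simpa only [A, map_mul, map_pow, map_add] using hAu
  have two_ne : (2 : IsLocalRing.ResidueField V) ≠ 0 := by
    intro h; rw [h, zero_mul] at h2k; exact zero_ne_one h2k
  have five_ne : (5 : IsLocalRing.ResidueField V) ≠ 0 := by
    intro h; rw [h, zero_mul] at h5k; exact zero_ne_one h5k
  have θ_ne : π θ ≠ 0 := by
    intro h; rw [h] at hθk
    have : (1 : IsLocalRing.ResidueField V) = 0 := by linear_combination hθk
    exact one_ne_zero this
  let D : V := a1^2 - 4*a0
  have hD : IsUnit D := by
    rw [vs_isUnit_iff]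
    intro hD
    have hDk : (π a1)^2 - 4 * π a0 = 0 := by
      simpa only [D, map_mul, map_pow, map_sub, map_ofNat] using hD
    have hs : (2 * π θ + π a1)^2 = 0 := by linear_combination 4*hAk + hDk
    have hs1 : π a1 = - (2 * π θ) := by
      have := pow_eq_zero_iff (by norm_num) |>.mp hs
      linear_combination this
    have hs0 : π a0 = (π θ)^2 := by rw [hs1] at hAk; linear_combination hAk
    have hGk : π G = 400 * (π θ)^8 := by
      simp only [G, map_mul, map_pow, map_add, map_sub, map_ofNat]
      rw [hs1, hs0]; ring
    have : 2^4*(5^2 * (π θ)^8) = 0 := by rw [← hGu]; change _ = π G; rw [hGk]; ring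
    exact (mul_ne_zero (pow_ne_zero _ two_ne) (mul_ne_zero (pow_ne_zero _ five_ne) (pow_ne_zero _ θ_ne))) this
  have hwV : w ∈ V := vs_sq_mem (by rw [hw2, ← hA, ← hG]; exact V.mul_mem _ _ A.2 G.2)
  have i2L : 2 * (i2:L) = 1 := by exact_mod_cast congrArg (fun x : V => (x:L)) h2
  let F1 : V := 4*(a1^4-3*a1^2*a0+a0^2)
  let F0 : V := 4*(a1^3*a0-2*a1*a0^2)+1
  have hF1 : 2*B0*B1 - a1*B1^2 = (F1:L) := by rw [E1]; simp [F1]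
  have hF0 : B0^2 - a0*B1^2 = (F0:L) := by rw [E0]; simp [F0]
  have hB1 : B1 ∈ V := by
    apply vs_sq_mem
    have hDi : (D:L) * ((hD.unit⁻¹ : Vˣ) : V) = 1 := by exact_mod_cast hD.mul_val_inv
    have : B1^2 = ((-a1*F1+2*F0 - 2*⟨w, hwV⟩) * ((hD.unit⁻¹ : Vˣ) : V) : V) := by
      push_cast
      rw [← hF1, ← hF0, hw]
      have hDL : (D:L) = a1^2 - 4*a0 := by simp [D]
      rw [hDL] at hDi
      linear_combination -B1^2 * hDi
    rw [this]; exact Subtype.mem _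
  have hB0 : B0 ∈ V := by
    have h1 : (2*B0 - a1*B1) ∈ V := by
      apply vs_sq_mem
      have : (2*B0 - a1*B1)^2 = (-a1*F1+2*F0 + 2*⟨w, hwV⟩ : V) := by
        push_cast; rw [← hF1, ← hF0, hw]; ring
      rw [this]; exact Subtype.mem _
    have : B0 = (i2 * (⟨2*B0 - a1*B1, h1⟩ + a1 * ⟨B1, hB1⟩) : V) := by
      push_cast
      linear_combination -B0*i2L
    rw [this]; exact Subtype.mem _
  let b1 : V := ⟨B1, hB1⟩
  let b0 : V := ⟨B0, hB0⟩
  have e1 : 2*b0*b1 - a1*b1^2 = F1 := Subtype.ext (by push_cast; exact hF1)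
  have e0 : b0^2 - a0*b1^2 = F0 := Subtype.ext (by push_cast; exact hF0)
  let k1 : V := 4*a0-4*a1^2
  let k0 : V := b1^2-a1*k1-4*a0*a1
  let Ct : V := -4*θ^3+4*a1*θ^2+k1*θ+k0
  have id1 : (b1*θ+b0)^2 = A * Ct := by
    simp only [A, Ct, k0, k1, F1, F0] at e1 e0 ⊢
    linear_combination θ*e1 + e0 + hθ
  have id2 : 2*(b1*θ+b0)*b1 - 20*θ^4 = (2*θ+a1)*Ct + A * (-12*θ^2+8*a1*θ+k1) := by
    simp only [A, Ct, k0, k1, F1, F0] at e1 e0 ⊢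
    linear_combination e1
  have hCu : IsUnit Ct := by
    rw [vs_isUnit_iff]
    intro hC
    have h1 := congrArg π id1
    have h2 := congrArg π id2
    rw [map_mul, show π A = 0 from hAu, zero_mul, map_pow] at h1
    have h3 := pow_eq_zero_iff (by norm_num) |>.mp h1
    simp only [map_sub, map_add _ ((2*θ+a1)*Ct), map_mul _ _ Ct, map_mul _ A, map_mul _ _ b1, h3, show π A = 0 from hAu, show π Ct = 0 from hC, map_mul _ 2 (b1*θ+b0)] at h2
    simp only [mul_zero, zero_mul, add_zero, zero_sub, map_mul, map_pow, map_ofNat] at h2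
    have : 2^2*(5 * (π θ)^4) = 0 := by linear_combination -h2
    exact (mul_ne_zero (pow_ne_zero _ two_ne) (mul_ne_zero five_ne (pow_ne_zero _ θ_ne))) this
  refine SqU.mk' (q := B1*θ+B0) hCu hA0 ?_
  rw [← hA]
  have := congrArg (fun x : V => (x:L)) id1
  simpa [b1, b0] using this

lemma caseIIa (θ i2 : V) (hθ : 4*θ^5 = -1) (h2 : 2*i2 = 1) (x y : V) (hx0 : (x:L) ≠ 0)
    (hx : IsLocalRing.residue V x = 0) (hy : IsLocalRing.residue V y = 0)
    (ha1 : a1 = y / x) (ha0 : a0 = 1 / x)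
    (E1 : 2*B0*B1 - a1*B1^2 = 4*((a1:L)^4-3*a1^2*a0+a0^2))
    (E0 : B0^2 - a0*B1^2 = 4*((a1:L)^3*a0-2*a1*a0^2)+1)
    (hw : w = B0^2 - a1*B0*B1 + a0*B1^2) (hw0 : w ≠ 0) :
    SqU V ((θ:L)^2+a1*θ+a0) := by
  have hw2 := E_w E1 E0 hw
  let e1 : V := 1 + y*θ+x*θ^2
  let e2 : V := x^5 - 4*(y^5-5*y^3*x+5*y*x^2)+16
  have h2k : 2*(IsLocalRing.residue V i2) = 1 := by
    have := congrArg (IsLocalRing.residue V) h2; simpa only [map_mul, map_pow, map_neg, map_one, map_ofNat] using this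
  have u1 : IsUnit e1 := by
    rw [vs_isUnit_iff]; simp [e1, hx, hy]
  have u2 : IsUnit e2 := by
    rw [vs_isUnit_iff]; simp only [e2, map_sub, map_add, map_mul, map_pow, hx, hy, map_ofNat]
    intro h
    have h16 : (16 : IsLocalRing.ResidueField V) = 0 := by linear_combination h
    have : (1 : IsLocalRing.ResidueField V) = 0 := by
      calc (1 : IsLocalRing.ResidueField V) = (2*(IsLocalRing.residue V i2))^4 := by rw [h2k]; ring
        _ = 16 * (IsLocalRing.residue V i2)^4 := by ring
        _ = 0 := by rw [h16, zero_mul]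
    exact one_ne_zero this
  have hA : (θ:L)^2+a1*θ+a0 = (1/(x:L)) * e1 := by
    rw [ha1, ha0]; simp only [e1]; push_cast; field_simp; ring
  rw [hA]
  refine SqU.mul_unit ?_ u1
  refine SqU.mk' (q := w * x^2) u2 (by simpa using hx0) ?_
  rw [mul_pow, hw2, ha1, ha0]; simp only [e2]; push_cast; field_simp

lemma caseIIb (θ i2 i5 : V) (hθ : 4*θ^5 = -1) (h2 : 2*i2 = 1) (h5 : 5*i5 = 1) (x r : V) (hx0 : (x:L) ≠ 0)
    (hx : IsLocalRing.residue V x = 0)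
    (ha1 : a1 = 1 / x) (ha0 : a0 = - r / x)
    (E1 : 2*B0*B1 - a1*B1^2 = 4*((a1:L)^4-3*a1^2*a0+a0^2))
    (E0 : B0^2 - a0*B1^2 = 4*((a1:L)^3*a0-2*a1*a0^2)+1)
    (hw : w = B0^2 - a1*B0*B1 + a0*B1^2) (hw0 : w ≠ 0) :
    SqU V ((θ:L)^2+a1*θ+a0) := by
  have hθL : 4*(θ:L)^5 = -1 := by exact_mod_cast congrArg (fun x : V => (x:L)) hθ
  have hw2 := E_w E1 E0 hw
  rw [Gθ_eq _ _ _ hθL] at hw2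
  have hA0 : (θ:L)^2+a1*θ+a0 ≠ 0 := by
    intro h; rw [h, zero_mul] at hw2; exact hw0 (pow_eq_zero_iff (by norm_num) |>.mp hw2)
  let π := IsLocalRing.residue V
  have hx' : π x = 0 := hx
  have hθk : 4*(π θ)^5 = -1 := by
    have := congrArg π hθ; simpa only [map_mul, map_pow, map_neg, map_one, map_ofNat] using this
  have h2k : 2*(π i2) = 1 := by
    have := congrArg π h2; simpa only [map_mul, map_pow, map_neg, map_one, map_ofNat] using this
  have h5k : 5*(π i5) = 1 := by
    have := congrArg π h5; simpa only [map_mul, map_pow, map_neg, map_one, map_ofNat] using this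
  have two_ne : (2 : IsLocalRing.ResidueField V) ≠ 0 := by
    intro h; rw [h, zero_mul] at h2k; exact zero_ne_one h2k
  have five_ne : (5 : IsLocalRing.ResidueField V) ≠ 0 := by
    intro h; rw [h, zero_mul] at h5k; exact zero_ne_one h5k
  have θ_ne : π θ ≠ 0 := by
    intro h; rw [h] at hθk
    have : (1 : IsLocalRing.ResidueField V) = 0 := by linear_combination hθk
    exact one_ne_zero this
  let Γ : V := 16*(x^4*θ^8 - r*x^3*θ^6 + r^2*x^2*θ^4 - r^3*x*θ^2+r^4 - (x^3*θ^7 - r*x^2*θ^5 + r^2* x*θ^3 - r^3*θ)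
    + (1+2*r*x)*(x^2*θ^6 - r*x*θ^4 + r^2*θ^2) - (1+3*r*x)*(x*θ^5 - r*θ^3) + (1+4*r*x+2*r^2*x^2)*θ^4)
  have hΓ : Gθ a1 a0 θ * (x:L)^4 = Γ := by
    rw [ha1, ha0]; simp only [Gθ, Γ]; push_cast; field_simp; ring
  by_cases hu : IsUnit Γ
  · refine SqU.mk' (q := w*x^2) hu hA0 ?_
    rw [mul_pow, hw2, ← hΓ]; ring
  rw [vs_isUnit_iff, not_not] at hu
  have hg : 2^4 * ((π r)^4 + (π r)^3*π θ+(π r)^2*(π θ)^2+π r*(π θ)^3+(π θ)^4) = 0 := by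
    have : π Γ = 0 := hu
    simp only [Γ, map_sub, map_add, map_mul, map_pow, hx', map_ofNat, map_one] at this
    linear_combination this
  have hg' := (mul_eq_zero.mp hg).resolve_left (pow_ne_zero _ two_ne)
  let e1 : V := θ - r + x*θ^2
  have u1 : IsUnit e1 := by
    rw [vs_isUnit_iff]
    intro h
    have h' : π e1 = 0 := h
    simp only [e1, map_sub, map_add, map_mul, map_pow, hx'] at h'
    have hr : π r = π θ := by linear_combination -h'
    rw [hr] at hg'
    exact (mul_ne_zero five_ne (pow_ne_zero 4 θ_ne)) (by linear_combination hg')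
  have hA : (θ:L)^2+a1*θ+a0 = (1/(x:L)) * e1 := by
    rw [ha1, ha0]; simp only [e1]; push_cast; field_simp; ring
  have hwx2 : (w*x^5)^2 = ((e1*Γ*x^5 : V) : L) := by
    rw [mul_pow, hw2, hA]; push_cast; rw [← hΓ]; field_simp
  have hwx : w*x^5 ∈ V := vs_sq_mem (by rw [hwx2]; exact Subtype.mem _)
  let ω : V := ⟨w*x^5, hwx⟩
  have hω : π ω = 0 := by
    have : ω^2 = e1*Γ*x^5 := Subtype.ext hwx2
    have := congrArg π this
    rw [map_pow, map_mul, map_pow, hx'] at this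
    exact pow_eq_zero_iff (by norm_num : (2:ℕ) ≠ 0) |>.mp (by rw [this]; ring)
  rw [hA]
  refine SqU.mul_unit ?_ u1
  let F : V := -4*(1+3*r*x+r^2*x^2) + 2*(4*(-r*x-2*r^2*x^2)+x^5) - 2*ω
  let d : V := 1+4*r*x
  have ud : IsUnit d := by rw [vs_isUnit_iff]; simp [d, hx]
  have uF : IsUnit F := by
    rw [vs_isUnit_iff]
    intro h
    have h' : π F = 0 := h
    simp only [F, map_sub, map_add, map_mul, map_pow, hx', map_neg, map_ofNat, map_one, hω] at h'
    exact pow_ne_zero 2 two_ne (by linear_combination -h')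
  have hF : (B1*x)^2 * (d:L) = (1/(x:L)) * F := by
    have hBD : B1^2*(a1^2-4*a0) = -a1*(4*((a1:L)^4-3*a1^2*a0+a0^2)) + 2*(4*((a1:L)^3*a0-2*a1*a0^2)+1) - 2*w := by
      rw [← E1, ← E0, hw]; ring
    have hBD2 : B1^2*(a1^2-4*a0)*x^2*x^2 = (-a1*(4*((a1:L)^4-3*a1^2*a0+a0^2)) + 2*(4*((a1:L)^3*a0-2*a1*a0^2)+1) - 2*w)*x^4 := by
      rw [hBD]; ring
    have hl : B1^2*(a1^2-4*a0)*x^2*x^2 = (B1*x)^2 * (d:L) := by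
      rw [ha1, ha0]; simp only [d]; push_cast; field_simp; ring
    rw [← hl, hBD2, ha1, ha0]; simp only [F, ω]; push_cast; field_simp; ring
  refine SqU.mk' (q := B1*x) (e := (ud.unit⁻¹ : Vˣ) * F) ((Units.isUnit _).mul uF) (by simpa using hx0) ?_
  have hdi : (d:L) * ((ud.unit⁻¹ : Vˣ) : V) = 1 := by exact_mod_cast ud.mul_val_inv
  push_cast
  linear_combination (((ud.unit⁻¹ : Vˣ) : V) : L) * hF - (B1*x)^2*hdi

lemma vs_inv_res {a : L} (h : a ∉ V) : ∃ x : V, (x:L) = a⁻¹ ∧ IsLocalRing.residue V x = 0 := by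
  have h1 := (V.mem_or_inv_mem a).resolve_left h
  refine ⟨⟨a⁻¹, h1⟩, rfl, ?_⟩
  by_contra hne
  rw [← Ne, ← vs_isUnit_iff] at hne
  obtain ⟨b, hb⟩ := hne.exists_right_inv
  have h2 : (a⁻¹) * (b : L) = 1 := congrArg (fun x : V => (x:L)) hb
  apply h
  have h3 : a ≠ 0 := by rintro rfl; simp at h2
  have : a = (b : L) := by field_simp at h2; exact h2.symm
  rw [this]; exact Subtype.mem _

/-- The local claim away from `10`. -/
lemma local_claim (θ i2 i5 : V) (hθ : 4*θ^5 = -1) (h2 : 2*i2 = 1) (h5 : 5*i5 = 1)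
    (E1 : 2*B0*B1 - a1*B1^2 = 4*((a1:L)^4-3*a1^2*a0+a0^2))
    (E0 : B0^2 - a0*B1^2 = 4*((a1:L)^3*a0-2*a1*a0^2)+1)
    (hw : w = B0^2 - a1*B0*B1 + a0*B1^2) (hw0 : w ≠ 0) :
    SqU V ((θ:L)^2+a1*θ+a0) := by
  by_cases h1 : a1 ∈ V
  · by_cases h0 : a0 ∈ V
    · exact caseI θ i2 i5 hθ h2 h5 ⟨a1, h1⟩ ⟨a0, h0⟩ E1 E0 hw hw0
    · obtain ⟨x, hx, hxr⟩ := vs_inv_res h0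
      have hne : a0 ≠ 0 := by rintro rfl; exact h0 V.zero_mem
      refine caseIIa θ i2 hθ h2 x (⟨a1, h1⟩ * x) (by rw [hx]; simpa using hne) hxr (by rw [map_mul, hxr, mul_zero])
        ?_ ?_ E1 E0 hw hw0
      · push_cast; rw [hx]; field_simp
      · rw [hx]; simp
  · have hne : a1 ≠ 0 := by rintro rfl; exact h1 V.zero_mem
    by_cases h0 : a0 / a1 ∈ V
    · obtain ⟨x, hx, hxr⟩ := vs_inv_res h1
      refine caseIIb θ i2 i5 hθ h2 h5 x (-⟨a0/a1, h0⟩) (by rw [hx]; simpa using hne) hxr ?_ ?_ E1 E0 hw hw0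
      · rw [hx]; simp
      · push_cast; rw [hx]; field_simp
    · obtain ⟨y, hy, hyr⟩ := vs_inv_res h0
      have hne0 : a0 ≠ 0 := by rintro rfl; apply h0; simp [V.zero_mem]
      obtain ⟨x, hx, hxr⟩ := vs_inv_res h1
      refine caseIIa θ i2 hθ h2 (x*y) y ?_ (by rw [map_mul, hxr, zero_mul]) hyr ?_ ?_ E1 E0 hw hw0
      · push_cast; rw [hx, hy]; simp [hne, hne0]
      · push_cast; rw [hx, hy]; field_simp
      · push_cast; rw [hx, hy]; field_simp

end LocalClaim

end Part9

section Part10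
open NumberField

section Combine

lemma datum_E {a1 a0 m1 m0 : Z2} (hd : Datum a1 a0 m1 m0) : ∃ B1 B0 : Z2,
    (2:Z2) ∣ B0 - 1 ∧
    2*B0*B1 - a1*B1^2 = 4*(a1^4-3*a1^2*a0+a0^2) ∧
    B0^2 - a0*B1^2 = 4*(a1^3*a0-2*a1*a0^2)+1 := by
  obtain ⟨-, -, -, -, c2, c1, c0, h2, h1, h0, r1, r0⟩ := hd
  subst h2
  obtain rfl : c1 = 2*m1*m0 - 1 - a1*m1^2 := by linear_combination -h1
  obtain rfl : c0 = m0^2 - a1*(2*m1*m0 - 1 - a1*m1^2) - a0 * m1^2 := by linear_combination -h0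
  refine ⟨2*(m1*(a1^2-a0)-m0*a1), 1+2*(m1*a1*a0-m0*a0), ⟨m1*a1*a0-m0*a0, by ring⟩, ?_, ?_⟩
  · linear_combination 4*(a1^2-a0)*r1 - 4*a1*r0
  · linear_combination 4*a1*a0*r1 - 4*a0*r0

variable {L : Type*} [Field L] [NumberField L] {ϖ : 𝓞 L}

open IsDedekindDomain

lemma pi5_prime (h : ϖ^5 = 2) (hf : Module.finrank ℚ L = 5) : Prime (1+ϖ^2) := by
  have hN := norm_pi5 h hf
  rw [← Ideal.span_singleton_prime]
  · apply Ideal.isPrime_of_irreducible_absNorm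
    rw [Ideal.absNorm_span_singleton, hN]
    exact Nat.prime_five
  · intro h0; rw [h0] at hN; simp at hN

lemma pi5_pow (h : ϖ^5 = 2) : (1+ϖ^2)^5 = 5*(1+ϖ^2+2*ϖ^4+2*ϖ^6+ϖ^8) := by
  linear_combination (ϖ^5 + 2) * h

/-- The height one prime attached to a prime element. -/
noncomputable def hos (p : 𝓞 L) (hp : Prime p) : HeightOneSpectrum (𝓞 L) where
  asIdeal := Ideal.span {p}
  isPrime := (Ideal.span_singleton_prime hp.ne_zero).2 hp
  ne_bot := by simpa using hp.ne_zero

lemma hos_lt_one {p : 𝓞 L} (hp : Prime p) (x : 𝓞 L) :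
    (hos p hp).valuation L (x:L) < 1 ↔ p ∣ x := by
  rw [HeightOneSpectrum.valuation_lt_one_iff_mem]
  exact Ideal.mem_span_singleton

lemma hos_eq_one {p : 𝓞 L} (hp : Prime p) (x : 𝓞 L) :
    (hos p hp).valuation L (x:L) = 1 ↔ ¬ p ∣ x := by
  rw [← hos_lt_one hp, not_lt]
  exact ⟨fun h => h.ge, fun h => le_antisymm ((hos p hp).valuation_le_one x) h⟩

lemma hos_self {p : 𝓞 L} (hp : Prime p) :
    (hos p hp).valuation L (p:L) = WithZero.exp (-1 : ℤ) := by
  rw [HeightOneSpectrum.valuation_of_algebraMap]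
  exact HeightOneSpectrum.intValuation_singleton _ hp.ne_zero rfl

lemma decomp (h : ϖ^5 = 2) (hf : Module.finrank ℚ L = 5) (n : 𝓞 L) (hn : n ≠ 0)
    (H : ∀ p (hp : Prime p), ¬ p ∣ (10 : 𝓞 L) →
      ∃ q : L, (hos p hp).valuation L (n:L) = ((hos p hp).valuation L q)^2) :
    ∃ (x : (𝓞 L)ˣ) (i j : ℕ) (s : 𝓞 L), n = x * ϖ^i * (1+ϖ^2)^j * s^2 := by
  have := pid_fifth h hf
  have d2 : ∀ p : 𝓞 L, p ∣ ϖ → p ∣ 10 := fun p hp =>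
    hp.trans ⟨ϖ^4*5, by linear_combination -5*h⟩
  have d5 : ∀ p : 𝓞 L, p ∣ (1+ϖ^2) → p ∣ 10 := fun p hp =>
    hp.trans ⟨2*(1-ϖ^2+ϖ^4-ϖ^6+ϖ^8), by linear_combination -2*(ϖ^5+2)*h⟩
  have d10 : ∀ p : 𝓞 L, Prime p → p ∣ 10 → p ∣ ϖ ∨ p ∣ 1+ϖ^2 := fun p hp hd => by
    have : (10 : 𝓞 L) = 2 * 5 := by norm_num
    rw [this] at hd
    rcases hp.dvd_or_dvd hd with hd | hd
    · left; rw [← h] at hd; exact hp.dvd_of_dvd_pow hd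
    · right
      exact hp.dvd_of_dvd_pow (n := 5) (by rw [pi5_pow h]; exact hd.mul_right _)
  have hstep : ∀ (p : 𝓞 L) (hp : Prime p) (c m : 𝓞 L), ¬ p ∣ c →
      (∃ q : L, (hos p hp).valuation L ((c*m : 𝓞 L):L) = ((hos p hp).valuation L q)^2) →
      (∃ q : L, (hos p hp).valuation L (m:L) = ((hos p hp).valuation L q)^2) := by
    rintro p hp c m hc ⟨q, hq⟩
    refine ⟨q, ?_⟩
    push_cast at hq
    rw [map_mul, (hos_eq_one hp c).2 hc, one_mul] at hq
    exact hq
  induction n using WellFounded.induction (wellFounded_dvdNotUnit (α := 𝓞 L)) with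
  | _ n ih =>
  by_cases hu : IsUnit n
  · obtain ⟨x, rfl⟩ := hu
    exact ⟨x, 0, 0, 1, by ring⟩
  obtain ⟨p, hp, hpn⟩ := WfDvdMonoid.exists_irreducible_factor hu hn
  have hpp := hp.prime
  by_cases h10 : p ∣ 10
  · rcases d10 p hpp h10 with hd | hd
    · have hpn' : ϖ ∣ n := ((hpp.associated_of_dvd (varpi_prime h hf) hd).symm.dvd).trans hpn
      obtain ⟨m, rfl⟩ := hpn'
      have hm : m ≠ 0 := right_ne_zero_of_mul hn
      obtain ⟨x, i, j, s, e⟩ := ih m ⟨hm, ϖ, (varpi_prime h hf).not_unit, by ring⟩ hm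
        (fun q hq hq10 => hstep q hq ϖ m (fun hd => hq10 (d2 _ hd)) (H q hq hq10))
      exact ⟨x, i+1, j, s, by conv_lhs => rw [e]
                              ring⟩
    · have hpn' : 1+ϖ^2 ∣ n := ((hpp.associated_of_dvd (pi5_prime h hf) hd).symm.dvd).trans hpn
      obtain ⟨m, rfl⟩ := hpn'
      have hm : m ≠ 0 := right_ne_zero_of_mul hn
      obtain ⟨x, i, j, s, e⟩ := ih m ⟨hm, 1+ϖ^2, (pi5_prime h hf).not_unit, by ring⟩ hm
        (fun q hq hq10 => hstep q hq (1+ϖ^2) m (fun hd => hq10 (d5 _ hd)) (H q hq hq10))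
      exact ⟨x, i, j+1, s, by conv_lhs => rw [e]
                              ring⟩
  · obtain ⟨m, rfl⟩ := hpn
    have hm : m ≠ 0 := right_ne_zero_of_mul hn
    have hpm : p ∣ m := by
      by_contra hpm
      obtain ⟨q, hq⟩ := H p hpp h10
      push_cast at hq
      rw [map_mul, (hos_eq_one hpp m).2 hpm, mul_one, hos_self hpp] at hq
      have hq0 : (hos p hpp).valuation L q ≠ 0 := by
        intro h0; rw [h0] at hq; simp at hq
      rw [← WithZero.exp_log hq0, ← WithZero.exp_nsmul, WithZero.exp_inj] at hq
      rw [nsmul_eq_mul] at hq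
      push_cast at hq
      omega
    obtain ⟨m, rfl⟩ := hpm
    have hm' : m ≠ 0 := right_ne_zero_of_mul hm
    obtain ⟨x, i, j, s, e⟩ := ih m ⟨hm', p*p, fun hu => hpp.not_unit (isUnit_of_mul_isUnit_left hu), by ring⟩ hm'
      (fun q hq hq10 => by
        obtain ⟨z, hz⟩ := H q hq hq10
        refine ⟨z / p, ?_⟩
        have hp0 : (p : L) ≠ 0 := by simpa using hpp.ne_zero
        have : (m : L) = ((p*(p*m) : 𝓞 L) : L) / (p:L)^2 := by
          push_cast; field_simp
        rw [this, map_div₀, hz, map_div₀, map_pow, div_pow])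
    exact ⟨x, i, j, p*s, by conv_lhs => rw [e]
                            ring⟩
end Combine

end Part10

section Part11
open NumberField

section Combine
variable {L : Type*} [Field L] [NumberField L] {ϖ : 𝓞 L}
open IsDedekindDomain

lemma sq_parity (i j : ℕ) (r : ℚ) (h : (2:ℚ)^i*5^j = r^2) : Even i ∧ Even j := by
  have hr : r ≠ 0 := by rintro rfl; have : (2:ℚ)^i*5^j ≠ 0 := by positivity
                        exact this (by rw [h]; norm_num)
  constructor
  · have hv := congrArg (padicValRat 2) h
    have : Fact (Nat.Prime 2) := ⟨Nat.prime_two⟩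
    rw [padicValRat.mul (by positivity) (by positivity), padicValRat.pow, padicValRat.pow, padicValRat.pow] at hv
    have h2 : padicValRat 2 (2:ℚ) = 1 := by exact_mod_cast padicValRat.self (p := 2) (by norm_num)
    have h5 : padicValRat 2 (5:ℚ) = 0 := by
      have : padicValNat 2 5 = 0 := padicValNat.eq_zero_of_not_dvd (by norm_num)
      have h := padicValRat.of_nat (p := 2) (n := 5)
      rw [this] at h; exact_mod_cast h
    rw [h2, h5] at hv
    rw [Nat.even_iff]; push_cast at hv; omega
  · have hv := congrArg (padicValRat 5) h
    have : Fact (Nat.Prime 5) := ⟨Nat.prime_five⟩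
    rw [padicValRat.mul (by positivity) (by positivity), padicValRat.pow, padicValRat.pow, padicValRat.pow] at hv
    have h2 : padicValRat 5 (5:ℚ) = 1 := by exact_mod_cast padicValRat.self (p := 5) (by norm_num)
    have h5 : padicValRat 5 (2:ℚ) = 0 := by
      have : padicValNat 5 2 = 0 := padicValNat.eq_zero_of_not_dvd (by norm_num)
      have h := padicValRat.of_nat (p := 5) (n := 2)
      rw [this] at h; exact_mod_cast h
    rw [h2, h5] at hv
    rw [Nat.even_iff]; push_cast at hv; omega

theorem selmer_sq (h : ϖ^5 = 2) (hf : Module.finrank ℚ L = 5) (a1 a0 m1 m0 : Z2)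
    (hd : Datum a1 a0 m1 m0) : ∃ s : L, s^2 = (-(1/(ϖ:L)^2))^2 +
      algebraMap ℚ L a1 * (-(1/(ϖ:L)^2)) + algebraMap ℚ L a0 := by
  obtain ⟨B1, B0, hB0, E1, E0⟩ := datum_E hd
  obtain ⟨⟨x1, hx1⟩, ⟨x0, hx0⟩, -⟩ := hd
  have hϖ : (ϖ:L)^5 = 2 := coe_fifth h
  have hϖ0 : (ϖ:L) ≠ 0 := by intro h0; rw [h0] at hϖ; norm_num at hϖ
  -- the quantity w
  obtain ⟨w, hw⟩ : ∃ w : Z2, w = B0^2 - a1*B0*B1 + a0*B1^2 := ⟨_, rfl⟩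
  have hw0 : w ≠ 0 := by
    rintro rfl
    obtain ⟨b, hb⟩ := hB0
    obtain rfl : B0 = 1 + 2*b := by linear_combination hb
    subst hx1; subst hx0
    exact Z2_not_dvd_one ⟨-2*b-2*b^2 + x1*(1+2*b)*B1 - x0*B1^2, by linear_combination -hw⟩
  have cast : ∀ x y : Z2, x = y → (x:ℚ) = y := fun x y h => congrArg _ h
  have E1q := cast _ _ E1
  have E0q := cast _ _ E0
  have hwq := cast _ _ hw
  push_cast at E1q E0q hwq
  have hwq0 : (w:ℚ) ≠ 0 := by exact_mod_cast hw0
  have hw2q := E_w E1q E0q hwq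
  have castL : ∀ x y : ℚ, x = y → algebraMap ℚ L x = algebraMap ℚ L y := fun x y h => congrArg _ h
  have E1L := castL _ _ E1q
  have E0L := castL _ _ E0q
  have hwL := castL _ _ hwq
  simp only [map_sub, map_mul, map_pow, map_add, map_ofNat, map_one] at E1L E0L hwL
  have hwL0 : algebraMap ℚ L w ≠ 0 := by simpa using hwq0
  -- denominators
  obtain ⟨n1, d1, hd1, e1⟩ := Z2_exists_num x1
  obtain ⟨n0, d0, hd0, e0⟩ := Z2_exists_num x0
  have e1L : (d1:L) * algebraMap ℚ L a1 = 2 * n1 := by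
    have : ((d1:ℚ)) * (a1:ℚ) = 2 * n1 := by
      have := cast _ _ (show (d1:Z2)*a1 = 2*n1 by rw [hx1]; linear_combination 2*e1)
      exact_mod_cast this
    have := castL _ _ this
    simpa using this
  have e0L : (d0:L) * algebraMap ℚ L a0 = 2 * n0 := by
    have : ((d0:ℚ)) * (a0:ℚ) = 2 * n0 := by
      have := cast _ _ (show (d0:Z2)*a0 = 2*n0 by rw [hx0]; linear_combination 2*e0)
      exact_mod_cast this
    have := castL _ _ this
    simpa using this
  obtain ⟨β, hβ⟩ : ∃ β : L, β = 1 - algebraMap ℚ L a1 * (ϖ:L)^2 + algebraMap ℚ L a0 * (ϖ:L)^4 := ⟨_, rfl⟩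
  have hNβ : Algebra.norm ℚ β = (w:ℚ)^2 := by
    have := norm_beta h hf (-(a1:ℚ)) (a0:ℚ)
    rw [hw2q, hβ, sub_eq_add_neg, ← neg_mul, ← map_neg, this]; ring
  have haβ : (-(1/(ϖ:L)^2))^2 + algebraMap ℚ L a1 * (-(1/(ϖ:L)^2)) + algebraMap ℚ L a0 = β / (ϖ:L)^4 := by
    rw [hβ]; field_simp; ring
  have hodd : ¬ ϖ ∣ ((d1*d0 : ℤ) : 𝓞 L) := by
    intro hdv
    have h2 : ϖ ∣ (2:𝓞 L) := by rw [← h]; exact dvd_pow_self _ (by norm_num)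
    have hodd : Odd (d1*d0) := by
      rw [Int.odd_mul]; constructor <;> rw [← Int.not_even_iff_odd, even_iff_two_dvd] <;> assumption
    obtain ⟨k, hk⟩ := hodd
    rw [hk] at hdv; push_cast at hdv
    exact (varpi_prime h hf).not_dvd_one ((dvd_add_right (h2.mul_right _)).1 hdv)
  obtain ⟨n, hn⟩ : ∃ n : 𝓞 L, n = d1*d0*(d1*d0 - 2*n1*d0*ϖ^2+2*n0*d1*ϖ^4) := ⟨_, rfl⟩
  have hdd : ((d1*d0:ℤ):L) ≠ 0 := by
    intro h0; apply hodd
    have : ((d1*d0:ℤ):𝓞 L) = 0 := by exact_mod_cast h0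
    rw [this]; exact dvd_zero _
  have hnβ : (n:L) = β * ((d1*d0:ℤ):L)^2 := by
    have ci : ∀ z : ℤ, (((z : ℤ) : 𝓞 L) : L) = z := fun z => map_intCast (algebraMap (𝓞 L) L) z
    have c2 : ((2 : 𝓞 L) : L) = 2 := map_ofNat (algebraMap (𝓞 L) L) 2
    rw [hn, hβ]; push_cast
    simp only [ci, c2]
    linear_combination (d1*d0^2*(ϖ:L)^2) * e1L - (d1^2*d0*(ϖ:L)^4)*e0L
  have hβ0 : β ≠ 0 := by
    intro h0; rw [h0, Algebra.norm_zero] at hNβ; exact pow_ne_zero 2 hwq0 hNβ.symm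
  have hn0 : n ≠ 0 := by
    intro h0; rw [h0] at hnβ
    exact mul_ne_zero hβ0 (pow_ne_zero 2 hdd) (by rw [← hnβ]; simp)
  obtain ⟨x, i, j, s, hx⟩ := decomp h hf n hn0 (fun p hp h10 => by
    have h10' : ∀ x : 𝓞 L, x ∣ 10 → (hos p hp).valuation L (x:L) = 1 := fun x hx =>
      (hos_eq_one hp x).2 (fun hh => h10 (hh.trans hx))
    have v2 := h10' 2 ⟨5, by norm_num⟩
    have v5 := h10' 5 ⟨2, by norm_num⟩
    have vϖ := h10' ϖ ⟨ϖ^4*5, by linear_combination -5*h⟩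
    rw [show ((2 : 𝓞 L) : L) = 2 from map_ofNat (algebraMap (𝓞 L) L) 2] at v2
    rw [show ((5 : 𝓞 L) : L) = 5 from map_ofNat (algebraMap (𝓞 L) L) 5] at v5
    let V := ((hos p hp).valuation L).valuationSubring
    have m2 : (2:L)⁻¹ ∈ V := by rw [Valuation.mem_valuationSubring_iff, map_inv₀]; rw [v2]; simp
    have m5 : (5:L)⁻¹ ∈ V := by rw [Valuation.mem_valuationSubring_iff, map_inv₀]; rw [v5]; simp
    have mθ : (-(1/(ϖ:L)^2)) ∈ V := by
      rw [Valuation.mem_valuationSubring_iff, Valuation.map_neg, map_div₀, map_pow, vϖ]; simp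
    obtain ⟨q, hq0, e, he, hqe⟩ := local_claim (V := V) ⟨_, mθ⟩ ⟨_, m2⟩ ⟨_, m5⟩
      (Subtype.ext (by push_cast; field_simp; rw [← show (2:L)^2 = 4 by norm_num, ← hϖ]; ring))
      (Subtype.ext (by push_cast; field_simp))
      (Subtype.ext (by push_cast; field_simp)) E1L E0L hwL hwL0
    have hev : (hos p hp).valuation L (e:L) = 1 :=
      by
      obtain ⟨e', he'⟩ := he.exists_right_inv
      have hL : (e:L) * (e':L) = 1 := congrArg (fun x : V => (x:L)) he'
      have h1 := congrArg ((hos p hp).valuation L) hL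
      rw [map_mul, map_one] at h1
      have hle := (Valuation.mem_valuationSubring_iff _ _).1 e.2
      have hle' := (Valuation.mem_valuationSubring_iff _ _).1 e'.2
      exact le_antisymm hle (by rw [← h1]; exact mul_le_of_le_one_right' hle')
    refine ⟨q * (ϖ:L)^2 * ((d1*d0:ℤ):L), ?_⟩
    have hβq : β = q^2 * e * (ϖ:L)^4 := by
      rw [← hqe]; dsimp only; rw [haβ]; field_simp
    have : (n:L) = (q * (ϖ:L)^2 * ((d1*d0:ℤ):L))^2 * e := by rw [hnβ, hβq]; ring
    rw [this, map_mul, hev, mul_one, map_pow])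
  -- norms
  have hN1 : Algebra.norm ℤ n = Algebra.norm ℤ (x:𝓞 L) * 2^i*5^j*(Algebra.norm ℤ s)^2 := by
    rw [hx]; simp only [map_mul, map_pow, norm_varpi h hf, norm_pi5 h hf]
  have hN2 : ((Algebra.norm ℤ n : ℤ) : ℚ) = ((w:ℚ) * (((d1*d0:ℤ):ℚ))^5)^2 := by
    rw [Algebra.coe_norm_int, hnβ, map_mul, hNβ, map_pow]
    have : ((d1*d0:ℤ):L) = algebraMap ℚ L ((d1*d0:ℤ):ℚ) := by simp
    rw [this, Algebra.norm_algebraMap, hf]; ring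
  have hs0 : s ≠ 0 := by rintro rfl; apply hn0; rw [hx]; ring
  have hNs : Algebra.norm ℤ s ≠ 0 := by simpa [Algebra.norm_eq_zero_iff] using hs0
  have hNx : Algebra.norm ℤ (x:𝓞 L) = 1 := by
    have hu : IsUnit (Algebra.norm ℤ (x:𝓞 L)) := x.isUnit.map _
    rcases Int.isUnit_iff.1 hu with hu | hu
    · exact hu
    · exfalso
      have h1 : ((Algebra.norm ℤ n : ℤ) : ℚ) ≥ 0 := by rw [hN2]; positivity
      rw [hN1, hu] at h1
      push_cast at h1
      have : (2:ℚ)^i*5^j*((Algebra.norm ℤ s:ℤ):ℚ)^2 > 0 := by positivity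
      linarith
  rw [hNx] at hN1
  have hsq : (2:ℚ)^i*5^j = ((w:ℚ) * (((d1*d0:ℤ):ℚ))^5/((Algebra.norm ℤ s:ℤ):ℚ))^2 := by
    rw [div_pow, ← hN2, hN1]; push_cast; field_simp
  obtain ⟨⟨i', rfl⟩, ⟨j', rfl⟩⟩ := sq_parity _ _ _ hsq
  obtain ⟨S, hS⟩ : ∃ S : 𝓞 L, S = ϖ^i' * (1+ϖ^2)^j' * s := ⟨_, rfl⟩
  have hx' : n = x * S^2 := by rw [hx, hS]; ring
  have hnmod : ϖ^4 ∣ n - ((d1*d0:ℤ):𝓞 L)^2 := by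
    rw [hn]
    exact ⟨ϖ*(d1*d0*(- n1*d0*ϖ^2+n0*d1*ϖ^4)), by
      push_cast; linear_combination -(d1*d0*(-n1*d0*ϖ^2+n0*d1*ϖ^4) : 𝓞 L)*h⟩
  have hSodd : ¬ ϖ ∣ S := by
    intro hh
    have h1 : ϖ ∣ n := by rw [hx']; exact (hh.trans (dvd_pow_self _ (by norm_num))).mul_left _
    have h2 : ϖ ∣ n - ((d1*d0:ℤ):𝓞 L)^2 := (dvd_pow_self _ (by norm_num)).trans hnmod
    exact hodd ((varpi_prime h hf).dvd_of_dvd_pow ((dvd_sub_right h1).1 h2))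
  obtain ⟨r, hr⟩ := unit_square h hf x hNx S _ hSodd hodd (by rw [← hx']; exact hnmod)
  refine ⟨(r:L)*S/((d1*d0:ℤ):L)/(ϖ:L)^2, ?_⟩
  rw [haβ]
  have : β = (n:L)/((d1*d0:ℤ):L)^2 := by rw [hnβ]; field_simp
  rw [this, hx', hr]
  push_cast
  field_simp

end Combine

end Part11

section Part12
open NumberField

theorem MW_of_fifth {L : Type*} [Field L] [NumberField L] {ϖ : 𝓞 L} (h : ϖ^5 = 2)
    (hf : Module.finrank ℚ L = 5) : MWStmt := by
  have hϖ : (ϖ:L)^5 = 2 := coe_fifth h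
  have hϖ0 : (ϖ:L) ≠ 0 := by intro h0; rw [h0] at hϖ; norm_num at hϖ
  intro a1 a0 m1 m0 hd
  refine datum_trivial_of_selmer (L := L) hf (-(1/(ϖ:L)^2)) ?_ ?_ (selmer_sq h hf) a1 a0 m1 m0 hd
  · field_simp; linear_combination ((ϖ:L)^5 + 2) * hϖ
  · intro p0 p1 p2 p3 p4 hp
    have h1 : -(1/(ϖ:L)^2) = -(ϖ:L)^3/2 := by field_simp; linear_combination hϖ
    have h2 : (-(1/(ϖ:L)^2))^2 = (ϖ:L)/2 := by field_simp; linear_combination -hϖ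
    have h3 : (-(1/(ϖ:L)^2))^3 = -(ϖ:L)^4/4 := by field_simp; linear_combination ((ϖ:L)^5+2)*hϖ
    have h4 : (-(1/(ϖ:L)^2))^4 = (ϖ:L)^2/4 := by field_simp; linear_combination (-(ϖ:L)^5-2)*hϖ
    rw [h4, h3, h2, h1] at hp
    have hs : ∑ i : Fin 5, (![p0, p2/2, p4/4, -p1/2, -p3/4] i) • (ϖ:L)^(i:ℕ) = 0 := by
      rw [Fin.sum_univ_five]
      simp only [Algebra.smul_def, Matrix.cons_val]
      simp only [map_div₀, map_neg, map_ofNat]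
      simp only [Fin.val_zero, Fin.val_one, Fin.val_two, Fin.isValue,
        show ((3 : Fin 5) : ℕ) = 3 from rfl, show ((4 : Fin 5) : ℕ) = 4 from rfl]
      linear_combination hp
    have hli := fifth_lin h
    rw [Fintype.linearIndependent_iff] at hli
    have hl := hli _ hs
    have k0 := hl 0
    have k1 := hl 1
    have k2 := hl 2
    have k3 := hl 3
    have k4 := hl 4
    simp at k0 k1 k2 k3 k4
    exact ⟨k0, k3, k1, k4, k2⟩

lemma fifth_int {L : Type*} [Field L] [NumberField L] {ρ : L} (hρ : ρ^5 = 2) : ∃ ϖ : 𝓞 L, ϖ^5 = 2 := by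
  have hintegral : IsIntegral ℤ ρ := ⟨X^5 - C 2, monic_X_pow_sub_C _ (by norm_num), by
    rw [eval₂_sub, eval₂_X_pow, eval₂_C, hρ]; simp⟩
  obtain ⟨ϖ, hϖ⟩ : ∃ ϖ : 𝓞 L, (ϖ:L) = ρ := ⟨⟨ρ, hintegral⟩, rfl⟩
  refine ⟨ϖ, ?_⟩
  apply RingOfIntegers.coe_injective
  rw [map_pow, map_ofNat, ← hρ, ← hϖ]

theorem MW_holds : MWStmt := by
  have hirr : Irreducible (X^5 - C 2 : ℚ[X]) := irr_X5
  have : Fact (Irreducible (X^5 - C 2 : ℚ[X])) := ⟨hirr⟩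
  have hmon : (X^5 - C 2 : ℚ[X]).Monic := monic_X_pow_sub_C _ (by norm_num)
  let L := AdjoinRoot (X^5 - C 2 : ℚ[X])
  have hfd : FiniteDimensional ℚ L := hmon.finite_adjoinRoot
  have : NumberField L := {}
  have hf : Module.finrank ℚ L = 5 := by
    rw [(AdjoinRoot.powerBasis hirr.ne_zero).finrank, AdjoinRoot.powerBasis_dim, natDegree_X_pow_sub_C]
  let ρ : L := AdjoinRoot.root _
  have hρ : ρ^5 = 2 := by
    have := AdjoinRoot.eval₂_root (X^5 - C 2 : ℚ[X])
    rw [eval₂_sub, eval₂_X_pow, eval₂_C, sub_eq_zero] at this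
    rw [this]; exact map_ofNat _ 2
  obtain ⟨ϖ, h⟩ := fifth_int (L := L) hρ
  exact MW_of_fifth h hf

end Part12

section Cubic

/-- the auxiliary cubic -/
noncomputable def hcub (e2 e3 : ℚ) : ℚ[X] := X^3 - X^2 + C e2 * X - C e3

lemma hcub_natDegree (e2 e3 : ℚ) : (hcub e2 e3).natDegree = 3 := by
  unfold hcub; compute_degree!

lemma hcub_irr (e2 e3 : ℚ) (hr : ∀ q : ℚ, q^3-q^2+e2*q-e3 ≠ 0) : Irreducible (hcub e2 e3) := by
  apply irreducible_of_degree_le_three_of_not_isRoot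
  · rw [hcub_natDegree]; decide
  · intro q hq
    apply hr q
    simpa [hcub, IsRoot] using hq

variable {e2 e3 : ℚ} {E : Type*} [Field E] [Algebra ℚ E]

lemma hcub_aeval {x y z : E} (s1 : x+y+z = 1) (s2 : x*y+y*z+z*x = algebraMap ℚ E e2)
    (s3 : x*y*z = algebraMap ℚ E e3) (a : E) :
    aeval a (hcub e2 e3) = (a-x)*(a-y)*(a-z) := by
  simp only [hcub, map_sub, map_add, map_mul, map_pow, aeval_X, aeval_C]
  rw [← s2, ← s3]
  linear_combination a^2 * s1

lemma hcub_roots {x y z : E} (s1 : x+y+z = 1) (s2 : x*y+y*z+z*x = algebraMap ℚ E e2)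
    (s3 : x*y*z = algebraMap ℚ E e3) (a : E) (ha : aeval a (hcub e2 e3) = 0) :
    a = x ∨ a = y ∨ a = z := by
  rw [hcub_aeval s1 s2 s3] at ha
  rcases mul_eq_zero.1 ha with ha | ha
  · rcases mul_eq_zero.1 ha with ha | ha
    · left; linear_combination ha
    · right; left; linear_combination ha
  · right; right; linear_combination ha

lemma gal_perm {x y z : E} (s1 : x+y+z = 1) (s2 : x*y+y*z+z*x = algebraMap ℚ E e2)
    (s3 : x*y*z = algebraMap ℚ E e3) (σ : E ≃ₐ[ℚ] E) {a : E} (ha : a = x ∨ a = y ∨ a = z) :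
    σ a = x ∨ σ a = y ∨ σ a = z := by
  apply hcub_roots s1 s2 s3
  have h0 : aeval a (hcub e2 e3) = 0 := by
    rw [hcub_aeval s1 s2 s3]; rcases ha with rfl | rfl | rfl <;> ring
  have := aeval_algHom_apply (σ : E →ₐ[ℚ] E) a (hcub e2 e3)
  rw [h0] at this
  simpa using this

lemma gal_eq_one [hE : IsSplittingField ℚ E (hcub e2 e3)] {x y z : E} (s1 : x+y+z = 1)
    (s2 : x*y+y*z+z*x = algebraMap ℚ E e2)
    (s3 : x*y*z = algebraMap ℚ E e3) (σ : E ≃ₐ[ℚ] E) (hx : σ x = x) (hy : σ y = y) : σ = 1 := by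
  have hz : σ z = z := by
    have : z = 1 - x - y := by linear_combination s1
    rw [this]; simp [hx, hy]
  have h := IsSplittingField.adjoin_rootSet E (hcub e2 e3)
  have := AlgHom.ext_of_adjoin_eq_top (φ₁ := (σ : E →ₐ[ℚ] E)) (φ₂ := AlgHom.id ℚ E) h (by
    intro a ha
    rw [mem_rootSet] at ha
    rcases hcub_roots s1 s2 s3 a ha.2 with rfl | rfl | rfl
    · exact hx
    · exact hy
    · exact hz)
  ext a
  exact DFunLike.congr_fun this a

/-- all data is distinct -/
lemma gal_distinct {x y z : E} (s1 : x+y+z = 1) (s2 : x*y+y*z+z*x = algebraMap ℚ E e2)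
    (s3 : x*y*z = algebraMap ℚ E e3)
    (hD : ∀ q : ℚ, q^2 ≠ e2^2-4*e2^3-4*e3+18*e2*e3-27*e3^2) :
    ((x-y)*(y-z)*(z-x))^2 = algebraMap ℚ E (e2^2-4*e2^3-4*e3+18*e2*e3-27*e3^2)
    ∧ x ≠ y ∧ y ≠ z ∧ z ≠ x := by
  have h1 : ((x-y)*(y-z)*(z-x))^2 = algebraMap ℚ E (e2^2-4*e2^3-4*e3+18*e2*e3-27*e3^2) := by
    simp only [map_sub, map_add, map_mul, map_pow, map_ofNat]
    rw [← s2, ← s3]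
    obtain rfl : z = 1 - x - y := by linear_combination s1
    ring
  have h2 : (x-y)*(y-z)*(z-x) ≠ 0 := by
    intro h0
    rw [h0] at h1
    apply hD 0
    apply (algebraMap ℚ E).injective
    rw [← h1]; simp
  refine ⟨h1, ?_, ?_, ?_⟩
  · rintro rfl; apply h2; ring
  · rintro rfl; apply h2; ring
  · rintro rfl; apply h2; ring

lemma gal_generator [hE : IsSplittingField ℚ E (hcub e2 e3)] [FiniteDimensional ℚ E] [IsGalois ℚ E]
    {x y z : E} (s1 : x+y+z = 1)
    (s2 : x*y+y*z+z*x = algebraMap ℚ E e2) (s3 : x*y*z = algebraMap ℚ E e3)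
    (hr : ∀ q : ℚ, q^3-q^2+e2*q-e3 ≠ 0)
    (hD : ∀ q : ℚ, q^2 ≠ e2^2-4*e2^3-4*e3+18*e2*e3-27*e3^2) (a : E) (ha : a * y = x) :
    ℚ⟮a⟯ = ⊤ := by
  obtain ⟨-, hxy, hyz, hzx⟩ := gal_distinct s1 s2 s3 hD
  have hfix : ℚ⟮a⟯.fixingSubgroup = ⊥ := by
    rw [eq_bot_iff]
    intro σ hσ
    rw [Subgroup.mem_bot]
    have hσa : σ a = a := (IntermediateField.mem_fixingSubgroup_iff _ _).1 hσ a (mem_adjoin_simple_self ℚ a)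
    have key : σ x * y = x * σ y := by
      rw [← ha, map_mul, hσa]; ring
    have hx0 : x ≠ 0 := by
      rintro rfl
      have : e3 = 0 := by apply (algebraMap ℚ E).injective; rw [← s3]; simp
      exact hr 0 (by rw [this]; ring)
    have hy0 : y ≠ 0 := by rintro rfl; apply hx0; rw [← ha]; ring
    have inj : ∀ b c, σ b = σ c → b = c := fun b c => σ.injective.eq_iff.1
    have hs1 : σ x + σ y + σ z = 1 := by rw [← map_add, ← map_add, s1, map_one]
    have hz1 : z ≠ 1 := by
      rintro rfl
      apply hr 1
      apply (algebraMap ℚ E).injective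
      simp only [map_sub, map_add, map_mul, map_pow, map_one, map_zero]
      rw [← s2, ← s3]; linear_combination -s1*0 + s1
    rcases gal_perm s1 s2 s3 σ (a := x) (Or.inl rfl) with h1 | h1 | h1
    · apply gal_eq_one s1 s2 s3 σ h1
      rw [h1] at key
      exact (mul_left_cancel₀ hx0 key).symm
    · exfalso
      rcases gal_perm s1 s2 s3 σ (a := y) (Or.inr (Or.inl rfl)) with h2 | h2 | h2
      · rw [h1, h2] at key
        have : (y - x) * (y + x) = 0 := by linear_combination key
        rcases mul_eq_zero.1 this with h | h
        · exact hxy (by linear_combination -h)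
        · exact hz1 (by linear_combination s1 - h)
      · exact hxy (inj _ _ (by rw [h1, h2]))
      · have h3 : σ z = x := by rw [h1, h2] at hs1; linear_combination hs1 - s1
        rw [h1, h2] at key
        have key2 := congrArg σ key
        rw [map_mul, map_mul, h1, h2, h3] at key2
        have : (y - z) * (x + y + z) = 0 := by linear_combination key - key2
        rw [s1, mul_one] at this
        exact hyz (by linear_combination this)
    · exfalso
      rcases gal_perm s1 s2 s3 σ (a := y) (Or.inr (Or.inl rfl)) with h2 | h2 | h2
      · have h3 : σ z = y := by rw [h1, h2] at hs1; linear_combination hs1 - s1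
        rw [h1, h2] at key
        have key2 := congrArg σ key
        rw [map_mul, map_mul, h1, h2, h3] at key2
        have : (z - x) * (x + y + z) = 0 := by linear_combination key - key2
        rw [s1, mul_one] at this
        exact hzx (by linear_combination this)
      · rw [h1, h2] at key
        exact hzx (mul_right_cancel₀ hy0 key)
      · exact hxy (inj _ _ (by rw [h1, h2]))
  rw [← IsGalois.fixedField_fixingSubgroup ℚ⟮a⟯, hfix, IntermediateField.fixedField_bot]

lemma gal_card [hE : IsSplittingField ℚ E (hcub e2 e3)] [FiniteDimensional ℚ E] [IsGalois ℚ E]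
    {x y z : E} (s1 : x+y+z = 1)
    (s2 : x*y+y*z+z*x = algebraMap ℚ E e2) (s3 : x*y*z = algebraMap ℚ E e3)
    (hr : ∀ q : ℚ, q^3-q^2+e2*q-e3 ≠ 0)
    (hD : ∀ q : ℚ, q^2 ≠ e2^2-4*e2^3-4*e3+18*e2*e3-27*e3^2) :
    Nat.card (E ≃ₐ[ℚ] E) = 6 ∧ Nonempty ((E ≃ₐ[ℚ] E) ≃* Equiv.Perm (Fin 3)) := by
  obtain ⟨hδ2, hxy, hyz, hzx⟩ := gal_distinct s1 s2 s3 hD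
  have hirr := hcub_irr e2 e3 hr
  have hsep : (hcub e2 e3).Separable := hirr.separable
  have hspl : ((hcub e2 e3).map (algebraMap ℚ E)).Splits := IsSplittingField.splits E _
  have : Fact ((hcub e2 e3).map (algebraMap ℚ E)).Splits := ⟨hspl⟩
  let φ := (IsSplittingField.algEquiv E (hcub e2 e3)).autCongr
  let ψ : (E ≃ₐ[ℚ] E) →* Equiv.Perm ((hcub e2 e3).rootSet E) :=
    (Gal.galActionHom (hcub e2 e3) E).comp φ.toMonoidHom
  have hψ : Function.Injective ψ := (Gal.galActionHom_injective _ _).comp φ.injective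
  have hc3 : Fintype.card ((hcub e2 e3).rootSet E) = 3 := by
    rw [card_rootSet_eq_natDegree hsep hspl, hcub_natDegree]
  let ε := Fintype.equivFinOfCardEq hc3
  have hcP : Nat.card (Equiv.Perm ((hcub e2 e3).rootSet E)) = 6 := by
    rw [Nat.card_congr ε.permCongr, Nat.card_eq_fintype_card, Fintype.card_perm]; rfl
  have hd6 : Nat.card (E ≃ₐ[ℚ] E) ∣ 6 := by
    rw [← hcP]; exact Subgroup.card_dvd_of_injective ψ hψ
  have h3 : 3 ∣ Nat.card (E ≃ₐ[ℚ] E) := by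
    have := Gal.prime_degree_dvd_card hirr (by rw [hcub_natDegree]; norm_num)
    rw [hcub_natDegree] at this
    rwa [Nat.card_congr φ.toEquiv]
  have hne3 : Nat.card (E ≃ₐ[ℚ] E) ≠ 3 := by
    intro hcard
    have hδ0 : (x-y)*(y-z)*(z-x) ≠ 0 := by
      refine mul_ne_zero (mul_ne_zero ?_ ?_) ?_ <;> rwa [sub_ne_zero]
    have hfix : ∀ σ : E ≃ₐ[ℚ] E, σ ((x-y)*(y-z)*(z-x)) = (x-y)*(y-z)*(z-x) := by
      intro σ
      obtain ⟨δ, hδ⟩ : ∃ δ, δ = (x-y)*(y-z)*(z-x) := ⟨_, rfl⟩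
      rw [← hδ] at hδ2 hδ0 ⊢
      have h1 : (σ δ)^2 = δ^2 := by
        rw [← map_pow, hδ2, AlgEquiv.commutes]
      rcases sq_eq_sq_iff_eq_or_eq_neg.1 h1 with h2 | h2
      · exact h2
      · exfalso
        have h3 : σ^3 = 1 := by rw [← hcard]; exact pow_card_eq_one'
        have h4 : (σ^3) δ = - δ := by
          change σ (σ (σ δ)) = _
          rw [h2, map_neg, h2, map_neg, map_neg, h2]; ring
        rw [h3] at h4
        have h5 : δ = - δ := h4
        have h6 : 2 * δ = 0 := by linear_combination h5
        have : CharZero E := charZero_of_injective_algebraMap (algebraMap ℚ E).injective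
        exact hδ0 ((mul_eq_zero.1 h6).resolve_left two_ne_zero)
    obtain ⟨q, hq⟩ := (IsGalois.mem_range_algebraMap_iff_fixed _).2 hfix
    apply hD q
    apply (algebraMap ℚ E).injective
    rw [← hδ2, ← hq, map_pow]
  have h6 : Nat.card (E ≃ₐ[ℚ] E) = 6 := by
    obtain ⟨k, hk⟩ := h3
    have : Nat.card (E ≃ₐ[ℚ] E) ≤ 6 := Nat.le_of_dvd (by norm_num) hd6
    have hk2 : k ≤ 2 := by omega
    interval_cases k
    · rw [hk] at hd6; norm_num at hd6
    · omega
    · omega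
  refine ⟨h6, ⟨(MulEquiv.ofBijective ψ ?_).trans ε.permCongrHom⟩⟩
  rw [Nat.bijective_iff_injective_and_card]
  exact ⟨hψ, by rw [h6, hcP]⟩

end Cubic

lemma quad_ne (t : ℚ) : t^2+t-1 ≠ 0 := by
  intro h
  have h5 : IsSquare ((5:ℕ):ℚ) := ⟨2*t+1, by push_cast; linear_combination -4*h⟩
  rw [Rat.isSquare_natCast_iff] at h5
  obtain ⟨r, hr⟩ := h5
  have : r ≤ 2 := by nlinarith
  interval_cases r <;> omega

/-- second elementary symmetric function -/
noncomputable def ee2 (t : ℚ) : ℚ := 1/(2-t)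
/-- third elementary symmetric function -/
noncomputable def ee3 (t : ℚ) : ℚ := -(t^2+t-1)/(5*(t-1)*(t-2))

lemma ee3_ne (t : ℚ) (h1 : t ≠ 1) (h2 : t ≠ 2) : ee3 t ≠ 0 := by
  have := quad_ne t
  have a1 : t - 1 ≠ 0 := sub_ne_zero.2 h1
  have a2 : t - 2 ≠ 0 := sub_ne_zero.2 h2
  unfold ee3
  exact div_ne_zero (neg_ne_zero.2 this) (mul_ne_zero (mul_ne_zero (by norm_num) a1) a2)

lemma ee_power (t : ℚ) (h1 : t ≠ 1) (h2 : t ≠ 2) :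
    1 - 5*ee2 t + 5*(ee2 t)^2 + 5*ee3 t - 5*ee2 t * ee3 t = 0 := by
  have a1 : t - 1 ≠ 0 := sub_ne_zero.2 h1
  have a2 : t - 2 ≠ 0 := sub_ne_zero.2 h2
  have a3 : 2 - t ≠ 0 := sub_ne_zero.2 h2.symm
  unfold ee2 ee3
  rw [show 2 - t = -(t-2) by ring]
  field_simp; ring

lemma cubic_no_root (t : ℚ) (h1 : t ≠ 1) (h2 : t ≠ 2) (q : ℚ) :
    q^3 - q^2 + ee2 t * q - ee3 t ≠ 0 := by
  intro h
  have hpow := ee_power t h1 h2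
  have h3 := ee3_ne t h1 h2
  obtain ⟨E2, hE2⟩ : ∃ x, x = ee2 t := ⟨_, rfl⟩
  obtain ⟨E3, hE3⟩ : ∃ x, x = ee3 t := ⟨_, rfl⟩
  rw [← hE2, ← hE3] at h
  rw [← hE2, ← hE3] at hpow
  rw [← hE3] at h3
  obtain ⟨s, hs⟩ : ∃ s, s = 1 - q := ⟨_, rfl⟩
  obtain ⟨p, hp⟩ : ∃ p, p = E2 - q*s := ⟨_, rfl⟩
  have e3 : E3 = q*p := by rw [hp, hs]; linear_combination -h
  have hq0 : q ≠ 0 := by rintro rfl; apply h3; rw [e3]; ring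
  have hp0 : p ≠ 0 := by intro h; apply h3; rw [e3, h]; ring
  have hrel : s^5 - 5*s^3*p + 5*s*p^2 + q^5 = 0 := by
    obtain rfl : E2 = p + q*s := by rw [hp]; ring
    subst e3
    obtain rfl : q = 1 - s := by rw [hs]; ring
    linear_combination hpow
  have hs0 : s ≠ 0 := by
    intro h0; rw [h0] at hrel
    exact hq0 (pow_eq_zero_iff (n := 5) (by norm_num) |>.1 (by linear_combination hrel))
  rcases curve_points MW_holds (-q/s) (p/s^2) (by field_simp; linear_combination -hrel) with h | h
  · exact (div_ne_zero hp0 (pow_ne_zero 2 hs0)) h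
  · have hps : p = s^2 := by field_simp at h; exact h
    rw [hps] at hrel
    have h5 : q^5 = (-s)^5 := by linear_combination hrel
    have : q = -s := (Odd.strictMono_pow (n := 5) (by decide)).injective h5
    rw [hs] at this; linarith

lemma cubic_disc (t : ℚ) (h1 : t ≠ 1) (h2 : t ≠ 2) (q : ℚ) :
    q^2 ≠ (ee2 t)^2-4*(ee2 t)^3-4*ee3 t+18*ee2 t*ee3 t-27*(ee3 t)^2 := by
  intro h
  have a1 : t - 1 ≠ 0 := sub_ne_zero.2 h1
  have a2 : t - 2 ≠ 0 := sub_ne_zero.2 h2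
  refine disc_not_square MW_holds t (5*q*(t-2)^2*(t-1)) h2 ?_
  rw [mul_pow, mul_pow, mul_pow, h]
  unfold ee2 ee3
  rw [show 2 - t = -(t-2) by ring]
  field_simp; ring

lemma prod_identity {x y z a E2 E3 : ℂ} (s1 : x+y+z = 1) (s2 : x*y+y*z+z*x = E2) (s3 : x*y*z = E3) :
    (x*a-y)*(y*a-x)*(x*a-z)*(z*a-x)*(y*a-z)*(z*a-y) =
    E3^2*a^6 + (3*E3^2-E2*E3)*a^5 + (6*E3^2+E3-5*E2*E3+E2^3)*a^4
    + (7*E3^2-2*E2*E3-(1-2*E2)*(E2^2-2*E3))*a^3 + (6*E3^2+E3-5*E2*E3+E2^3)*a^2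
    + (3*E3^2-E2*E3)*a+E3^2 := by
  obtain rfl : z = 1 - x - y := by linear_combination s1
  subst s2; subst s3
  ring

lemma f_coeffs (t : ℚ) (h1 : t ≠ 1) (h2 : t ≠ 2) :
    (ee3 t)^2 * u t = 3*(ee3 t)^2 - ee2 t*ee3 t ∧
    (ee3 t)^2 * v t = 6*(ee3 t)^2+ee3 t-5*ee2 t*ee3 t+(ee2 t)^3 ∧
    (ee3 t)^2 * w t = 7*(ee3 t)^2-2*ee2 t*ee3 t-(1-2*ee2 t)*((ee2 t)^2-2*ee3 t) := by
  have a1 : t - 1 ≠ 0 := sub_ne_zero.2 h1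
  have a2 : t - 2 ≠ 0 := sub_ne_zero.2 h2
  have a3 := quad_ne t
  unfold ee2 ee3 u v w
  rw [show 2 - t = -(t-2) by ring]
  obtain ⟨k, hk⟩ : ∃ k, k = t^2+t-1 := ⟨_, rfl⟩
  rw [← hk] at a3 ⊢
  refine ⟨?_, ?_, ?_⟩ <;> field_simp <;> rw [hk] <;> ring

lemma cubic_roots (E2 E3 : ℂ) : ∃ x y z : ℂ, x+y+z = 1 ∧ x*y+y*z+z*x = E2 ∧ x*y*z = E3 := by
  have hd : (X^3 - X^2 + C E2 * X - C E3 : ℂ[X]).degree ≠ 0 := by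
    have : (X^3 - X^2 + C E2 * X - C E3 : ℂ[X]).degree = 3 := by compute_degree!
    rw [this]; decide
  obtain ⟨x, hx⟩ := IsAlgClosed.exists_root _ hd
  have hd2 : (X^2 - C (1-x) * X + C (E2 - x*(1-x)) : ℂ[X]).degree ≠ 0 := by
    have : (X^2 - C (1-x) * X + C (E2 - x*(1-x)) : ℂ[X]).degree = 2 := by compute_degree!
    rw [this]; decide
  obtain ⟨y, hy⟩ := IsAlgClosed.exists_root _ hd2
  simp only [IsRoot, eval_add, eval_sub, eval_mul, eval_pow, eval_X, eval_C] at hx hy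
  refine ⟨x, y, 1-x-y, by ring, by linear_combination -hy, by linear_combination -x*hy + hx⟩

lemma exists_roots (t : ℚ) (h1 : t ≠ 1) (h2 : t ≠ 2) (α : ℂ) (hα : aeval α (f t) = 0) :
    ∃ x y z : ℂ, x+y+z = 1 ∧ x*y+y*z+z*x = algebraMap ℚ ℂ (ee2 t) ∧
      x*y*z = algebraMap ℚ ℂ (ee3 t) ∧ α * y = x := by
  obtain ⟨x, y, z, s1, s2, s3⟩ := cubic_roots (algebraMap ℚ ℂ (ee2 t)) (algebraMap ℚ ℂ (ee3 t))
  have hid := prod_identity (a := α) s1 s2 s3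
  obtain ⟨hu, hv, hw⟩ := f_coeffs t h1 h2
  have hu := congrArg (algebraMap ℚ ℂ) hu
  have hv := congrArg (algebraMap ℚ ℂ) hv
  have hw := congrArg (algebraMap ℚ ℂ) hw
  simp only [map_sub, map_add, map_mul, map_pow, map_ofNat, map_one] at hu hv hw
  simp only [f, map_add, map_mul, map_pow, aeval_X, aeval_C, map_one] at hα
  have h0 : (x*α-y)*(y*α-x)*(x*α-z)*(z*α-x)*(y*α-z)*(z*α-y) = 0 := by
    rw [hid]
    linear_combination (algebraMap ℚ ℂ (ee3 t))^2 * hα - (α^5+α)*hu - (α^4+α^2)*hv - α^3*hw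
  simp only [mul_eq_zero] at h0
  rcases h0 with ((((h0 | h0) | h0) | h0) | h0) | h0
  · exact ⟨y, x, z, by linear_combination s1, by linear_combination s2, by linear_combination s3, by linear_combination h0⟩
  · exact ⟨x, y, z, by linear_combination s1, by linear_combination s2, by linear_combination s3, by linear_combination h0⟩
  · exact ⟨z, x, y, by linear_combination s1, by linear_combination s2, by linear_combination s3, by linear_combination h0⟩
  · exact ⟨x, z, y, by linear_combination s1, by linear_combination s2, by linear_combination s3, by linear_combination h0⟩
  · exact ⟨z, y, x, by linear_combination s1, by linear_combination s2, by linear_combination s3, by linear_combination h0⟩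
  · exact ⟨y, z, x, by linear_combination s1, by linear_combination s2, by linear_combination s3, by linear_combination h0⟩

lemma adjoin_eq_of_top (M : IntermediateField ℚ ℂ) (α : ℂ) (hα : α ∈ M)
    (h : ℚ⟮(⟨α, hα⟩ : M)⟯ = ⊤) : ℚ⟮α⟯ = M := by
  exact (lift_adjoin_simple ℚ M ⟨α, hα⟩).symm.trans ((congrArg IntermediateField.lift h).trans (lift_top (F := ℚ) (K := M)))

/-- If `t ≠ 1, 2` is rational and `α ∈ ℂ` is a root of `f t`, then `ℚ(α)/ℚ` is a Galois
extension of degree `6` whose Galois group is isomorphic to `S₃`. -/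
theorem adjoin_root_galois_S3 (t : ℚ) (h1 : t ≠ 1) (h2 : t ≠ 2) (α : ℂ)
    (hα : Polynomial.aeval α (f t) = 0) :
    Module.finrank ℚ ℚ⟮α⟯ = 6 ∧ IsGalois ℚ ℚ⟮α⟯ ∧
      Nonempty ((ℚ⟮α⟯ ≃ₐ[ℚ] ℚ⟮α⟯) ≃* Equiv.Perm (Fin 3)) := by
  obtain ⟨x, y, z, s1, s2, s3, hxy⟩ := exists_roots t h1 h2 α hα
  have hr := cubic_no_root t h1 h2
  have hD := cubic_disc t h1 h2
  have hirr := hcub_irr _ _ hr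
  let M : IntermediateField ℚ ℂ := adjoin ℚ ((hcub (ee2 t) (ee3 t)).rootSet ℂ)
  have hM : IsSplittingField ℚ M (hcub (ee2 t) (ee3 t)) :=
    adjoin_rootSet_isSplittingField (IsAlgClosed.splits _)
  have hfd : FiniteDimensional ℚ M := IsSplittingField.finiteDimensional M (hcub (ee2 t) (ee3 t))
  have hG : IsGalois ℚ M := IsGalois.of_separable_splitting_field hirr.separable
  have hmem : ∀ a : ℂ, (a-x)*(a-y)*(a-z) = 0 → a ∈ M := fun a ha =>
    subset_adjoin _ _ (by rw [mem_rootSet]; exact ⟨hirr.ne_zero, by rw [hcub_aeval s1 s2 s3, ha]⟩)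
  have hx := hmem x (by ring)
  have hy := hmem y (by ring)
  have hz := hmem z (by ring)
  have hy0 : y ≠ 0 := by
    rintro rfl
    apply ee3_ne t h1 h2
    apply (algebraMap ℚ ℂ).injective
    rw [← s3]; simp
  have hαM : α ∈ M := by
    have : α = x / y := by field_simp; exact hxy
    rw [this]; exact M.div_mem hx hy
  have s1' : (⟨x, hx⟩ : M) + ⟨y, hy⟩ + ⟨z, hz⟩ = 1 := Subtype.ext s1
  have s2' : (⟨x, hx⟩ : M) * ⟨y, hy⟩ + ⟨y, hy⟩ * ⟨z, hz⟩ + ⟨z, hz⟩ * ⟨x, hx⟩ = algebraMap ℚ M (ee2 t) :=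
    Subtype.ext s2
  have s3' : (⟨x, hx⟩ : M) * ⟨y, hy⟩ * ⟨z, hz⟩ = algebraMap ℚ M (ee3 t) := Subtype.ext s3
  have hgen := gal_generator s1' s2' s3' hr hD ⟨α, hαM⟩ (Subtype.ext hxy)
  obtain ⟨hcard, hiso⟩ := gal_card s1' s2' s3' hr hD
  have heq : ℚ⟮α⟯ = M := adjoin_eq_of_top M α hαM hgen
  rw [heq]
  exact ⟨by rw [← IsGalois.card_aut_eq_finrank, hcard], hG, hiso⟩
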